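/- Let U_s be an admissible shear flow satisfying Criterion 2: ξ(0) = 0 and ξ₋(0) > ξ₊(0). Then there exist K, η, γ₊ > 0 such that for every integer k ≥ K and every ν > 0 with (√ν k)⁻¹ ≤ γ₊, there exists μ_{k,ν} ∈ ℂ with Im μ_{k,ν} ≥ η and a smooth function φ : [0,∞) → ℂ satisfying (μ_{k,ν} − U_s)φ' + U_s' φ − (i/k) φ''' = F, φ(0) = 0, φ'(0) = 1, φ'(y) → 0 and φ(y) → 1/(√ν k) as y → ∞. Equivalently, λ_{k,ν} := −i k μ_{k,ν} satisfies Re λ_{k,ν} ≥ η k and the linearized Interactive Boundary Layer (IBL) system displays a (λ_{k,ν}, k) instability. -/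

import Mathlib

open MeasureTheory Filter Set

noncomputable section

/-- The source term `F(y) = 1 - U(y) + y U'(y)` of the eigenmode ODE. -/
def srcF (U : ℝ → ℝ) (y : ℝ) : ℝ := 1 - U y + y * deriv U y

/-- The displacement thickness `Δ_s = ∫₀^∞ (1 - U)`. -/
def deltaS (U : ℝ → ℝ) : ℝ := ∫ y in Ioi (0:ℝ), (1 - U y)

/-- An admissible shear flow: smooth, monotone, `U(0) = 0`, `U → 1`,
`U''(0) ≠ 0`, finitely many inflexion points, and the decay conditions of the paper. -/
structure AdmissibleShearFlow (U : ℝ → ℝ) : Prop where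
  smooth : ContDiff ℝ (⊤ : ℕ∞) U
  mem_Ico : ∀ y, 0 ≤ y → U y ∈ Ico (0:ℝ) 1
  zero_val : U 0 = 0
  deriv_pos : ∀ y, 0 ≤ y → 0 < deriv U y
  tendsto_one : Tendsto U atTop (nhds 1)
  snd_deriv_zero_ne : iteratedDeriv 2 U 0 ≠ 0
  finite_inflexions : {y : ℝ | 0 < y ∧ iteratedDeriv 2 U y = 0}.Finite
  integrable_defect : IntegrableOn (fun y => 1 - U y) (Ioi (0:ℝ))
  derivs_bounded : ∀ j : ℕ, 1 ≤ j → j ≤ 3 →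
    ∃ M : ℝ, ∀ y, 0 ≤ y → |iteratedDeriv j U y| ≤ M
  decay_ratio₁ : Tendsto (fun y => (1 - U y) ^ 2 / deriv U y) atTop (nhds 0)
  decay_ratio₂ : Tendsto (fun y => y * (1 - U y)) atTop (nhds 0)
  decay_ratio₃ : IntegrableOn
    (fun y => (1 - U y) ^ 2 * iteratedDeriv 2 U y / (deriv U y) ^ 2) (Ioi (0:ℝ))
  kappa_decay : ∃ κ : ℝ, 0 < κ ∧ κ < 1/2 ∧ ∃ yκ > (0:ℝ), ∃ cκ > (0:ℝ),
    ∀ y, yκ ≤ y →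
      (1 - U y) ^ ((2:ℝ) - κ) * iteratedDeriv 2 U y ≤ -cκ * (deriv U y) ^ 3

/-- `φ` is a smooth solution of the eigenmode problem
`(μ - U_s)φ' + U_s'φ - (i/k)φ''' = F`, `φ(0) = 0`, `φ'(0) = 1`, `φ' → 0`, `φ → L`. -/
def IsEigSolution (U : ℝ → ℝ) (μ : ℂ) (k : ℝ) (L : ℂ) (φ : ℝ → ℂ) : Prop :=
  ContDiff ℝ (⊤ : ℕ∞) φ ∧
  (∀ y, 0 ≤ y →
    (μ - (U y : ℂ)) * deriv φ y + ((deriv U y : ℝ) : ℂ) * φ y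
      - Complex.I / (k : ℂ) * iteratedDeriv 3 φ y = (srcF U y : ℂ)) ∧
  φ 0 = 0 ∧ deriv φ 0 = 1 ∧
  Tendsto (deriv φ) atTop (nhds 0) ∧
  Tendsto φ atTop (nhds L)

/-- Same problem without the prescribed limit at infinity. -/
def IsBLSolution (U : ℝ → ℝ) (μ : ℂ) (k : ℝ) (φ : ℝ → ℂ) : Prop :=
  ContDiff ℝ (⊤ : ℕ∞) φ ∧
  (∀ y, 0 ≤ y →
    (μ - (U y : ℂ)) * deriv φ y + ((deriv U y : ℝ) : ℂ) * φ y
      - Complex.I / (k : ℂ) * iteratedDeriv 3 φ y = (srcF U y : ℂ)) ∧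
  φ 0 = 0 ∧ deriv φ 0 = 1 ∧ Tendsto (deriv φ) atTop (nhds 0)

/-- Cauchy principal value `PV ∫₀¹ h(u)/(u - a) du`. -/
def pvIntegral (h : ℝ → ℝ) (a : ℝ) : ℝ :=
  limUnder (nhdsWithin (0:ℝ) (Ioi 0))
    (fun ε => ∫ u in Ioo (0:ℝ) 1 \ Ioo (a - ε) (a + ε), h u / (u - a))

/-- Inverse of the shear flow on `[0, ∞)`. -/
def shearInv (U : ℝ → ℝ) (u : ℝ) : ℝ := Function.invFunOn U (Ici 0) u

/-- `g(u) = (1-u)² U''(U⁻¹(u)) / (U'(U⁻¹(u)))³`. -/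
def gfun (U : ℝ → ℝ) (u : ℝ) : ℝ :=
  (1 - u) ^ 2 * iteratedDeriv 2 U (shearInv U u) / (deriv U (shearInv U u)) ^ 3

/-- `G(a) = 1/(a U'(0)) + PV ∫₀¹ g(u)/(u-a) du + iπ g(a)`. -/
def Gfun (U : ℝ → ℝ) (a : ℝ) : ℂ :=
  ((1 / (a * deriv U 0) + pvIntegral (gfun U) a : ℝ) : ℂ)
    + Complex.I * ((Real.pi * gfun U a : ℝ) : ℂ)

/-- Crossing abscissa `χ(y) = Re G(U(y))`. -/
def chiAbscissa (U : ℝ → ℝ) (y : ℝ) : ℝ := (Gfun U (U y)).re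

/-- `ξ(γ)`: number of zeros of `U''` in `(0,∞)` with `χ(yᵢ) = γ`. -/
def xiEq (U : ℝ → ℝ) (γ : ℝ) : ℕ :=
  {y : ℝ | 0 < y ∧ iteratedDeriv 2 U y = 0 ∧ chiAbscissa U y = γ}.ncard

/-- `ξ₊(γ)`: zeros of `U''` with `χ(yᵢ) < γ`, `U'' < 0` on the left and `U'' > 0`
on the right. -/
def xiPlus (U : ℝ → ℝ) (γ : ℝ) : ℕ :=
  {y : ℝ | 0 < y ∧ iteratedDeriv 2 U y = 0 ∧ chiAbscissa U y < γ ∧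
    ∃ δ > (0:ℝ), (∀ z ∈ Ioo (y - δ) y, iteratedDeriv 2 U z < 0) ∧
      (∀ z ∈ Ioo y (y + δ), 0 < iteratedDeriv 2 U z)}.ncard

/-- `ξ₋(γ)`: zeros of `U''` with `χ(yᵢ) < γ`, `U'' > 0` on the left and `U'' < 0`
on the right. -/
def xiMinus (U : ℝ → ℝ) (γ : ℝ) : ℕ :=
  {y : ℝ | 0 < y ∧ iteratedDeriv 2 U y = 0 ∧ chiAbscissa U y < γ ∧
    ∃ δ > (0:ℝ), (∀ z ∈ Ioo (y - δ) y, 0 < iteratedDeriv 2 U z) ∧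
      (∀ z ∈ Ioo y (y + δ), iteratedDeriv 2 U z < 0)}.ncard

/-- `Φ_inv(μ) = (μ - 1) ∫₀^∞ F(y)/(μ - U(y))² dy`. -/
def PhiInv (U : ℝ → ℝ) (μ : ℂ) : ℂ :=
  (μ - 1) * ∫ y in Ioi (0:ℝ), (srcF U y : ℂ) / (μ - (U y : ℂ)) ^ 2

/-- A weight function `ω ≥ 1` with `C_ω < ∞`. -/
structure WeightFn (ω : ℝ → ℝ) : Prop where
  pos : ∀ y, 0 ≤ y → 0 < ω y
  contDiff : ContDiff ℝ 1 ω
  one_le : ∀ y, 0 ≤ y → 1 ≤ ω y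
  integrable_inv : IntegrableOn (fun y => 1 / ω y) (Ioi (0:ℝ))
  deriv_ratio_bdd : ∃ M : ℝ, ∀ y, 0 ≤ y → |deriv ω y / ω y| ≤ M
  log_ratio_bdd : ∃ M : ℝ, ∀ y, 0 ≤ y → Real.log (ω y) / (1 + y) ≤ M

/-- Weighted decay conditions: `(1-U_s) ∈ L²(ω)` and `(1+y)U_s^{(j)} ∈ L²(ω)`, `j = 1,2,3`. -/
def WeightedDecay (U ω : ℝ → ℝ) : Prop :=
  IntegrableOn (fun y => (1 - U y) ^ 2 * ω y) (Ioi (0:ℝ)) ∧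
  ∀ j : ℕ, 1 ≤ j → j ≤ 3 →
    IntegrableOn (fun y => ((1 + y) * iteratedDeriv j U y) ^ 2 * ω y) (Ioi (0:ℝ))

/-- Membership in the weighted space `L²(ω)`. -/
def MemL2w (ω : ℝ → ℝ) (f : ℝ → ℂ) : Prop :=
  IntegrableOn (fun y => ‖f y‖ ^ 2 * ω y) (Ioi (0:ℝ))

/-- The `L²(ω)` norm. -/
def wNorm (ω : ℝ → ℝ) (f : ℝ → ℂ) : ℝ :=
  Real.sqrt (∫ y in Ioi (0:ℝ), ‖f y‖ ^ 2 * ω y)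

/-- `φ` solves the homogeneous-boundary-conditions resolvent problem with forcing `f`. -/
def SolvesHom (U : ℝ → ℝ) (μ : ℂ) (k : ℝ) (f φ : ℝ → ℂ) : Prop :=
  ContDiff ℝ 2 φ ∧
  (∀ᵐ y ∂(volume.restrict (Ioi (0:ℝ))),
    (μ - (U y : ℂ)) * deriv φ y + ((deriv U y : ℝ) : ℂ) * φ y
      - Complex.I / (k : ℂ) * iteratedDeriv 3 φ y = f y) ∧
  φ 0 = 0 ∧ deriv φ 0 = 0 ∧ Tendsto (deriv φ) atTop (nhds 0)

/-- Parameterization on `[0,1]` of the contour `C_η`: the segment from `iη` to `1 + iη`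
followed by the upper half-circle of radius `1/2` centered at `1/2 + iη`. -/
def Ceta (η : ℝ) (t : ℝ) : ℂ :=
  if t ≤ 1/2 then ((2*t : ℝ) : ℂ) + (η : ℂ) * Complex.I
  else (1/2 : ℂ) + (η : ℂ) * Complex.I
    + (1/2 : ℂ) * Complex.exp (((Real.pi * (2*t - 1) : ℝ)) * Complex.I)

/-- Winding number `(1/2πi) ∮ dz/(z - p)` of a closed curve parameterized on `[0,1]`. -/
def windingNumber (c : ℝ → ℂ) (p : ℂ) : ℂ :=
  (((2 * Real.pi : ℝ) : ℂ) * Complex.I)⁻¹ * ∫ t in (0:ℝ)..1, deriv c t / (c t - p)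

/-- `q_μ(x) = |μ - x|⁴ - (2μ - 1 - x)(μ̄ - x)²`. -/
def qmu (μ : ℂ) (x : ℝ) : ℂ :=
  ((‖μ - (x:ℂ)‖ ^ 4 : ℝ) : ℂ) - (2*μ - 1 - (x:ℂ)) * ((starRingEnd ℂ) μ - (x:ℂ))^2

/-- `f(α) = -2iΔ_s/α + 1/√α`, principal square root (positive real part for `Re α > 0`). -/
def fIBL (Δ : ℝ) (α : ℂ) : ℂ := (-2 * Complex.I * (Δ:ℂ)) / α + 1 / (α ^ (1/2 : ℂ))

noncomputable section

namespace AdmissibleShearFlow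
open Topology

theorem hasDeriv {U : ℝ → ℝ} (hU : AdmissibleShearFlow U) (y : ℝ) :
    HasDerivAt U (deriv U y) y :=
  (hU.smooth.differentiable (by simp)).differentiableAt.hasDerivAt

theorem iter2 (U : ℝ → ℝ) : iteratedDeriv 2 U = deriv (deriv U) := by
  rw [iteratedDeriv_succ, iteratedDeriv_one]

theorem smooth1 {U : ℝ → ℝ} (hU : AdmissibleShearFlow U) : ContDiff ℝ (⊤ : ℕ∞) (deriv U) := by
  have h := hU.smooth
  rw [show ((⊤ : ℕ∞) : WithTop ℕ∞) = ((⊤ : ℕ∞) : WithTop ℕ∞) + 1 by rfl, contDiff_succ_iff_deriv] at h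
  exact h.2.2

theorem smooth2 {U : ℝ → ℝ} (hU : AdmissibleShearFlow U) :
    ContDiff ℝ (⊤ : ℕ∞) (iteratedDeriv 2 U) := by
  rw [iter2]
  have h := hU.smooth1
  rw [show ((⊤ : ℕ∞) : WithTop ℕ∞) = ((⊤ : ℕ∞) : WithTop ℕ∞) + 1 by rfl, contDiff_succ_iff_deriv] at h
  exact h.2.2

theorem hasDeriv2 {U : ℝ → ℝ} (hU : AdmissibleShearFlow U) (y : ℝ) :
    HasDerivAt (deriv U) (iteratedDeriv 2 U y) y := by
  rw [iter2]
  exact (hU.smooth1.differentiable (by simp)).differentiableAt.hasDerivAt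

theorem cont {U : ℝ → ℝ} (hU : AdmissibleShearFlow U) : Continuous U := hU.smooth.continuous
theorem cont1 {U : ℝ → ℝ} (hU : AdmissibleShearFlow U) : Continuous (deriv U) :=
  hU.smooth1.continuous
theorem cont2 {U : ℝ → ℝ} (hU : AdmissibleShearFlow U) : Continuous (iteratedDeriv 2 U) :=
  hU.smooth2.continuous
theorem contF {U : ℝ → ℝ} (hU : AdmissibleShearFlow U) : Continuous (srcF U) := by
  have := hU.cont
  have := hU.cont1
  unfold srcF
  fun_prop

theorem nonneg {U : ℝ → ℝ} (hU : AdmissibleShearFlow U) {y : ℝ} (hy : 0 ≤ y) : 0 ≤ U y :=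
  (hU.mem_Ico y hy).1
theorem lt_one {U : ℝ → ℝ} (hU : AdmissibleShearFlow U) {y : ℝ} (hy : 0 ≤ y) : U y < 1 :=
  (hU.mem_Ico y hy).2

theorem strictMono {U : ℝ → ℝ} (hU : AdmissibleShearFlow U) : StrictMonoOn U (Ici 0) := by
  apply strictMonoOn_of_deriv_pos (convex_Ici 0) hU.cont.continuousOn
  intro x hx
  rw [interior_Ici] at hx
  exact hU.deriv_pos x (le_of_lt hx)

theorem hasDerivF {U : ℝ → ℝ} (hU : AdmissibleShearFlow U) (y : ℝ) :
    HasDerivAt (srcF U) (y * iteratedDeriv 2 U y) y := by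
  have h := ((hasDerivAt_const y (1:ℝ)).sub (hU.hasDeriv y)).add
    ((hasDerivAt_id y).mul (hU.hasDeriv2 y))
  refine h.congr_deriv ?_
  simp

theorem F_nonneg {U : ℝ → ℝ} (hU : AdmissibleShearFlow U) {y : ℝ} (hy : 0 ≤ y) :
    0 ≤ srcF U y := by
  have h1 := hU.lt_one hy
  have h2 := mul_nonneg hy (hU.deriv_pos y hy).le
  unfold srcF; linarith

theorem eventually_snd_neg {U : ℝ → ℝ} (hU : AdmissibleShearFlow U) :
    ∃ Y : ℝ, 0 < Y ∧ ∀ y, Y ≤ y → iteratedDeriv 2 U y < 0 := by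
  obtain ⟨κ, hκ, hκ2, Y, hY, c, hc, h⟩ := hU.kappa_decay
  refine ⟨Y, hY, fun y hy => ?_⟩
  have h0 : 0 ≤ y := hY.le.trans hy
  have h1 := h y hy
  have h2 : 0 < (1 - U y) ^ ((2:ℝ) - κ) := Real.rpow_pos_of_pos (by linarith [hU.lt_one h0]) _
  have h3 : 0 < c * (deriv U y) ^ 3 := mul_pos hc (pow_pos (hU.deriv_pos y h0) 3)
  by_contra hcon
  push Not at hcon
  have := mul_nonneg h2.le hcon
  linarith

end AdmissibleShearFlow

/-- A function which is eventually nonincreasing and nonnegative has an integrable derivative. -/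
theorem integrable_deriv_of_anti {f f' : ℝ → ℝ} (hf : ∀ y, HasDerivAt f (f' y) y)
    (hc : Continuous f') {Y : ℝ} (hY : 0 < Y) (hneg : ∀ y, Y ≤ y → f' y ≤ 0)
    (hpos : ∀ y, Y ≤ y → 0 ≤ f y) : IntegrableOn f' (Ioi 0) := by
  have hanti : AntitoneOn f (Ici Y) := by
    apply antitoneOn_of_deriv_nonpos (convex_Ici Y)
    · exact fun y _ => (hf y).continuousAt.continuousWithinAt
    · exact fun y _ => (hf y).differentiableAt.differentiableWithinAt
    · intro y hy
      rw [interior_Ici] at hy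
      rw [(hf y).deriv]; exact hneg y (le_of_lt hy)
  have h2 : Antitone (fun y => f (max y Y)) := by
    intro a b hab
    exact hanti (mem_Ici.2 (le_max_right _ _)) (mem_Ici.2 (le_max_right _ _)) (max_le_max_right Y hab)
  have h3 : Tendsto (fun y => f (max y Y)) atTop (nhds (⨅ y, f (max y Y))) := by
    apply tendsto_atTop_ciInf h2
    exact ⟨0, by rintro _ ⟨y, rfl⟩; exact hpos _ (le_max_right _ _)⟩
  have h4 : Tendsto f atTop (nhds (⨅ y, f (max y Y))) := by
    refine h3.congr' ?_
    filter_upwards [eventually_ge_atTop Y] with y hy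
    rw [max_eq_left hy]
  have h5 : IntegrableOn f' (Ioi Y) :=
    integrableOn_Ioi_deriv_of_nonpos' (fun x _ => hf x) (fun x hx => hneg x (le_of_lt hx)) h4
  have h6 : IntegrableOn f' (Ioc 0 Y) := (hc.integrableOn_Icc).mono_set Ioc_subset_Icc_self
  rw [← Ioc_union_Ioi_eq_Ioi hY.le]
  exact h6.union h5

namespace AdmissibleShearFlow
open Topology

theorem int_U1 {U : ℝ → ℝ} (hU : AdmissibleShearFlow U) : IntegrableOn (deriv U) (Ioi 0) :=
  integrableOn_Ioi_deriv_of_nonneg' (fun x _ => hU.hasDeriv x)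
    (fun x hx => (hU.deriv_pos x (le_of_lt hx)).le) hU.tendsto_one

theorem int_U2 {U : ℝ → ℝ} (hU : AdmissibleShearFlow U) :
    IntegrableOn (iteratedDeriv 2 U) (Ioi 0) := by
  obtain ⟨Y, hY, h⟩ := hU.eventually_snd_neg
  exact integrable_deriv_of_anti hU.hasDeriv2 hU.cont2 hY (fun y hy => (h y hy).le)
    (fun y hy => (hU.deriv_pos y (hY.le.trans hy)).le)

theorem int_yU2 {U : ℝ → ℝ} (hU : AdmissibleShearFlow U) :
    IntegrableOn (fun y => y * iteratedDeriv 2 U y) (Ioi 0) := by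
  obtain ⟨Y, hY, h⟩ := hU.eventually_snd_neg
  refine integrable_deriv_of_anti hU.hasDerivF ?_ hY
    (fun y hy => mul_nonpos_of_nonneg_of_nonpos (hY.le.trans hy) (h y hy).le)
    (fun y hy => hU.F_nonneg (hY.le.trans hy))
  have := hU.cont2
  fun_prop

theorem int_F {U : ℝ → ℝ} (hU : AdmissibleShearFlow U) : IntegrableOn (srcF U) (Ioi 0) := by
  have hcU := hU.cont
  have hcont : Continuous fun y => 1 - U y := by fun_prop
  have hd : ∀ y, HasDerivAt (fun y => y * (1 - U y) - ∫ t in (0:ℝ)..y, (1 - U t))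
      (-(y * deriv U y)) y := by
    intro y
    have h1 := (hasDerivAt_id y).mul ((hasDerivAt_const y (1:ℝ)).sub (hU.hasDeriv y))
    have h2 := intervalIntegral.integral_hasDerivAt_right (hcont.intervalIntegrable 0 y)
      (hcont.stronglyMeasurableAtFilter _ _) hcont.continuousAt
    refine (h1.sub h2).congr_deriv ?_
    simp
  have ht : Tendsto (fun y => y * (1 - U y) - ∫ t in (0:ℝ)..y, (1 - U t)) atTop
      (𝓝 (0 - ∫ t in Ioi (0:ℝ), (1 - U t))) :=
    hU.decay_ratio₂.sub (intervalIntegral_tendsto_integral_Ioi 0 hU.integrable_defect tendsto_id)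
  have h := integrableOn_Ioi_deriv_of_nonpos' (fun x _ => hd x)
    (fun x hx => by
      have := mul_nonneg (le_of_lt hx) (hU.deriv_pos x (le_of_lt hx)).le
      linarith) ht
  have h' := hU.integrable_defect.sub h
  refine h'.congr (ae_of_all _ fun y => ?_)
  simp [srcF]

theorem integral_U1_Ioi {U : ℝ → ℝ} (hU : AdmissibleShearFlow U) {x : ℝ} (hx : 0 ≤ x) :
    ∫ y in Ioi x, deriv U y = 1 - U x :=
  integral_Ioi_of_hasDerivAt_of_tendsto' (fun y _ => hU.hasDeriv y)
    (hU.int_U1.mono_set (Ioi_subset_Ioi hx)) hU.tendsto_one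

end AdmissibleShearFlow
end

noncomputable section
open Topology

theorem intMul {p : ℝ → ℝ} (hp : IntegrableOn p (Ioi 0)) {c : ℝ → ℂ} (hc : Continuous c) {C : ℝ}
    (hb : ∀ y, 0 ≤ y → ‖c y‖ ≤ C) : IntegrableOn (fun y => (p y : ℂ) * c y) (Ioi 0) := by
  refine Integrable.mul_bdd (c := C) hp.ofReal hc.aestronglyMeasurable ?_
  filter_upwards [ae_restrict_mem measurableSet_Ioi] with y hy
  exact hb y (le_of_lt hy)

theorem sub_ne {μ : ℂ} (hμ : 0 < μ.im) (u : ℝ) : μ - (u : ℂ) ≠ 0 := by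
  intro h
  have := congrArg Complex.im h
  simp at this
  exact hμ.ne' this

theorem im_le_norm (μ : ℂ) (u : ℝ) : μ.im ≤ ‖μ - (u : ℂ)‖ := by
  have := Complex.abs_im_le_norm (μ - (u:ℂ))
  simp at this
  exact (le_abs_self _).trans this

theorem inv_bd {μ : ℂ} (hμ : 0 < μ.im) (u : ℝ) : ‖(μ - (u : ℂ))⁻¹‖ ≤ 1 / μ.im := by
  rw [norm_inv, one_div]
  exact inv_anti₀ hμ (im_le_norm μ u)

namespace AdmissibleShearFlow

theorem hasDerivC {U : ℝ → ℝ} (hU : AdmissibleShearFlow U) (y : ℝ) :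
    HasDerivAt (fun y => (U y : ℂ)) ((deriv U y : ℝ) : ℂ) y := (hU.hasDeriv y).ofReal_comp

theorem hasDerivC2 {U : ℝ → ℝ} (hU : AdmissibleShearFlow U) (y : ℝ) :
    HasDerivAt (fun y => ((deriv U y : ℝ) : ℂ)) ((iteratedDeriv 2 U y : ℝ) : ℂ) y :=
  (hU.hasDeriv2 y).ofReal_comp

theorem cont_inv {U : ℝ → ℝ} (hU : AdmissibleShearFlow U) {μ : ℂ} (hμ : 0 < μ.im) :
    Continuous (fun y => (μ - (U y : ℂ))⁻¹) := by
  have := hU.cont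
  exact Continuous.inv₀ (by fun_prop) (fun y => sub_ne hμ _)

theorem hasDeriv_inv {U : ℝ → ℝ} (hU : AdmissibleShearFlow U) {μ : ℂ} (hμ : 0 < μ.im) (y : ℝ) :
    HasDerivAt (fun y => (μ - (U y : ℂ))⁻¹) (((deriv U y : ℝ) : ℂ) * (μ - (U y : ℂ))⁻¹ ^ 2) y := by
  have h := ((hasDerivAt_const y μ).sub (hU.hasDerivC y)).inv (sub_ne hμ _)
  refine h.congr_deriv ?_
  have := sub_ne hμ (U y)
  simp only [Pi.sub_apply]
  field_simp
  simp

theorem tendsto_inv {U : ℝ → ℝ} (hU : AdmissibleShearFlow U) {μ : ℂ} (hμ : 0 < μ.im) :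
    Tendsto (fun y => (μ - (U y : ℂ))⁻¹) atTop (𝓝 ((μ - 1)⁻¹)) := by
  refine Tendsto.inv₀ ?_ (by simpa using sub_ne hμ 1)
  refine tendsto_const_nhds.sub ?_
  exact (Complex.continuous_ofReal.tendsto 1).comp hU.tendsto_one

theorem int_R1 {U : ℝ → ℝ} (hU : AdmissibleShearFlow U) {μ : ℂ} (hμ : 0 < μ.im) :
    IntegrableOn (fun y => ((1 - U y : ℝ) : ℂ) * ((2 * μ - 1 - U y) * (μ - (U y : ℂ))⁻¹ ^ 2))
      (Ioi 0) := by
  have hc := hU.cont_inv hμ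
  have hc0 := hU.cont
  refine intMul hU.integrable_defect (C := (‖2 * μ - 1‖ + 1) * (1 / μ.im) ^ 2) (by fun_prop) ?_
  intro y hy
  rw [norm_mul, norm_pow]
  have h1 : ‖(U y : ℂ)‖ ≤ 1 := by
    rw [Complex.norm_real, Real.norm_eq_abs, abs_of_nonneg (hU.nonneg hy)]
    exact (hU.lt_one hy).le
  have h2 := inv_bd hμ (U y)
  gcongr
  exact (norm_sub_le _ _).trans (by gcongr)

theorem int_F2 {U : ℝ → ℝ} (hU : AdmissibleShearFlow U) {μ : ℂ} (hμ : 0 < μ.im) :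
    IntegrableOn (fun y => (srcF U y : ℂ) * (μ - (U y : ℂ))⁻¹ ^ 2) (Ioi 0) := by
  have hc := hU.cont_inv hμ
  refine intMul hU.int_F (C := (1 / μ.im) ^ 2) (by fun_prop) ?_
  intro y hy
  rw [norm_pow]
  have h2 := inv_bd hμ (U y)
  gcongr

theorem phi_eq {U : ℝ → ℝ} (μ : ℂ) :
    PhiInv U μ = (μ - 1) * ∫ y in Ioi (0:ℝ), (srcF U y : ℂ) * (μ - (U y : ℂ))⁻¹ ^ 2 := by
  unfold PhiInv
  simp only [div_eq_mul_inv, inv_pow]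

theorem phi_R1 {U : ℝ → ℝ} (hU : AdmissibleShearFlow U) {μ : ℂ} (hμ : 0 < μ.im) :
    PhiInv U μ = ∫ y in Ioi (0:ℝ),
      ((1 - U y : ℝ) : ℂ) * ((2 * μ - 1 - U y) * (μ - (U y : ℂ))⁻¹ ^ 2) := by
  have hd : ∀ y, HasDerivAt (fun y : ℝ => ((y * (1 - U y) : ℝ) : ℂ) * (μ - (U y : ℂ))⁻¹)
      (((1 - U y : ℝ) : ℂ) * ((2 * μ - 1 - U y) * (μ - (U y : ℂ))⁻¹ ^ 2)
        - (μ - 1) * ((srcF U y : ℂ) * (μ - (U y : ℂ))⁻¹ ^ 2)) y := by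
    intro y
    have h1 := ((hasDerivAt_id y).mul ((hasDerivAt_const y (1:ℝ)).sub (hU.hasDeriv y))).ofReal_comp
    refine (h1.mul (hU.hasDeriv_inv hμ y)).congr_deriv ?_
    have := sub_ne hμ (U y)
    simp [srcF]
    field_simp
    ring
  have ht : Tendsto (fun y : ℝ => ((y * (1 - U y) : ℝ) : ℂ) * (μ - (U y : ℂ))⁻¹) atTop (𝓝 0) := by
    have := ((Complex.continuous_ofReal.tendsto 0).comp hU.decay_ratio₂).mul (hU.tendsto_inv hμ)
    simpa using this
  have hi := (hU.int_R1 hμ).sub ((hU.int_F2 hμ).const_mul (μ - 1))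
  have h := integral_Ioi_of_hasDerivAt_of_tendsto' (fun y _ => hd y) hi ht
  rw [integral_sub (hU.int_R1 hμ) ((hU.int_F2 hμ).const_mul (μ - 1)), integral_const_mul,
    ← phi_eq] at h
  simp at h
  rw [sub_eq_zero] at h
  rw [← h]
  simp

theorem phi_R2 {U : ℝ → ℝ} (hU : AdmissibleShearFlow U) {μ : ℂ} (hμ : 0 < μ.im) :
    PhiInv U μ = 1 / (μ * (deriv U 0 : ℝ)) - ∫ y in Ioi (0:ℝ),
      (((1 - U y) ^ 2 * iteratedDeriv 2 U y / (deriv U y) ^ 2 : ℝ) : ℂ) * (μ - (U y : ℂ))⁻¹ := by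
  have hi2 : IntegrableOn (fun y =>
      (((1 - U y) ^ 2 * iteratedDeriv 2 U y / (deriv U y) ^ 2 : ℝ) : ℂ) * (μ - (U y : ℂ))⁻¹)
      (Ioi 0) :=
    intMul hU.decay_ratio₃ (hU.cont_inv hμ) (fun y _ => inv_bd hμ (U y))
  have hd : ∀ y ∈ Ici (0:ℝ), HasDerivAt
      (fun y : ℝ => (((1 - U y) ^ 2 / deriv U y : ℝ) : ℂ) * (μ - (U y : ℂ))⁻¹)
      (-(((1 - U y : ℝ) : ℂ) * ((2 * μ - 1 - U y) * (μ - (U y : ℂ))⁻¹ ^ 2))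
        - (((1 - U y) ^ 2 * iteratedDeriv 2 U y / (deriv U y) ^ 2 : ℝ) : ℂ)
          * (μ - (U y : ℂ))⁻¹) y := by
    intro y hy
    have hp := (hU.deriv_pos y hy).ne'
    have h1 := (((((hasDerivAt_const y (1:ℝ)).sub (hU.hasDeriv y)).pow 2).div
      (hU.hasDeriv2 y) hp)).ofReal_comp
    refine (h1.mul (hU.hasDeriv_inv hμ y)).congr_deriv ?_
    have h2 := sub_ne hμ (U y)
    have h3 : ((deriv U y : ℝ) : ℂ) ≠ 0 := by exact_mod_cast hp
    simp
    field_simp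
    ring
  have ht : Tendsto (fun y : ℝ => (((1 - U y) ^ 2 / deriv U y : ℝ) : ℂ) * (μ - (U y : ℂ))⁻¹)
      atTop (𝓝 0) := by
    have := ((Complex.continuous_ofReal.tendsto 0).comp hU.decay_ratio₁).mul (hU.tendsto_inv hμ)
    simpa using this
  have h := integral_Ioi_of_hasDerivAt_of_tendsto' hd ((hU.int_R1 hμ).neg.sub hi2) ht
  have hn : IntegrableOn (fun y => -(((1 - U y : ℝ) : ℂ)
      * ((2 * μ - 1 - U y) * (μ - (U y : ℂ))⁻¹ ^ 2))) (Ioi 0) := (hU.int_R1 hμ).neg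
  rw [integral_sub hn hi2] at h
  rw [integral_neg, ← hU.phi_R1 hμ, hU.zero_val] at h
  have h4 : μ ≠ 0 := by simpa using sub_ne hμ 0
  have h5 : ((deriv U 0 : ℝ) : ℂ) ≠ 0 := by exact_mod_cast (hU.deriv_pos 0 le_rfl).ne'
  have h6 : PhiInv U μ = (((1 - 0) ^ 2 / deriv U 0 : ℝ) : ℂ) * (μ - ((0:ℝ) : ℂ))⁻¹
    - ∫ y in Ioi (0:ℝ),
      (((1 - U y) ^ 2 * iteratedDeriv 2 U y / (deriv U y) ^ 2 : ℝ) : ℂ) * (μ - (U y : ℂ))⁻¹ := by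
    linear_combination -h
  rw [h6]
  simp

theorem phi_im_neg {U : ℝ → ℝ} (hU : AdmissibleShearFlow U) {μ : ℂ} (hμ : 0 < μ.im)
    (hμ2 : 0 ≤ μ.re ^ 2 - μ.re + μ.im ^ 2) : (PhiInv U μ).im < 0 := by
  rw [hU.phi_R1 hμ]
  have hi := hU.int_R1 hμ
  have e : (∫ y in Ioi (0:ℝ),
      ((1 - U y : ℝ) : ℂ) * ((2 * μ - 1 - U y) * (μ - (U y : ℂ))⁻¹ ^ 2)).im
      = ∫ y in Ioi (0:ℝ),
      (((1 - U y : ℝ) : ℂ) * ((2 * μ - 1 - U y) * (μ - (U y : ℂ))⁻¹ ^ 2)).im :=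
    (integral_im hi).symm
  rw [e]
  have hpt : ∀ y ∈ Ioi (0:ℝ),
      (((1 - U y : ℝ) : ℂ) * ((2 * μ - 1 - U y) * (μ - (U y : ℂ))⁻¹ ^ 2)).im < 0 := by
    intro y hy
    have hy0 : 0 < y := hy
    have h1 := hU.lt_one hy0.le
    have h0 : 0 < U y := by
      have := hU.strictMono (mem_Ici.2 le_rfl) (mem_Ici.2 hy0.le) hy0
      rwa [hU.zero_val] at this
    set u := U y
    obtain ⟨a, b⟩ := μ
    simp only at hμ hμ2
    have hn : 0 < (a - u) ^ 2 + b ^ 2 := by positivity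
    have key : 0 < (1 - a) * (u - a) + b ^ 2 := by
      rcases lt_trichotomy a 1 with h | h | h
      · nlinarith [mul_pos h0 (sub_pos.2 h)]
      · subst h; nlinarith
      · nlinarith [mul_pos (sub_pos.2 h) (show 0 < a - u by linarith)]
    have e2 : (((1 - u : ℝ) : ℂ) * ((2 * (⟨a, b⟩ : ℂ) - 1 - u) * ((⟨a, b⟩ : ℂ) - (u : ℂ))⁻¹ ^ 2)).im
        = -(2 * (1 - u) * b * ((1 - a) * (u - a) + b ^ 2) / ((a - u) ^ 2 + b ^ 2) ^ 2) := by
      have : ((⟨a, b⟩ : ℂ) - (u : ℂ))⁻¹ = ⟨(a - u) / ((a - u) ^ 2 + b ^ 2), -b / ((a - u) ^ 2 + b ^ 2)⟩ := by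
        apply Complex.ext <;> simp [Complex.inv_re, Complex.inv_im, Complex.normSq_apply] <;> ring
      rw [this]
      simp [pow_two, Complex.mul_re, Complex.mul_im]
      field_simp
      ring
    rw [e2, neg_lt_zero]
    have : 0 < 1 - u := by linarith
    positivity
  have hneg : 0 < ∫ y in Ioi (0:ℝ),
      -(((1 - U y : ℝ) : ℂ) * ((2 * μ - 1 - U y) * (μ - (U y : ℂ))⁻¹ ^ 2)).im := by
    rw [setIntegral_pos_iff_support_of_nonneg_ae]
    · have : Ioi (0:ℝ) ⊆ (Function.support fun y =>
        -(((1 - U y : ℝ) : ℂ) * ((2 * μ - 1 - U y) * (μ - (U y : ℂ))⁻¹ ^ 2)).im) ∩ Ioi 0 := by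
        intro y hy
        refine ⟨?_, hy⟩
        have := hpt y hy
        simp only [Function.mem_support]
        linarith
      refine lt_of_lt_of_le ?_ (measure_mono this)
      simp
    · filter_upwards [ae_restrict_mem measurableSet_Ioi] with y hy
      have := hpt y hy
      simp only [Pi.zero_apply]
      linarith
    · exact hi.im.neg
  rw [integral_neg] at hneg
  linarith

theorem phi_diff {U : ℝ → ℝ} (hU : AdmissibleShearFlow U) :
    DifferentiableOn ℂ (PhiInv U) {μ : ℂ | 0 < μ.im} := by
  intro μ₀ hμ₀
  apply DifferentiableAt.differentiableWithinAt
  have hμ₀ : 0 < μ₀.im := hμ₀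
  have hfun : PhiInv U = fun μ => (μ - 1) *
      ∫ y in Ioi (0:ℝ), (srcF U y : ℂ) * (μ - (U y : ℂ))⁻¹ ^ 2 := funext fun μ => phi_eq μ
  rw [hfun]
  refine (differentiableAt_id.sub_const 1).mul ?_
  set s : Set ℂ := {μ : ℂ | μ₀.im / 2 < μ.im}
  have hs : s ∈ 𝓝 μ₀ := (isOpen_lt continuous_const Complex.continuous_im).mem_nhds
    (show μ₀.im / 2 < μ₀.im by linarith)
  have hs' : ∀ μ ∈ s, 0 < μ.im := fun μ h => by
    have : μ₀.im / 2 < μ.im := h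
    linarith
  have hF := hU.contF
  refine (hasDerivAt_integral_of_dominated_loc_of_deriv_le (s := s)
    (μ := volume.restrict (Ioi (0:ℝ)))
    (F := fun μ y => (srcF U y : ℂ) * (μ - (U y : ℂ))⁻¹ ^ 2)
    (F' := fun μ y => (srcF U y : ℂ) * (-2 * (μ - (U y : ℂ))⁻¹ ^ 3))
    (bound := fun y => |srcF U y| * (2 * (1 / (μ₀.im / 2)) ^ 3)) hs ?_ (hU.int_F2 hμ₀) ?_ ?_ ?_
    ?_).2.differentiableAt
  · filter_upwards [hs] with μ hμ
    exact (hU.int_F2 (hs' μ hμ)).aestronglyMeasurable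
  · have := hU.cont_inv hμ₀
    exact Continuous.aestronglyMeasurable (by fun_prop)
  · refine ae_of_all _ fun y μ hμ => ?_
    have h2 := inv_bd (hs' μ hμ) (U y)
    have h3 : μ₀.im / 2 < μ.im := hμ
    have h4 : 1 / μ.im ≤ 1 / (μ₀.im / 2) := one_div_le_one_div_of_le (by linarith) h3.le
    rw [norm_mul, Complex.norm_real, Real.norm_eq_abs, norm_mul, norm_pow]
    gcongr
    · simp
    · exact h2.trans h4
  · exact hU.int_F.abs.mul_const _
  · refine ae_of_all _ fun y μ hμ => ?_
    have h2 := sub_ne (hs' μ hμ) (U y)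
    have h := ((((hasDerivAt_id μ).sub_const (U y : ℂ)).inv h2).pow 2).const_mul (srcF U y : ℂ)
    refine h.congr_deriv ?_
    simp
    field_simp

end AdmissibleShearFlow
end

noncomputable section
open Topology
namespace AdmissibleShearFlow

theorem inv_left {U : ℝ → ℝ} (hU : AdmissibleShearFlow U) {y : ℝ} (hy : 0 ≤ y) :
    shearInv U (U y) = y :=
  hU.strictMono.injOn.leftInvOn_invFunOn (mem_Ici.2 hy)

theorem exists_pre {U : ℝ → ℝ} (hU : AdmissibleShearFlow U) {u : ℝ} (h0 : 0 ≤ u) (h1 : u < 1) :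
    ∃ y, 0 ≤ y ∧ U y = u := by
  obtain ⟨Y, hY⟩ := ((hU.tendsto_one.eventually (lt_mem_nhds h1)).and
    (eventually_ge_atTop 0)).exists
  have := intermediate_value_Icc hY.2 hU.cont.continuousOn
  rw [hU.zero_val] at this
  obtain ⟨y, hy, rfl⟩ := this ⟨h0, hY.1.le⟩
  exact ⟨y, hy.1, rfl⟩

theorem inv_nonneg {U : ℝ → ℝ} (hU : AdmissibleShearFlow U) {u : ℝ} (h0 : 0 ≤ u) (h1 : u < 1) :
    0 ≤ shearInv U u := by
  obtain ⟨y, hy, rfl⟩ := hU.exists_pre h0 h1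
  rwa [hU.inv_left hy]

theorem inv_right {U : ℝ → ℝ} (hU : AdmissibleShearFlow U) {u : ℝ} (h0 : 0 ≤ u) (h1 : u < 1) :
    U (shearInv U u) = u := by
  obtain ⟨y, hy, rfl⟩ := hU.exists_pre h0 h1
  rw [hU.inv_left hy]

theorem pos {U : ℝ → ℝ} (hU : AdmissibleShearFlow U) {y : ℝ} (hy : 0 < y) : 0 < U y := by
  have := hU.strictMono (mem_Ici.2 le_rfl) (mem_Ici.2 hy.le) hy
  rwa [hU.zero_val] at this

theorem image_U {U : ℝ → ℝ} (hU : AdmissibleShearFlow U) : U '' Ioi 0 = Ioo 0 1 := by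
  ext u
  constructor
  · rintro ⟨y, hy, rfl⟩
    exact ⟨hU.pos hy, hU.lt_one (le_of_lt hy)⟩
  · rintro ⟨h0, h1⟩
    obtain ⟨y, hy, rfl⟩ := hU.exists_pre h0.le h1
    refine ⟨y, lt_of_le_of_ne hy ?_, rfl⟩
    rintro rfl
    rw [hU.zero_val] at h0
    exact lt_irrefl _ h0

theorem g_U {U : ℝ → ℝ} (hU : AdmissibleShearFlow U) {y : ℝ} (hy : 0 ≤ y) :
    gfun U (U y) = (1 - U y) ^ 2 * iteratedDeriv 2 U y / (deriv U y) ^ 3 := by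
  unfold gfun
  rw [hU.inv_left hy]

theorem g_deriv {U : ℝ → ℝ} (hU : AdmissibleShearFlow U) {y : ℝ} (hy : 0 ≤ y) :
    |deriv U y| * gfun U (U y) = (1 - U y) ^ 2 * iteratedDeriv 2 U y / (deriv U y) ^ 2 := by
  have := hU.deriv_pos y hy
  rw [hU.g_U hy, abs_of_pos this]
  field_simp

theorem int_g {U : ℝ → ℝ} (hU : AdmissibleShearFlow U) : IntegrableOn (gfun U) (Ioo 0 1) := by
  rw [← hU.image_U, integrableOn_image_iff_integrableOn_abs_deriv_smul measurableSet_Ioi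
    (fun x _ => (hU.hasDeriv x).hasDerivWithinAt)
    (hU.strictMono.injOn.mono Ioi_subset_Ici_self)]
  refine hU.decay_ratio₃.congr_fun (fun y hy => ?_) measurableSet_Ioi
  simp only [smul_eq_mul]
  rw [hU.g_deriv (le_of_lt hy)]

theorem phi_g {U : ℝ → ℝ} (hU : AdmissibleShearFlow U) {μ : ℂ} (hμ : 0 < μ.im) :
    PhiInv U μ = 1 / (μ * (deriv U 0 : ℝ)) + ∫ u in Ioo (0:ℝ) 1, (gfun U u : ℂ) / ((u : ℂ) - μ) := by
  rw [hU.phi_R2 hμ, ← hU.image_U, integral_image_eq_integral_abs_deriv_smul measurableSet_Ioi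
    (fun x _ => (hU.hasDeriv x).hasDerivWithinAt)
    (hU.strictMono.injOn.mono Ioi_subset_Ici_self), sub_eq_add_neg, ← integral_neg]
  congr 1
  refine setIntegral_congr_fun measurableSet_Ioi fun y hy => ?_
  rw [← hU.g_deriv (le_of_lt hy), ← neg_sub μ (U y : ℂ), div_neg, div_eq_mul_inv]
  simp only [Complex.real_smul, Complex.ofReal_mul]
  ring

theorem g_lip {U : ℝ → ℝ} (hU : AdmissibleShearFlow U) {b : ℝ} (hb0 : 0 ≤ b) (hb : b < 1) :
    ∃ Λ : ℝ, 0 ≤ Λ ∧ ∀ u ∈ Icc 0 b, ∀ v ∈ Icc 0 b, |gfun U u - gfun U v| ≤ Λ * |u - v| := by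
  obtain ⟨Y, hY, rfl⟩ := hU.exists_pre hb0 hb
  obtain ⟨z, hz, hzmin⟩ := isCompact_Icc.exists_isMinOn (nonempty_Icc.2 hY)
    (hU.cont1.continuousOn (s := Icc 0 Y))
  set c := deriv U z with hc
  have hcpos : 0 < c := hU.deriv_pos z hz.1
  have hq : ∀ y ∈ Icc 0 Y, ContDiffAt ℝ 1
      (fun y => (1 - U y) ^ 2 * iteratedDeriv 2 U y / (deriv U y) ^ 3) y := by
    intro y hy
    have h0 := (hU.smooth.of_le (show (1 : WithTop ℕ∞) ≤ ((⊤:ℕ∞):WithTop ℕ∞) by exact_mod_cast le_top)).contDiffAt (x := y)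
    have h1 := (hU.smooth1.of_le (show (1 : WithTop ℕ∞) ≤ ((⊤:ℕ∞):WithTop ℕ∞) by exact_mod_cast le_top)).contDiffAt (x := y)
    have h2 := (hU.smooth2.of_le (show (1 : WithTop ℕ∞) ≤ ((⊤:ℕ∞):WithTop ℕ∞) by exact_mod_cast le_top)).contDiffAt (x := y)
    exact (((contDiffAt_const.sub h0).pow 2).mul h2).div (h1.pow 3)
      (pow_ne_zero 3 (hU.deriv_pos y hy.1).ne')
  set q := (fun y => (1 - U y) ^ 2 * iteratedDeriv 2 U y / (deriv U y) ^ 3) with hqdef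
  have hdc : ContinuousOn (deriv q) (Icc 0 Y) := by
    intro y hy
    have h1 : ContinuousAt (fderiv ℝ q) y := (hq y hy).continuousAt_fderiv one_ne_zero
    have h2 : ContinuousAt (fun x => fderiv ℝ q x 1) y := h1.clm_apply continuousAt_const
    exact h2.continuousWithinAt
  obtain ⟨C, hC⟩ := isCompact_Icc.exists_bound_of_continuousOn hdc
  have hC0 : 0 ≤ C := (norm_nonneg _).trans (hC 0 ⟨le_rfl, hY⟩)
  have hqlip : ∀ y ∈ Icc 0 Y, ∀ x ∈ Icc 0 Y, ‖q x - q y‖ ≤ C * ‖x - y‖ := fun y hy x hx =>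
    (convex_Icc 0 Y).norm_image_sub_le_of_norm_deriv_le
      (fun t ht => (hq t ht).differentiableAt (by simp)) hC hy hx
  have hUlip : ∀ y ∈ Icc 0 Y, ∀ x ∈ Icc 0 Y, y ≤ x → c * (x - y) ≤ U x - U y := by
    intro y hy x hx hxy
    refine (convex_Icc 0 Y).mul_sub_le_image_sub_of_le_deriv hU.cont.continuousOn
      (fun t _ => (hU.hasDeriv t).differentiableAt.differentiableWithinAt) (fun t ht => ?_) y hy x hx hxy
    exact hzmin (interior_subset ht)
  have hUlip' : ∀ y ∈ Icc 0 Y, ∀ x ∈ Icc 0 Y, c * |x - y| ≤ |U x - U y| := by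
    intro y hy x hx
    rcases le_total y x with h | h
    · rw [abs_of_nonneg (sub_nonneg.2 h)]
      exact (hUlip y hy x hx h).trans (le_abs_self _)
    · rw [abs_sub_comm, abs_sub_comm (U x), abs_of_nonneg (sub_nonneg.2 h)]
      exact (hUlip x hx y hy h).trans (le_abs_self _)
  refine ⟨C / c, by positivity, ?_⟩
  have hpre : ∀ u ∈ Icc 0 (U Y), ∃ y ∈ Icc 0 Y, U y = u := by
    intro u hu
    obtain ⟨y, hy, rfl⟩ := hU.exists_pre hu.1 (hu.2.trans_lt hb)
    exact ⟨y, ⟨hy, (hU.strictMono.le_iff_le (mem_Ici.2 hy) (mem_Ici.2 hY)).1 hu.2⟩, rfl⟩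
  intro u hu v hv
  obtain ⟨x, hx, rfl⟩ := hpre u hu
  obtain ⟨y, hy, rfl⟩ := hpre v hv
  rw [hU.g_U hx.1, hU.g_U hy.1]
  have h1 := hqlip y hy x hx
  have h2 := hUlip' y hy x hx
  simp only [Real.norm_eq_abs] at h1
  calc _ ≤ C * |x - y| := h1
    _ = C / c * (c * |x - y|) := by field_simp
    _ ≤ _ := by gcongr

theorem g_kappa {U : ℝ → ℝ} (hU : AdmissibleShearFlow U) :
    ∃ κ : ℝ, 0 < κ ∧ κ < 1 ∧ ∃ b : ℝ, 0 < b ∧ b < 1 ∧ ∃ c > (0:ℝ), ∀ u, b ≤ u → u < 1 →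
      gfun U u ≤ -c * (1 - u) ^ κ := by
  obtain ⟨κ, hκ, hκ2, Y, hY, c, hc, h⟩ := hU.kappa_decay
  refine ⟨κ, hκ, by linarith, U Y, hU.pos hY, hU.lt_one hY.le, c, hc, ?_⟩
  intro u hu hu1
  obtain ⟨y, hy, rfl⟩ := hU.exists_pre ((hU.pos hY).le.trans hu) hu1
  have hYy : Y ≤ y := (hU.strictMono.le_iff_le (mem_Ici.2 hY.le) (mem_Ici.2 hy)).1 hu
  have h1 := h y hYy
  rw [hU.g_U hy]
  have hd := hU.deriv_pos y hy
  have h1u : 0 < 1 - U y := by linarith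
  rw [div_le_iff₀ (by positivity)]
  have e : (1 - U y) ^ 2 = (1 - U y) ^ κ * (1 - U y) ^ ((2:ℝ) - κ) := by
    rw [← Real.rpow_add h1u]
    norm_num
  rw [e]
  have := mul_le_mul_of_nonneg_left h1 (Real.rpow_pos_of_pos h1u κ).le
  linarith

theorem g_zero_iff {U : ℝ → ℝ} (hU : AdmissibleShearFlow U) {y : ℝ} (hy : 0 ≤ y) :
    gfun U (U y) = 0 ↔ iteratedDeriv 2 U y = 0 := by
  have hd := hU.deriv_pos y hy
  have h1 := hU.lt_one hy
  have : (1 - U y) ≠ 0 := by linarith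
  rw [hU.g_U hy]
  simp [hd.ne', this]

theorem g_pos_iff {U : ℝ → ℝ} (hU : AdmissibleShearFlow U) {y : ℝ} (hy : 0 ≤ y) :
    0 < gfun U (U y) ↔ 0 < iteratedDeriv 2 U y := by
  have hd := hU.deriv_pos y hy
  have h1 := hU.lt_one hy
  have h2 : 0 < (1 - U y) := by linarith
  rw [hU.g_U hy]
  rw [div_pos_iff_of_pos_right (by positivity), mul_pos_iff_of_pos_left (by positivity)]

theorem g_neg_iff {U : ℝ → ℝ} (hU : AdmissibleShearFlow U) {y : ℝ} (hy : 0 ≤ y) :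
    gfun U (U y) < 0 ↔ iteratedDeriv 2 U y < 0 := by
  rw [← not_iff_not, not_lt, not_lt, le_iff_lt_or_eq, le_iff_lt_or_eq, hU.g_pos_iff hy, eq_comm,
    hU.g_zero_iff hy, eq_comm]

end AdmissibleShearFlow
end

noncomputable section
open Topology

theorem sub_ne' {μ : ℂ} (hμ : 0 < μ.im) (u : ℝ) : (u : ℂ) - μ ≠ 0 := by
  rw [← neg_sub]; exact neg_ne_zero.2 (sub_ne hμ u)

theorem sub_slit {μ : ℂ} (hμ : 0 < μ.im) (u : ℝ) : (u : ℂ) - μ ∈ Complex.slitPlane := by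
  right
  simp
  exact hμ.ne'

theorem cont_cauchy {μ : ℂ} (hμ : 0 < μ.im) : Continuous fun u : ℝ => ((u : ℂ) - μ)⁻¹ :=
  Continuous.inv₀ (by fun_prop) (fun u => sub_ne' hμ u)

theorem norm_cauchy {μ : ℂ} (hμ : 0 < μ.im) (u : ℝ) : ‖((u : ℂ) - μ)⁻¹‖ ≤ 1 / μ.im := by
  rw [← neg_sub, inv_neg, norm_neg]
  exact inv_bd hμ u

theorem int_cauchy {μ : ℂ} (hμ : 0 < μ.im) {f : ℝ → ℝ} {s : Set ℝ}
    (hf : IntegrableOn f s) : IntegrableOn (fun u => (f u : ℂ) / ((u : ℂ) - μ)) s := by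
  simp only [div_eq_mul_inv]
  refine Integrable.mul_bdd (c := 1 / μ.im) hf.ofReal (cont_cauchy hμ).aestronglyMeasurable ?_
  exact Eventually.of_forall fun u => norm_cauchy hμ u

theorem integral_cauchy {μ : ℂ} (hμ : 0 < μ.im) {p q : ℝ} (hpq : p ≤ q) :
    ∫ u in Ioo p q, ((u : ℂ) - μ)⁻¹ = Complex.log (q - μ) - Complex.log (p - μ) := by
  rw [← integral_Ioc_eq_integral_Ioo, ← intervalIntegral.integral_of_le hpq]
  have hd : ∀ u ∈ uIcc p q, HasDerivAt (fun u : ℝ => Complex.log ((u : ℂ) - μ)) ((u : ℂ) - μ)⁻¹ u := by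
    intro u _
    have h1 : HasDerivAt (fun u : ℝ => (u : ℂ) - μ) 1 u :=
      (Complex.ofRealCLM.hasDerivAt (x := u)).sub_const μ
    have := h1.clog_real (sub_slit hμ u)
    refine this.congr_deriv (by simp)
  exact intervalIntegral.integral_eq_sub_of_hasDerivAt hd ((cont_cauchy hμ).intervalIntegrable _ _)

namespace AdmissibleShearFlow

/-- regularised Cauchy integrand -/
def regI (U : ℝ → ℝ) (p q : ℝ) (μ : ℂ) (u : ℝ) : ℂ :=
  ((gfun U u - (Ioo p q).indicator (fun _ => gfun U μ.re) u : ℝ) : ℂ) / ((u : ℂ) - μ)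

theorem cauchy_split {U : ℝ → ℝ} (hU : AdmissibleShearFlow U) {μ : ℂ} (hμ : 0 < μ.im) {p q : ℝ}
    (hp : 0 ≤ p) (hpq : p ≤ q) (hq : q ≤ 1) :
    ∫ u in Ioo (0:ℝ) 1, (gfun U u : ℂ) / ((u : ℂ) - μ) =
      (∫ u in Ioo (0:ℝ) 1, regI U p q μ u) +
        gfun U μ.re * (Complex.log (q - μ) - Complex.log (p - μ)) := by
  have hsub : Ioo p q ⊆ Ioo (0:ℝ) 1 := Ioo_subset_Ioo hp hq
  rw [← integral_cauchy hμ hpq, ← integral_const_mul]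
  have e : ∫ u in Ioo p q, (gfun U μ.re : ℂ) * ((u : ℂ) - μ)⁻¹ =
      ∫ u in Ioo (0:ℝ) 1, (((Ioo p q).indicator (fun _ => gfun U μ.re) u : ℝ) : ℂ) / ((u : ℂ) - μ) := by
    have : (fun u : ℝ => (((Ioo p q).indicator (fun _ => gfun U μ.re) u : ℝ) : ℂ) / ((u : ℂ) - μ))
      = (Ioo p q).indicator (fun u => (gfun U μ.re : ℂ) * ((u : ℂ) - μ)⁻¹) := by
      ext u
      by_cases h : u ∈ Ioo p q <;> simp [h, div_eq_mul_inv]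
    rw [this, setIntegral_indicator measurableSet_Ioo, inter_eq_right.2 hsub]
  rw [e, ← integral_add]
  · congr 1
    ext u
    simp only [regI]
    rw [← add_div]
    push_cast
    ring
  · apply int_cauchy hμ
    refine hU.int_g.sub ?_
    exact (integrable_indicator_iff measurableSet_Ioo).2 (by simp) |>.mono_measure Measure.restrict_le_self
  · apply int_cauchy hμ
    exact (integrable_indicator_iff measurableSet_Ioo).2 (by simp) |>.mono_measure Measure.restrict_le_self

theorem reg_bound {U : ℝ → ℝ} {μ : ℂ} (hμ : 0 < μ.im) {p q Λ r : ℝ}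
    (hΛ : 0 ≤ Λ) (hr : 0 < r)
    (hl : ∀ u ∈ Icc p q, ∀ v ∈ Icc p q, |gfun U u - gfun U v| ≤ Λ * |u - v|)
    (ha : μ.re ∈ Icc p q) {u : ℝ} (hu : u ∉ Ioo p q → r ≤ ‖(u : ℂ) - μ‖) :
    ‖regI U p q μ u‖ ≤ Λ + |gfun U u| / r := by
  unfold regI
  have h0 : 0 < ‖(u : ℂ) - μ‖ := norm_pos_iff.2 (sub_ne' hμ u)
  rw [norm_div, Complex.norm_real, Real.norm_eq_abs]
  by_cases h : u ∈ Ioo p q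
  · rw [indicator_of_mem h]
    have h1 : |gfun U u - gfun U μ.re| / ‖(u : ℂ) - μ‖ ≤ Λ := by
      rw [div_le_iff₀ h0]
      refine (hl u (Ioo_subset_Icc_self h) _ ha).trans ?_
      gcongr
      have := Complex.abs_re_le_norm ((u : ℂ) - μ)
      simpa using this
    have : 0 ≤ |gfun U u| / r := by positivity
    linarith
  · rw [indicator_of_notMem h, sub_zero]
    have : |gfun U u| / ‖(u : ℂ) - μ‖ ≤ |gfun U u| / r := by
      gcongr
      exact hu h
    linarith

theorem int_bound {U : ℝ → ℝ} (hU : AdmissibleShearFlow U) (Λ r : ℝ) :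
    IntegrableOn (fun u => Λ + |gfun U u| / r) (Ioo 0 1) := by
  refine Integrable.add (by simp) ?_
  exact (hU.int_g.abs).div_const r

theorem g_contAt {U : ℝ → ℝ} (hU : AdmissibleShearFlow U) {a : ℝ} (h0 : 0 < a) (h1 : a < 1) :
    ContinuousAt (gfun U) a := by
  obtain ⟨b, hb, hb1⟩ := exists_between h1
  obtain ⟨Λ, hΛ, hl⟩ := hU.g_lip (h0.trans hb).le hb1
  have : LipschitzOnWith (Real.toNNReal Λ) (gfun U) (Icc 0 b) := by
    apply LipschitzOnWith.of_dist_le_mul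
    intro x hx y hy
    rw [Real.coe_toNNReal _ hΛ]
    exact hl x hx y hy
  exact this.continuousOn.continuousAt (Icc_mem_nhds h0 hb)

theorem meas_g {U : ℝ → ℝ} (hU : AdmissibleShearFlow U) (f : ℝ → ℂ) (p q c : ℝ)
    (hf : AEStronglyMeasurable f (volume.restrict (Ioo 0 1))) :
    AEStronglyMeasurable (fun u => ((gfun U u - (Ioo p q).indicator (fun _ => c) u : ℝ) : ℂ) * f u)
      (volume.restrict (Ioo 0 1)) := by
  refine AEStronglyMeasurable.mul ?_ hf
  refine Complex.continuous_ofReal.comp_aestronglyMeasurable ?_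
  exact hU.int_g.aestronglyMeasurable.sub
    ((measurable_const.indicator measurableSet_Ioo).aestronglyMeasurable)

/-- the limiting value of `PhiInv` on the real axis -/
theorem phi_lim {U : ℝ → ℝ} (hU : AdmissibleShearFlow U) {a : ℝ} (h0 : 0 < a) (h1 : a < 1) :
    ∃ R : ℝ, Tendsto (PhiInv U) (𝓝[{μ : ℂ | 0 < μ.im}] (a : ℂ))
        (𝓝 ((R : ℂ) + Complex.I * ((Real.pi * gfun U a : ℝ) : ℂ))) ∧
      (gfun U a = 0 → R = 1 / (a * deriv U 0) + ∫ u in Ioo (0:ℝ) 1, gfun U u / (u - a)) ∧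
      (gfun U a = 0 → IntegrableOn (fun u => gfun U u / (u - a)) (Ioo 0 1)) := by
  obtain ⟨r, hr, hra, hra1⟩ : ∃ r > 0, 0 < a - r ∧ a + r < 1 := by
    refine ⟨min a (1 - a) / 2, by have : 0 < 1 - a := by linarith
                                  positivity, ?_, ?_⟩
    · have := min_le_left a (1 - a); linarith
    · have := min_le_right a (1 - a); linarith
  obtain ⟨Λ, hΛ, hl⟩ := hU.g_lip (b := a + r) (by linarith) hra1
  have hl' : ∀ u ∈ Icc (a - r) (a + r), ∀ v ∈ Icc (a - r) (a + r),
      |gfun U u - gfun U v| ≤ Λ * |u - v| := fun u hu v hv =>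
    hl u ⟨by linarith [hu.1], hu.2⟩ v ⟨by linarith [hv.1], hv.2⟩
  set l := 𝓝[{μ : ℂ | 0 < μ.im}] (a : ℂ) with hldef
  have him : ∀ᶠ μ in l, 0 < μ.im := eventually_mem_nhdsWithin
  have hball : ∀ᶠ μ : ℂ in l, ‖μ - a‖ < r / 2 := by
    apply mem_nhdsWithin_of_mem_nhds
    have := Metric.ball_mem_nhds (a : ℂ) (half_pos hr)
    filter_upwards [this] with μ hμ
    rwa [← dist_eq_norm]
  have hid : Tendsto (fun μ : ℂ => μ) l (𝓝 (a : ℂ)) := tendsto_id.mono_left nhdsWithin_le_nhds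
  have hre : Tendsto (fun μ : ℂ => μ.re) l (𝓝 a) := by
    exact (Complex.continuous_re.tendsto (a : ℂ)).comp hid
  have hg : Tendsto (fun μ : ℂ => gfun U μ.re) l (𝓝 (gfun U a)) := (hU.g_contAt h0 h1).tendsto.comp hre
  set I0 : ℝ → ℝ := fun u => (gfun U u - (Ioo (a - r) (a + r)).indicator (fun _ => gfun U a) u) / (u - a) with hI0
  have hbd : ∀ᶠ μ in l, ∀ᵐ u ∂(volume.restrict (Ioo (0:ℝ) 1)),
      ‖regI U (a - r) (a + r) μ u‖ ≤ Λ + |gfun U u| / (r / 2) := by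
    filter_upwards [him, hball] with μ hμ hμb
    refine Eventually.of_forall fun u => ?_
    have h3 : |μ.re - a| ≤ ‖μ - a‖ := by simpa using Complex.abs_re_le_norm (μ - a)
    rw [abs_le] at h3
    refine reg_bound hμ hΛ (half_pos hr) hl' ⟨by linarith [h3.1], by linarith [h3.2]⟩ ?_
    intro hu
    have h4 : r ≤ |u - a| := by
      by_contra hh
      push Not at hh
      rw [abs_lt] at hh
      exact hu ⟨by linarith [hh.1], by linarith [hh.2]⟩
    have h5 : |u - a| = ‖((u:ℂ) - μ) + (μ - a)‖ := by
      rw [sub_add_sub_cancel, ← Complex.ofReal_sub, Complex.norm_real, Real.norm_eq_abs]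
    have := norm_add_le ((u:ℂ) - μ) (μ - a)
    linarith
  have hptw : ∀ᵐ u ∂(volume.restrict (Ioo (0:ℝ) 1)),
      Tendsto (fun μ => regI U (a - r) (a + r) μ u) l (𝓝 ((I0 u : ℝ) : ℂ)) := by
    have : ∀ᵐ u ∂(volume : Measure ℝ), u ≠ a := by simp [ae_iff, measure_singleton]
    filter_upwards [ae_restrict_of_ae this] with u hu
    have hne : (u : ℂ) - a ≠ 0 := by
      rw [← Complex.ofReal_sub]; exact_mod_cast sub_ne_zero.2 hu
    unfold regI
    rw [hI0]
    push_cast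
    refine Tendsto.div ?_ (tendsto_const_nhds.sub hid) hne
    refine tendsto_const_nhds.sub ?_
    by_cases h : u ∈ Ioo (a - r) (a + r)
    · simp only [indicator_of_mem h]
      exact (Complex.continuous_ofReal.tendsto _).comp hg
    · simp only [indicator_of_notMem h]
      exact tendsto_const_nhds
  have hmeas : ∀ᶠ μ in l, AEStronglyMeasurable (regI U (a - r) (a + r) μ) (volume.restrict (Ioo (0:ℝ) 1)) := by
    filter_upwards [him] with μ hμ
    have := hU.meas_g _ (a - r) (a + r) (gfun U μ.re) (cont_cauchy hμ).aestronglyMeasurable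
    simp only [← div_eq_mul_inv] at this
    exact this
  have hlim1 := tendsto_integral_filter_of_dominated_convergence _ hmeas hbd (hU.int_bound Λ (r/2)) hptw
  rw [integral_complex_ofReal] at hlim1
  have hlog1 : Tendsto (fun μ : ℂ => Complex.log ((a + r : ℝ) - μ)) l (𝓝 (Complex.log (r : ℂ))) := by
    have h1 : Tendsto (fun μ : ℂ => ((a + r : ℝ) : ℂ) - μ) l (𝓝 (r : ℂ)) := by
      have := (tendsto_const_nhds (x := ((a + r : ℝ) : ℂ))).sub hid
      simpa using this
    exact h1.clog (by left; simpa using hr)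
  have hlog2 : Tendsto (fun μ : ℂ => Complex.log ((a - r : ℝ) - μ)) l
      (𝓝 ((Real.log r : ℂ) - Real.pi * Complex.I)) := by
    have h1 : Tendsto (fun μ : ℂ => ((a - r : ℝ) : ℂ) - μ) l (𝓝[{z : ℂ | z.im < 0}] (-(r : ℂ))) := by
      refine tendsto_nhdsWithin_iff.2 ⟨?_, ?_⟩
      · have := (tendsto_const_nhds (x := ((a - r : ℝ) : ℂ))).sub hid
        simpa using this
      · filter_upwards [him] with μ hμ
        show _ < 0
        simpa using hμ
    have h2 := Complex.tendsto_log_nhdsWithin_im_neg_of_re_neg_of_im_zero (z := -(r:ℂ)) (by simpa using hr) (by simp)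
    have h3 := h2.comp h1
    simp only [norm_neg, Complex.norm_real, Real.norm_eq_abs, abs_of_pos hr] at h3
    exact h3
  have hlog := hlog1.sub hlog2
  have e1 : Complex.log (r : ℂ) - ((Real.log r : ℂ) - Real.pi * Complex.I) = Real.pi * Complex.I := by
    rw [Complex.ofReal_log hr.le]; ring
  rw [e1] at hlog
  have hg' : Tendsto (fun μ : ℂ => (gfun U μ.re : ℂ)) l (𝓝 (gfun U a : ℂ)) :=
    (Complex.continuous_ofReal.tendsto _).comp hg
  have hd0 := hU.deriv_pos 0 le_rfl
  have hinv : Tendsto (fun μ : ℂ => 1 / (μ * (deriv U 0 : ℝ))) l (𝓝 (1 / ((a : ℂ) * (deriv U 0 : ℝ)))) := by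
    refine tendsto_const_nhds.div (hid.mul tendsto_const_nhds) ?_
    rw [← Complex.ofReal_mul]
    exact_mod_cast (mul_pos h0 hd0).ne'
  have htot := hinv.add (hlim1.add (hg'.mul hlog))
  refine ⟨1 / (a * deriv U 0) + ∫ u in Ioo (0:ℝ) 1, I0 u, ?_, ?_, ?_⟩
  · refine Tendsto.congr' ?_ (htot.trans (le_of_eq ?_))
    · filter_upwards [him] with μ hμ
      rw [hU.phi_g hμ, hU.cauchy_split hμ (p := a - r) (q := a + r) (by linarith) (by linarith) hra1.le]
    · congr 1
      push_cast
      ring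
  · intro hga
    rw [hI0]
    simp [hga]
  · intro hga
    have hI : IntegrableOn I0 (Ioo 0 1) := by
      have hm : AEStronglyMeasurable I0 (volume.restrict (Ioo (0:ℝ) 1)) := by
        have : Measurable fun u : ℝ => (u - a)⁻¹ := by fun_prop
        have h2 := (hU.int_g.aestronglyMeasurable.sub
          ((measurable_const (a := gfun U a)).indicator (measurableSet_Ioo (a := a - r) (b := a + r))).aestronglyMeasurable).mul
          this.aestronglyMeasurable
        exact h2
      refine (hU.int_bound Λ (r/2)).mono' hm (Eventually.of_forall fun u => ?_)
      rw [hI0]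
      simp only [norm_div, Real.norm_eq_abs]
      by_cases h : u ∈ Ioo (a - r) (a + r)
      · rw [indicator_of_mem h]
        have : 0 ≤ |gfun U u| / (r/2) := by positivity
        have h6 := hl' u (Ioo_subset_Icc_self h) a ⟨by linarith, by linarith⟩
        have : |gfun U u - gfun U a| / |u - a| ≤ Λ := div_le_of_le_mul₀ (abs_nonneg _) hΛ h6
        linarith
      · rw [indicator_of_notMem h, sub_zero]
        have h4 : r / 2 ≤ |u - a| := by
          by_contra hh
          push Not at hh
          rw [abs_lt] at hh
          exact h ⟨by linarith [hh.1], by linarith [hh.2]⟩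
        have : |gfun U u| / |u - a| ≤ |gfun U u| / (r/2) := by gcongr
        linarith
    refine hI.congr_fun (fun u _ => ?_) measurableSet_Ioo
    rw [hI0]
    simp [hga]

end AdmissibleShearFlow
end

noncomputable section
open Topology

theorem pv_eq {f : ℝ → ℝ} {a : ℝ} (hf : IntegrableOn (fun u => f u / (u - a)) (Ioo 0 1)) :
    pvIntegral f a = ∫ u in Ioo (0:ℝ) 1, f u / (u - a) := by
  unfold pvIntegral
  apply Tendsto.limUnder_eq
  have e : ∀ ε : ℝ, ∫ u in Ioo (0:ℝ) 1 \ Ioo (a - ε) (a + ε), f u / (u - a) =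
      ∫ u in Ioo (0:ℝ) 1, (Ioo (a - ε) (a + ε))ᶜ.indicator (fun u => f u / (u - a)) u := by
    intro ε
    rw [setIntegral_indicator measurableSet_Ioo.compl, sdiff_eq]
  simp only [e]
  refine tendsto_integral_filter_of_dominated_convergence (fun u => ‖f u / (u - a)‖) ?_ ?_ hf.norm ?_
  · exact Eventually.of_forall fun ε => hf.aestronglyMeasurable.indicator measurableSet_Ioo.compl
  · exact Eventually.of_forall fun ε => Eventually.of_forall fun u => norm_indicator_le_norm_self _ _
  · have : ∀ᵐ u ∂(volume : Measure ℝ), u ≠ a := by simp [ae_iff, measure_singleton]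
    filter_upwards [ae_restrict_of_ae this] with u hu
    refine tendsto_const_nhds.congr' ?_
    have h1 : ∀ᶠ ε : ℝ in 𝓝[>] 0, ε < |u - a| :=
      mem_nhdsWithin_of_mem_nhds (gt_mem_nhds (abs_pos.2 (sub_ne_zero.2 hu)))
    filter_upwards [h1] with ε hε
    rw [indicator_of_mem]
    rintro ⟨h2, h3⟩
    exact absurd (abs_lt.2 ⟨by linarith, by linarith⟩) (not_lt.2 hε.le)

namespace AdmissibleShearFlow

theorem phi_lim_zero {U : ℝ → ℝ} (hU : AdmissibleShearFlow U) {y : ℝ} (hy : 0 < y)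
    (h : iteratedDeriv 2 U y = 0) :
    Tendsto (PhiInv U) (𝓝[{μ : ℂ | 0 < μ.im}] (U y : ℂ)) (𝓝 (chiAbscissa U y : ℂ)) := by
  obtain ⟨R, h1, h2, h3⟩ := hU.phi_lim (hU.pos hy) (hU.lt_one hy.le)
  have hg : gfun U (U y) = 0 := (hU.g_zero_iff hy.le).2 h
  have : chiAbscissa U y = R := by
    unfold chiAbscissa Gfun
    rw [pv_eq (h3 hg), h2 hg]
    simp
  rw [this]
  rw [hg] at h1
  simpa using h1

theorem phi_im_lim {U : ℝ → ℝ} (hU : AdmissibleShearFlow U) {a : ℝ} (h0 : 0 < a) (h1 : a < 1) :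
    Tendsto (fun μ => (PhiInv U μ).im) (𝓝[{μ : ℂ | 0 < μ.im}] (a : ℂ)) (𝓝 (Real.pi * gfun U a)) := by
  obtain ⟨R, h1, -, -⟩ := hU.phi_lim h0 h1
  have := (Complex.continuous_im.tendsto _).comp h1
  simpa [Function.comp_def] using this

theorem phi_near_zero {U : ℝ → ℝ} (hU : AdmissibleShearFlow U) :
    ∃ r > 0, ∀ μ : ℂ, 0 ≤ μ.re → 0 < μ.im → ‖μ‖ < r → PhiInv U μ ∈ Complex.slitPlane := by
  obtain ⟨Λ, hΛ, hl⟩ := hU.g_lip (b := 1/2) (by norm_num) (by norm_num)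
  set d := deriv U 0 with hd
  have hdpos : 0 < d := hU.deriv_pos 0 le_rfl
  set C := ∫ u in Ioo (0:ℝ) 1, (Λ + |gfun U u| / (1/4)) with hC
  set M := |gfun U 0| + Λ with hM
  have hM0 : 0 ≤ M := by positivity
  have hC0 : 0 ≤ C := by
    refine setIntegral_nonneg measurableSet_Ioo fun u _ => by positivity
  -- bound on the Cauchy integral
  have key : ∀ μ : ℂ, 0 ≤ μ.re → 0 < μ.im → ‖μ‖ < 1/4 →
      ‖∫ u in Ioo (0:ℝ) 1, (gfun U u : ℂ) / ((u : ℂ) - μ)‖ ≤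
        C + M * (2 + |Real.log ‖μ‖| + 2 * Real.pi) := by
    intro μ hre him hn
    have hren : μ.re ≤ ‖μ‖ := (le_abs_self _).trans (Complex.abs_re_le_norm μ)
    have hμ0 : μ ≠ 0 := by rintro rfl; simp at him
    rw [hU.cauchy_split him (p := 0) (q := 1/2) le_rfl (by norm_num) (by norm_num)]
    refine (norm_add_le _ _).trans (add_le_add ?_ ?_)
    · refine norm_integral_le_of_norm_le (hU.int_bound Λ (1/4)) ?_
      filter_upwards [ae_restrict_mem measurableSet_Ioo] with u hu
      refine reg_bound him hΛ (by norm_num) hl ⟨hre, by linarith⟩ ?_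
      intro hu2
      have : 1/2 ≤ u := by
        by_contra hh
        push Not at hh
        exact hu2 ⟨hu.1, hh⟩
      have h1 : ‖(u:ℂ)‖ = u := by rw [Complex.norm_real, Real.norm_eq_abs, abs_of_pos hu.1]
      have := norm_sub_norm_le (u : ℂ) μ
      linarith
    · rw [norm_mul]
      have h1 : ‖(gfun U μ.re : ℂ)‖ ≤ M := by
        rw [Complex.norm_real, Real.norm_eq_abs]
        have h2 := hl μ.re ⟨hre, by linarith⟩ 0 ⟨le_rfl, by norm_num⟩
        have h3 := abs_sub_abs_le_abs_sub (gfun U μ.re) (gfun U 0)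
        rw [sub_zero, abs_of_nonneg hre] at h2
        have : Λ * μ.re ≤ Λ := by nlinarith
        linarith
      have hlog : ∀ z : ℂ, ‖Complex.log z‖ ≤ |Real.log ‖z‖| + Real.pi := by
        intro z
        refine (Complex.norm_le_abs_re_add_abs_im _).trans ?_
        rw [Complex.log_re, Complex.log_im]
        gcongr
        exact Complex.abs_arg_le_pi z
      have h4 : ‖Complex.log (((1/2 : ℝ) : ℂ) - μ)‖ ≤ 2 + Real.pi := by
        refine (hlog _).trans ?_
        have hz1 : 1/4 ≤ ‖((1/2 : ℝ) : ℂ) - μ‖ := by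
          have := norm_sub_norm_le ((1/2 : ℝ) : ℂ) μ
          have h5 : ‖((1/2 : ℝ) : ℂ)‖ = 1/2 := by rw [Complex.norm_real]; norm_num
          linarith
        have hz2 : ‖((1/2 : ℝ) : ℂ) - μ‖ ≤ 1 := by
          have := norm_sub_le ((1/2 : ℝ) : ℂ) μ
          have h5 : ‖((1/2 : ℝ) : ℂ)‖ = 1/2 := by rw [Complex.norm_real]; norm_num
          linarith
        have h6 : Real.log ‖((1/2 : ℝ) : ℂ) - μ‖ ≤ 0 := Real.log_nonpos (norm_nonneg _) hz2
        have h7 : Real.log (1/4) ≤ Real.log ‖((1/2 : ℝ) : ℂ) - μ‖ := Real.log_le_log (by norm_num) hz1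
        have h8 : -2 ≤ Real.log (1/4) := by
          have : (1/4 : ℝ) = (2⁻¹)^2 := by norm_num
          rw [this, Real.log_pow, Real.log_inv]
          have := Real.log_two_lt_d9
          push_cast
          linarith
        rw [abs_of_nonpos h6]
        linarith
      have h9 : ‖Complex.log (((0 : ℝ) : ℂ) - μ)‖ ≤ |Real.log ‖μ‖| + Real.pi := by
        have := hlog (((0 : ℝ) : ℂ) - μ)
        simpa using this
      have h10 := norm_sub_le (Complex.log (((1/2 : ℝ) : ℂ) - μ)) (Complex.log (((0 : ℝ) : ℂ) - μ))
      gcongr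
      linarith
  have hlim : Tendsto (fun x : ℝ => x * d * (C + M * (2 + |Real.log x| + 2 * Real.pi))) (𝓝[>] 0) (𝓝 0) := by
    have h1 : Tendsto (fun x : ℝ => x) (𝓝[>] 0) (𝓝 0) := tendsto_id.mono_left nhdsWithin_le_nhds
    have h2 : Tendsto (fun x : ℝ => |Real.log x * x|) (𝓝[>] 0) (𝓝 0) := by
      have := tendsto_log_mul_rpow_nhdsGT_zero zero_lt_one
      simp only [Real.rpow_one] at this
      simpa using this.abs
    have h3 := (h1.mul_const (d * (C + M * (2 + 2 * Real.pi)))).add (h2.mul_const (d * M))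
    simp only [zero_mul, add_zero] at h3
    refine h3.congr' ?_
    filter_upwards [self_mem_nhdsWithin] with x hx
    have hx : 0 < x := hx
    rw [abs_mul, abs_of_pos hx]
    ring
  have hev := hlim.eventually (gt_mem_nhds (show (0:ℝ) < 1 by norm_num))
  obtain ⟨r, hr, hrr⟩ := mem_nhdsGT_iff_exists_Ioo_subset.1 hev
  refine ⟨min r (1/4), lt_min hr (by norm_num), ?_⟩
  intro μ hre him hn
  have hμ0 : μ ≠ 0 := by rintro rfl; simp at him
  have hnpos : 0 < ‖μ‖ := norm_pos_iff.2 hμ0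
  have h1 := hrr ⟨hnpos, hn.trans_le (min_le_left _ _)⟩
  have h1 : ‖μ‖ * d * (C + M * (2 + |Real.log ‖μ‖| + 2 * Real.pi)) < 1 := h1
  have h2 := key μ hre him (hn.trans_le (min_le_right _ _))
  set J := ∫ u in Ioo (0:ℝ) 1, (gfun U u : ℂ) / ((u : ℂ) - μ) with hJ
  have h3 : ‖μ * d * J‖ < 1 := by
    rw [norm_mul, norm_mul, Complex.norm_real, Real.norm_eq_abs, abs_of_pos hdpos]
    exact lt_of_le_of_lt (by gcongr) h1
  have hdne : (d : ℂ) ≠ 0 := by exact_mod_cast hdpos.ne'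
  have hz : μ * d * PhiInv U μ = 1 + μ * d * J := by
    rw [hU.phi_g him, ← hJ, ← hd]
    field_simp
  have hzre : 0 < (μ * d * PhiInv U μ).re := by
    rw [hz, Complex.add_re, Complex.one_re]
    have := Complex.abs_re_le_norm (μ * d * J)
    have := neg_abs_le (μ * d * J).re
    linarith
  rw [Complex.mem_slitPlane_iff]
  by_contra hcon
  push Not at hcon
  have e : (μ * d * PhiInv U μ).re = μ.re * d * (PhiInv U μ).re := by
    simp [Complex.mul_re, hcon.2]
  rw [e] at hzre
  have : 0 ≤ μ.re * d := by positivity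
  nlinarith [hcon.1]

end AdmissibleShearFlow
end

noncomputable section
open Topology

namespace AdmissibleShearFlow

theorem phi_near_one {U : ℝ → ℝ} (hU : AdmissibleShearFlow U) :
    ∃ b, 0 < b ∧ b < 1 ∧ ∃ η₀ > 0, ∀ μ : ℂ, b ≤ μ.re → μ.re ≤ 1 → 0 < μ.im → μ.im ≤ η₀ →
      (PhiInv U μ).im < 0 := by
  obtain ⟨κ, hκ0, hκ1, b, hb0, hb1, c, hc, hg⟩ := hU.g_kappa
  set b' := (1 + b) / 2 with hb'
  set e := b' - b with he
  have hepos : 0 < e := by rw [he, hb']; linarith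
  set C := ∫ u in Ioo (0:ℝ) 1, |gfun U u| / e ^ 2 with hC
  have hlim : Tendsto (fun x : ℝ => x ^ (1 - κ) * C) (𝓝[>] 0) (𝓝 0) := by
    have h1 : ContinuousAt (fun x : ℝ => x ^ (1 - κ)) 0 :=
      Real.continuousAt_rpow_const _ _ (Or.inr (by linarith))
    have h2 := (h1.tendsto.mono_left (nhdsWithin_le_nhds (s := Ioi 0))).mul_const C
    simpa [Real.zero_rpow (show (1 - κ) ≠ 0 by linarith)] using h2
  have hev := hlim.eventually (gt_mem_nhds (show (0:ℝ) < c / 5 by positivity))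
  obtain ⟨r, hr, hrr⟩ := mem_nhdsGT_iff_exists_Ioo_subset.1 hev
  have hr : 0 < r := hr
  refine ⟨b', by rw [hb']; linarith, by rw [hb']; linarith, min (r/2) (e / 2), by positivity, ?_⟩
  intro μ hre hre1 him him0
  set a := μ.re with ha
  set η := μ.im with hη
  have h1 : η ^ (1 - κ) * C < c / 5 :=
    hrr ⟨him, lt_of_le_of_lt (him0.trans (min_le_left _ _)) (by linarith)⟩
  have hηe : 2 * η ≤ e := by linarith [him0.trans (min_le_right _ _)]
  have hd := hU.deriv_pos 0 le_rfl
  rw [hU.phi_g him, Complex.add_im]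
  have hA : (1 / (μ * (deriv U 0 : ℝ))).im ≤ 0 := by
    rw [one_div, Complex.inv_im]
    apply div_nonpos_of_nonpos_of_nonneg _ (Complex.normSq_nonneg _)
    simp
    positivity
  have hintg := int_cauchy him hU.int_g
  have hB : (∫ u in Ioo (0:ℝ) 1, (gfun U u : ℂ) / ((u : ℂ) - μ)).im =
      ∫ u in Ioo (0:ℝ) 1, gfun U u * η / ((u - a) ^ 2 + η ^ 2) := by
    have := (Complex.imCLM.integral_comp_comm hintg).symm
    simp only [Complex.imCLM_apply] at this
    rw [this]
    congr 1
    ext u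
    rw [Complex.div_im]
    simp [Complex.normSq_apply]
    rw [← ha, ← hη]
    ring
  have hBint : IntegrableOn (fun u => gfun U u * η / ((u - a) ^ 2 + η ^ 2)) (Ioo 0 1) := by
    have := Complex.imCLM.integrable_comp hintg
    refine this.congr (Eventually.of_forall fun u => ?_)
    simp only [Function.comp, Complex.imCLM_apply]
    rw [Complex.div_im]
    simp [Complex.normSq_apply]
    rw [← ha, ← hη]
    ring
  have hpt : ∀ u ∈ Ioo (0:ℝ) 1, gfun U u * η / ((u - a) ^ 2 + η ^ 2) ≤
      η * (|gfun U u| / e ^ 2) - (Icc (a - 2 * η) (a - η)).indicator (fun _ => c * η ^ κ / (5 * η)) u := by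
    intro u hu
    have hden : 0 < (u - a) ^ 2 + η ^ 2 := by positivity
    by_cases hub : u < b
    · rw [indicator_of_notMem, sub_zero]
      · have h2 : e ^ 2 ≤ (u - a) ^ 2 + η ^ 2 := by nlinarith
        calc _ ≤ |gfun U u| * η / ((u - a) ^ 2 + η ^ 2) := by gcongr; exact le_abs_self _
          _ ≤ |gfun U u| * η / e ^ 2 := by gcongr
          _ = _ := by ring
      · rintro ⟨h2, h3⟩
        linarith
    · push Not at hub
      have hgu := hg u hub hu.2
      have h1u : 0 < 1 - u := by linarith [hu.2]
      have hp : 0 ≤ (1 - u) ^ κ := Real.rpow_nonneg h1u.le _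
      have hgneg : gfun U u ≤ 0 := by nlinarith
      have hpos : 0 ≤ η * (|gfun U u| / e ^ 2) := by positivity
      by_cases hin : u ∈ Icc (a - 2 * η) (a - η)
      · rw [indicator_of_mem hin]
        have h3 : η ^ κ ≤ (1 - u) ^ κ := Real.rpow_le_rpow him.le (by linarith [hin.2]) hκ0.le
        have h4 : (u - a) ^ 2 + η ^ 2 ≤ 5 * η ^ 2 := by nlinarith [hin.1, hin.2]
        have h5 : gfun U u ≤ -(c * η ^ κ) := by nlinarith
        have h6 : gfun U u * η / ((u - a) ^ 2 + η ^ 2) ≤ -(c * η ^ κ / (5 * η)) := by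
          rw [div_le_iff₀ hden]
          have h7 : 0 ≤ c * η ^ κ := by positivity
          have h8 : c * η ^ κ / (5 * η) * ((u - a) ^ 2 + η ^ 2) ≤ c * η ^ κ / (5 * η) * (5 * η ^ 2) := by
            gcongr
          have h9 : c * η ^ κ / (5 * η) * (5 * η ^ 2) = c * η ^ κ * η := by field_simp
          nlinarith
        linarith
      · rw [indicator_of_notMem hin]
        have : gfun U u * η / ((u - a) ^ 2 + η ^ 2) ≤ 0 :=
          div_nonpos_of_nonpos_of_nonneg (mul_nonpos_of_nonpos_of_nonneg hgneg him.le) hden.le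
        linarith
  have hI1 : IntegrableOn (fun u => η * (|gfun U u| / e ^ 2)) (Ioo 0 1) :=
    ((hU.int_g.abs).div_const _).const_mul _
  have hI2 : IntegrableOn ((Icc (a - 2 * η) (a - η)).indicator (fun _ => c * η ^ κ / (5 * η))) (Ioo 0 1) :=
    (integrable_indicator_iff measurableSet_Icc).2 (by simp) |>.mono_measure Measure.restrict_le_self
  have hmono := setIntegral_mono_on hBint (hI1.sub hI2) measurableSet_Ioo hpt
  have e1 : ∫ u in Ioo (0:ℝ) 1, (η * (|gfun U u| / e ^ 2) -
      (Icc (a - 2 * η) (a - η)).indicator (fun _ => c * η ^ κ / (5 * η)) u) = η * C - c * η ^ κ / 5 := by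
    rw [integral_sub hI1 hI2, integral_const_mul, setIntegral_indicator measurableSet_Icc,
      inter_eq_right.2, setIntegral_const]
    · rw [← hC]
      simp only [measureReal_def, Real.volume_Icc, smul_eq_mul]
      rw [ENNReal.toReal_ofReal (by linarith)]
      field_simp
      ring
    · intro u hu
      exact ⟨by linarith [hu.1], by linarith [hu.2]⟩
  have h2 : η * C < c * η ^ κ / 5 := by
    have : η = η ^ κ * η ^ (1 - κ) := by
      rw [← Real.rpow_add him]; simp
    have hp : 0 < η ^ κ := Real.rpow_pos_of_pos him _
    calc η * C = η ^ κ * (η ^ (1 - κ) * C) := by rw [← mul_assoc, ← this]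
      _ < η ^ κ * (c / 5) := by gcongr
      _ = _ := by ring
  rw [hB]
  have := hmono.trans_eq e1
  linarith

end AdmissibleShearFlow
end

noncomputable section
open Topology

theorem branch_const {S : Set ℂ} (hS : IsPreconnected S) {H h : ℂ → ℂ} (hh : ContinuousOn h S)
    (hH : ContinuousOn H S) (he : ∀ z ∈ S, Complex.exp (h z) = H z)
    (hs : ∀ z ∈ S, H z ∈ Complex.slitPlane) {x y : ℂ} (hx : x ∈ S) (hy : y ∈ S) :
    (h x).im - (H x).arg = (h y).im - (H y).arg := by
  have hπ := Real.pi_pos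
  have hD : DiscreteTopology (range ((↑) : ℤ → ℝ)) :=
    (Int.isClosedEmbedding_coe_real.isEmbedding.toHomeomorph).symm.isEmbedding.discreteTopology
  have hc : ContinuousOn (fun z => ((h z).im - (H z).arg) / (2 * Real.pi)) S := by
    refine ContinuousOn.div_const ?_ _
    refine (Complex.continuous_im.comp_continuousOn hh).sub ?_
    intro z hz
    exact (Complex.continuousAt_arg (hs z hz)).comp_continuousWithinAt (hH z hz)
  have hm : MapsTo (fun z => ((h z).im - (H z).arg) / (2 * Real.pi)) S (range ((↑) : ℤ → ℝ)) := by
    intro z hz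
    have h0 : H z ≠ 0 := Complex.slitPlane_ne_zero (hs z hz)
    have h1 : Complex.exp (h z) = Complex.exp (Complex.log (H z)) := by
      rw [he z hz, Complex.exp_log h0]
    obtain ⟨n, hn⟩ := Complex.exp_eq_exp_iff_exists_int.1 h1
    refine ⟨n, ?_⟩
    have := congrArg Complex.im hn
    simp [Complex.log_im] at this
    simp only [this]
    field_simp
    ring
  have := hS.constant_of_mapsTo ⟨hD⟩ hc hm hx hy
  field_simp at this
  exact this

theorem branch_const_neg {S : Set ℂ} (hS : IsPreconnected S) {H h : ℂ → ℂ} (hh : ContinuousOn h S)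
    (hH : ContinuousOn H S) (he : ∀ z ∈ S, Complex.exp (h z) = H z)
    (hs : ∀ z ∈ S, (H z).re < 0) {x y : ℂ} (hx : x ∈ S) (hy : y ∈ S) :
    (h x).im - (-H x).arg = (h y).im - (-H y).arg := by
  have := branch_const (H := fun z => - H z) (h := fun z => h z + Real.pi * Complex.I) hS
    (hh.add continuousOn_const) hH.neg (fun z hz => by
      rw [Complex.exp_add, Complex.exp_pi_mul_I, he z hz]; ring)
    (fun z hz => by left; simpa using hs z hz) hx hy
  simp at this
  linarith

theorem sum_jumps (Y : Finset ℝ) (z σ M : ℝ → ℝ) {δ : ℝ} (hδ : 0 < δ)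
    (hsep : ∀ y ∈ Y, ∀ y' ∈ Y, y ≠ y' → 2 * δ < |z y - z y'|)
    (h1 : ∀ a a', 0 ≤ a → a ≤ a' → a' ≤ 1 → (∀ t ∈ Icc a a', ∀ y ∈ Y, δ ≤ |t - z y|) → M a = M a')
    (h2 : ∀ y ∈ Y, M (z y + δ) - M (z y - δ) = σ y) :
    ∀ n : ℕ, ∀ a a', 0 ≤ a → a ≤ a' → a' ≤ 1 → (∀ y ∈ Y, δ ≤ |a - z y|) → (∀ y ∈ Y, δ ≤ |a' - z y|) →
      (Y.filter (fun y => z y ∈ Ioo a a')).card ≤ n →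
      M a' - M a = ∑ y ∈ Y.filter (fun y => z y ∈ Ioo a a'), σ y := by
  intro n
  induction n with
  | zero =>
    intro a a' ha haa ha' hga hga' hcard
    have he : Y.filter (fun y => z y ∈ Ioo a a') = ∅ := Finset.card_eq_zero.1 (Nat.le_zero.1 hcard)
    rw [he, Finset.sum_empty, h1 a a' ha haa ha', sub_self]
    intro t ht y hy
    have hn : z y ∉ Ioo a a' := by
      intro hh
      have : y ∈ Y.filter (fun y => z y ∈ Ioo a a') := Finset.mem_filter.2 ⟨hy, hh⟩
      rw [he] at this
      exact absurd this (Finset.notMem_empty _)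
    have h3 := hga y hy
    have h4 := hga' y hy
    rw [le_abs] at h3 h4 ⊢
    by_cases hz : z y ≤ a
    · left
      rcases h3 with h3 | h3 <;> linarith [ht.1]
    · have hz' : a' ≤ z y := by
        by_contra hh
        exact hn ⟨not_le.1 hz, not_le.1 hh⟩
      right
      rcases h4 with h4 | h4 <;> linarith [ht.2]
  | succ n ih =>
    intro a a' ha haa ha' hga hga' hcard
    by_cases he : Y.filter (fun y => z y ∈ Ioo a a') = ∅
    · exact ih a a' ha haa ha' hga hga' (by rw [he]; simp)
    obtain ⟨y, hy⟩ := Finset.nonempty_iff_ne_empty.2 he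
    obtain ⟨hyY, hyI⟩ := Finset.mem_filter.1 hy
    have b1 : a ≤ z y - δ := by
      have := hga y hyY
      rw [le_abs] at this
      rcases this with h | h <;> linarith [hyI.1]
    have b2 : z y + δ ≤ a' := by
      have := hga' y hyY
      rw [le_abs] at this
      rcases this with h | h <;> linarith [hyI.2]
    have sepc : ∀ y' ∈ Y, y' ≠ y → z y' < z y - 2 * δ ∨ z y + 2 * δ < z y' := by
      intro y' hy' hne
      have := hsep y' hy' y hyY hne
      rw [lt_abs] at this
      rcases this with h | h
      · right; linarith
      · left; linarith
    have g1 : ∀ y' ∈ Y, δ ≤ |z y - δ - z y'| := by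
      intro y' hy'
      rw [le_abs]
      by_cases hne : y' = y
      · subst hne; right; linarith
      · rcases sepc y' hy' hne with h | h
        · left; linarith
        · right; linarith
    have g2 : ∀ y' ∈ Y, δ ≤ |z y + δ - z y'| := by
      intro y' hy'
      rw [le_abs]
      by_cases hne : y' = y
      · subst hne; left; linarith
      · rcases sepc y' hy' hne with h | h
        · left; linarith
        · right; linarith
    have hsplit : Y.filter (fun y => z y ∈ Ioo a a') =
        insert y (Y.filter (fun w => z w ∈ Ioo a (z y - δ)) ∪ Y.filter (fun w => z w ∈ Ioo (z y + δ) a')) := by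
      ext w
      simp only [Finset.mem_filter, Finset.mem_insert, Finset.mem_union, mem_Ioo]
      constructor
      · rintro ⟨hw, h3, h4⟩
        by_cases hne : w = y
        · left; exact hne
        · right
          rcases sepc w hw hne with h | h
          · left; exact ⟨hw, h3, by linarith⟩
          · right; exact ⟨hw, by linarith, h4⟩
      · rintro (rfl | ⟨hw, h3, h4⟩ | ⟨hw, h3, h4⟩)
        · exact ⟨hyY, hyI⟩
        · exact ⟨hw, h3, by linarith⟩
        · exact ⟨hw, by linarith, h4⟩
    have hdisj : Disjoint (Y.filter (fun w => z w ∈ Ioo a (z y - δ)))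
        (Y.filter (fun w => z w ∈ Ioo (z y + δ) a')) := by
      rw [Finset.disjoint_left]
      intro w hw hw'
      have h3 := (Finset.mem_filter.1 hw).2.2
      have h4 := (Finset.mem_filter.1 hw').2.1
      linarith
    have hnot : y ∉ Y.filter (fun w => z w ∈ Ioo a (z y - δ)) ∪ Y.filter (fun w => z w ∈ Ioo (z y + δ) a') := by
      intro hh
      rcases Finset.mem_union.1 hh with h | h
      · have := (Finset.mem_filter.1 h).2.2
        linarith
      · have := (Finset.mem_filter.1 h).2.1
        linarith
    rw [hsplit, Finset.card_insert_of_notMem hnot, Finset.card_union_of_disjoint hdisj] at hcard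
    rw [hsplit, Finset.sum_insert hnot, Finset.sum_union hdisj,
      ← ih a (z y - δ) ha b1 (by linarith) hga g1 (by omega),
      ← ih (z y + δ) a' (by linarith) b2 ha' g2 hga' (by omega), ← h2 y hyY]
    ring

theorem sign_left {f : ℝ → ℝ} (hf : Continuous f) {p y : ℝ} (hp : p < y)
    (h0 : ∀ t ∈ Ico p y, f t ≠ 0) :
    0 < f p ↔ ∃ δ > (0:ℝ), ∀ t ∈ Ioo (y - δ) y, 0 < f t := by
  have key : ∀ t ∈ Ico p y, ∀ s ∈ Ico p y, 0 < f t → 0 < f s := by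
    intro t ht s hs hpos
    by_contra hcon
    push Not at hcon
    obtain ⟨c, hc, hc0⟩ := isPreconnected_Ico.intermediate_value hs ht hf.continuousOn ⟨hcon, hpos.le⟩
    exact h0 c hc hc0
  constructor
  · intro h
    refine ⟨y - p, by linarith, fun t ht => key p ⟨le_rfl, hp⟩ t ⟨by linarith [ht.1], ht.2⟩ h⟩
  · rintro ⟨δ, hδ, h⟩
    obtain ⟨t, ht1, ht2⟩ := exists_between (max_lt (show y - δ < y by linarith) hp)
    exact key t ⟨(le_max_right _ _).trans ht1.le, ht2⟩ p ⟨le_rfl, hp⟩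
      (h t ⟨(le_max_left _ _).trans_lt ht1, ht2⟩)

theorem sign_right {f : ℝ → ℝ} (hf : Continuous f) {p y : ℝ} (hp : y < p)
    (h0 : ∀ t ∈ Ioc y p, f t ≠ 0) :
    0 < f p ↔ ∃ δ > (0:ℝ), ∀ t ∈ Ioo y (y + δ), 0 < f t := by
  have := sign_left (f := fun t => f (-t)) (by fun_prop) (p := -p) (y := -y) (by linarith)
    (fun t ht => h0 (-t) ⟨by linarith [ht.2], by linarith [ht.1]⟩)
  simp only [neg_neg] at this
  rw [this]
  constructor
  · rintro ⟨δ, hδ, h⟩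
    exact ⟨δ, hδ, fun t ht => by simpa using h (-t) ⟨by linarith [ht.2], by linarith [ht.1]⟩⟩
  · rintro ⟨δ, hδ, h⟩
    exact ⟨δ, hδ, fun t ht => h (-t) ⟨by linarith [ht.2], by linarith [ht.1]⟩⟩

theorem sign_both {f : ℝ → ℝ} (hf : Continuous f) {p q y : ℝ} (hp : p < y) (hq : y < q)
    (h0 : ∀ t ∈ Ico p y, f t ≠ 0) (h1 : ∀ t ∈ Ioc y q, f t ≠ 0) :
    (0 < f p ∧ f q < 0) ↔ ∃ δ > (0:ℝ), (∀ t ∈ Ioo (y - δ) y, 0 < f t) ∧ (∀ t ∈ Ioo y (y + δ), f t < 0) := by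
  rw [sign_left hf hp h0]
  have := sign_right (f := fun t => - f t) hf.neg hq (fun t ht => neg_ne_zero.2 (h1 t ht))
  simp only [Left.neg_pos_iff] at this
  rw [this]
  constructor
  · rintro ⟨⟨δ, hδ, h⟩, δ', hδ', h'⟩
    refine ⟨min δ δ', lt_min hδ hδ', fun t ht => h t ⟨?_, ht.2⟩, fun t ht => h' t ⟨ht.1, ?_⟩⟩
    · linarith [ht.1, min_le_left δ δ']
    · linarith [ht.2, min_le_right δ δ']
  · rintro ⟨δ, hδ, h, h'⟩
    exact ⟨⟨δ, hδ, h⟩, δ, hδ, h'⟩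

end

noncomputable section
open Topology

/-- the horizontal line at height `η` -/
def lineP (η : ℝ) (t : ℝ) : ℂ := (t : ℂ) + η * Complex.I

theorem lineP_re (η t : ℝ) : (lineP η t).re = t := by simp [lineP]
theorem lineP_im (η t : ℝ) : (lineP η t).im = η := by simp [lineP]

theorem lineP_pre (η a b : ℝ) : IsPreconnected (lineP η '' Icc a b) := by
  refine isPreconnected_Icc.image _ (Continuous.continuousOn ?_)
  unfold lineP
  fun_prop

namespace AdmissibleShearFlow

theorem phi_box {U : ℝ → ℝ} (hU : AdmissibleShearFlow U) {y : ℝ} (hy : 0 < y)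
    (h : iteratedDeriv 2 U y = 0) (hχ : chiAbscissa U y ≠ 0) :
    ∀ᶠ δ : ℝ in 𝓝[>] 0, ∀ μ : ℂ, |μ.re - U y| ≤ δ → 0 < μ.im → μ.im ≤ δ →
      0 < (PhiInv U μ).re * chiAbscissa U y := by
  have h1 := (Complex.continuous_re.tendsto _).comp (hU.phi_lim_zero hy h)
  have h2 := h1.mul_const (chiAbscissa U y)
  have h3 : 0 < ((chiAbscissa U y : ℂ)).re * chiAbscissa U y := by
    rw [Complex.ofReal_re]; exact mul_self_pos.2 hχ
  have h4 := h2.eventually (lt_mem_nhds h3)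
  rw [eventually_nhdsWithin_iff, Metric.eventually_nhds_iff] at h4
  obtain ⟨ε, hε, h5⟩ := h4
  have h6 : ∀ᶠ δ : ℝ in 𝓝[>] 0, δ < ε / 2 := mem_nhdsWithin_of_mem_nhds (gt_mem_nhds (half_pos hε))
  filter_upwards [h6] with δ hδ μ hre him him2
  refine h5 ?_ him
  rw [dist_eq_norm]
  refine (Complex.norm_le_abs_re_add_abs_im _).trans_lt ?_
  simp only [Complex.sub_re, Complex.ofReal_re, Complex.sub_im, Complex.ofReal_im, sub_zero]
  rw [abs_of_pos him]
  linarith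

theorem phi_compact {U : ℝ → ℝ} (hU : AdmissibleShearFlow U) {K : Set ℝ} (hK : IsCompact K)
    (h0 : ∀ a ∈ K, 0 < a) (h1 : ∀ a ∈ K, a < 1) (hg : ∀ a ∈ K, gfun U a ≠ 0) :
    ∀ᶠ η : ℝ in 𝓝[>] 0, ∀ a ∈ K, 0 < (PhiInv U (lineP η a)).im * gfun U a := by
  rw [eventually_nhdsWithin_iff]
  have := hK.eventually_forall_of_forall_eventually (x₀ := (0:ℝ))
    (P := fun η a => η ∈ Ioi (0:ℝ) → 0 < (PhiInv U (lineP η a)).im * gfun U a) ?_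
  · filter_upwards [this] with η h hη a ha
    exact h a ha hη
  · intro a ha
    have h2 := hU.phi_im_lim (h0 a ha) (h1 a ha)
    have hre : Tendsto (fun μ : ℂ => gfun U μ.re) (𝓝[{μ : ℂ | 0 < μ.im}] (a : ℂ)) (𝓝 (gfun U a)) := by
      have h3 : ContinuousAt (fun μ : ℂ => gfun U μ.re) (a : ℂ) := by
        refine ContinuousAt.comp (f := Complex.re) (g := gfun U) ?_ Complex.continuous_re.continuousAt
        rw [Complex.ofReal_re]
        exact hU.g_contAt (h0 a ha) (h1 a ha)
      have h4 := h3.tendsto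
      simp only [Complex.ofReal_re] at h4
      exact h4.mono_left nhdsWithin_le_nhds
    have h5 := h2.mul hre
    have h6 : 0 < Real.pi * gfun U a * gfun U a := by
      rw [mul_assoc]
      exact mul_pos Real.pi_pos (mul_self_pos.2 (hg a ha))
    have h7 := h5.eventually (lt_mem_nhds h6)
    rw [eventually_nhdsWithin_iff] at h7
    have hc : Tendsto (fun z : ℝ × ℝ => lineP z.1 z.2) (𝓝 ((0:ℝ), a)) (𝓝 (a : ℂ)) := by
      have : Continuous (fun z : ℝ × ℝ => lineP z.1 z.2) := by unfold lineP; fun_prop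
      have h8 := this.tendsto ((0:ℝ), a)
      simpa [lineP] using h8
    filter_upwards [hc.eventually h7] with z hz hz1
    have := hz (show 0 < (lineP z.1 z.2).im by rw [lineP_im]; exact hz1)
    rwa [lineP_re] at this

theorem exists_zero {U : ℝ → ℝ} (hU : AdmissibleShearFlow U)
    (hξ : xiEq U 0 = 0) (hξpm : xiPlus U 0 < xiMinus U 0) :
    ∃ μ : ℂ, 0 < μ.im ∧ PhiInv U μ = 0 := by
  classical
  by_contra hcon
  push Not at hcon
  set H := PhiInv U with hH
  set ℍ : Set ℂ := {μ : ℂ | 0 < μ.im} with hℍ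
  have hHc : ContinuousOn H ℍ := hU.phi_diff.continuousOn
  have hconv : Convex ℝ ℍ := convex_halfSpace_im_gt 0
  have hsc : IsSimplyConnected ℍ := by
    have := hconv.contractibleSpace ⟨Complex.I, by simp [hℍ]⟩
    exact SimplyConnectedSpace.ofContractible _
  have hopen : IsOpen ℍ := isOpen_lt continuous_const Complex.continuous_im
  obtain ⟨h, hhc, hhe⟩ := Complex.exists_continuousOn_eqOn_exp_comp hsc hopen hHc (by
    rintro ⟨μ, hμ, h0⟩
    exact hcon μ hμ h0)
  have hexp : ∀ z ∈ ℍ, Complex.exp (h z) = H z := fun z hz => hhe hz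
  set Y : Finset ℝ := hU.finite_inflexions.toFinset with hY
  have memY : ∀ y, y ∈ Y ↔ 0 < y ∧ iteratedDeriv 2 U y = 0 := by
    intro y
    rw [hY, Set.Finite.mem_toFinset]
    exact Iff.rfl
  have hχ : ∀ y ∈ Y, chiAbscissa U y ≠ 0 := by
    intro y hy h0
    rw [memY] at hy
    unfold xiEq at hξ
    rw [Set.ncard_eq_zero (hU.finite_inflexions.subset (fun z hz => ⟨hz.1, hz.2.1⟩))] at hξ
    have : y ∈ (∅ : Set ℝ) := by
      rw [← hξ]; exact ⟨hy.1, hy.2, h0⟩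
    exact this
  have hU0 : ∀ y ∈ Y, 0 < U y := fun y hy => hU.pos ((memY y).1 hy).1
  have hU1 : ∀ y ∈ Y, U y < 1 := fun y hy => hU.lt_one ((memY y).1 hy).1.le
  -- choice of δ
  have hδev : ∀ᶠ δ : ℝ in 𝓝[>] 0, ∀ y ∈ Y, 2 * δ < U y ∧ 2 * δ < 1 - U y ∧
      (∀ y' ∈ Y, y ≠ y' → 2 * δ < |U y - U y'|) ∧
      (∀ μ : ℂ, |μ.re - U y| ≤ δ → 0 < μ.im → μ.im ≤ δ → 0 < (H μ).re * chiAbscissa U y) := by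
    rw [Filter.eventually_all_finset]
    intro y hy
    have small : ∀ c : ℝ, 0 < c → ∀ᶠ δ : ℝ in 𝓝[>] 0, 2 * δ < c := by
      intro c hc
      have : ∀ᶠ δ : ℝ in 𝓝[>] 0, δ < c / 2 := mem_nhdsWithin_of_mem_nhds (gt_mem_nhds (half_pos hc))
      filter_upwards [this] with δ hδ
      linarith
    refine (small _ (hU0 y hy)).and ((small _ (sub_pos.2 (hU1 y hy))).and (Eventually.and ?_ ?_))
    · rw [Filter.eventually_all_finset]
      intro y' hy'
      by_cases hne : y = y'
      · exact Eventually.of_forall fun δ h => absurd hne h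
      · have : 0 < |U y - U y'| := by
          rw [abs_pos, sub_ne_zero]
          intro heq
          exact hne (hU.strictMono.injOn (mem_Ici.2 ((memY y).1 hy).1.le)
            (mem_Ici.2 ((memY y').1 hy').1.le) heq)
        filter_upwards [small _ this] with δ hδ _
        exact hδ
    · exact hU.phi_box ((memY y).1 hy).1 ((memY y).1 hy).2 (hχ y hy)
  obtain ⟨δ, hδY, hδ⟩ := (hδev.and self_mem_nhdsWithin).exists
  have hδ : 0 < δ := hδ
  obtain ⟨r, hr, hnear0⟩ := hU.phi_near_zero
  obtain ⟨b, hb0, hb1, η₀, hη₀, hnear1⟩ := hU.phi_near_one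
  set p := min (r / 2) δ with hp
  set q := max b (1 - δ) with hq
  have hppos : 0 < p := by positivity
  have hq1 : q < 1 := max_lt hb1 (by linarith)
  set good : Set ℝ := {a | ∀ y ∈ Y, δ ≤ |a - U y|} with hgood
  have hgoodc : IsClosed good := by
    have : good = ⋂ y ∈ Y, {a | δ ≤ |a - U y|} := by
      ext a; simp [hgood]
    rw [this]
    exact isClosed_biInter fun y _ => isClosed_le continuous_const (by fun_prop)
  have hgne : ∀ a, 0 < a → a < 1 → a ∈ good → gfun U a ≠ 0 := by
    intro a h0 h1 hg h2
    obtain ⟨y, hy, rfl⟩ : a ∈ U '' Ioi 0 := by rw [hU.image_U]; exact ⟨h0, h1⟩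
    have hyY : y ∈ Y := (memY y).2 ⟨hy, (hU.g_zero_iff (le_of_lt hy)).1 h2⟩
    have := hg y hyY
    simp at this
    linarith
  have hKev := hU.phi_compact (K := Icc p q ∩ good) (isCompact_Icc.inter_right hgoodc)
    (fun a ha => hppos.trans_le ha.1.1) (fun a ha => ha.1.2.trans_lt hq1)
    (fun a ha => hgne a (hppos.trans_le ha.1.1) (ha.1.2.trans_lt hq1) ha.2)
  have hηlt : ∀ᶠ η : ℝ in 𝓝[>] 0, η < min (min η₀ (r / 4)) (min δ 1) :=
    mem_nhdsWithin_of_mem_nhds (gt_mem_nhds (by positivity))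
  obtain ⟨η, ⟨hKη, hηl⟩, hη⟩ := ((hKev.and hηlt).and self_mem_nhdsWithin).exists
  have hη : 0 < η := hη
  rw [lt_min_iff, lt_min_iff, lt_min_iff] at hηl
  obtain ⟨⟨hη1, hη2⟩, hη3, hη4⟩ := hηl
  have hline : ∀ t, lineP η t ∈ ℍ := fun t => by show 0 < (lineP η t).im; rw [lineP_im]; exact hη
  have hslit : ∀ t, 0 ≤ t → t ≤ 1 → t ∈ good → H (lineP η t) ∈ Complex.slitPlane := by
    intro t h0 h1 hg
    by_cases htp : t < p
    · refine hnear0 _ (by rwa [lineP_re]) (by rwa [lineP_im]) ?_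
      refine (Complex.norm_le_abs_re_add_abs_im _).trans_lt ?_
      rw [lineP_re, lineP_im, abs_of_nonneg h0, abs_of_pos hη]
      have := min_le_left (r/2) δ
      linarith
    by_cases htq : q < t
    · right
      refine (hnear1 _ ?_ (by rwa [lineP_re]) (by rwa [lineP_im]) (by rw [lineP_im]; exact hη1.le)).ne
      rw [lineP_re]
      exact (le_max_left _ _).trans htq.le
    right
    intro h2
    have := hKη t ⟨⟨not_lt.1 htp, not_lt.1 htq⟩, hg⟩
    rw [← hH, h2, zero_mul] at this
    exact lt_irrefl _ this
  set M : ℝ → ℝ := fun t => ((h (lineP η t)).im - (H (lineP η t)).arg) / (2 * Real.pi) with hM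
  have hπ := Real.pi_pos
  have h1 : ∀ a a', 0 ≤ a → a ≤ a' → a' ≤ 1 → (∀ t ∈ Icc a a', ∀ y ∈ Y, δ ≤ |t - U y|) → M a = M a' := by
    intro a a' ha haa ha' hg
    have hsub : lineP η '' Icc a a' ⊆ ℍ := by rintro _ ⟨t, -, rfl⟩; exact hline t
    have := branch_const (lineP_pre η a a') (hhc.mono hsub) (hHc.mono hsub) (fun z hz => hexp z (hsub hz))
      (by rintro _ ⟨t, ht, rfl⟩
          exact hslit t (ha.trans ht.1) (ht.2.trans ha') (hg t ht))
      (mem_image_of_mem _ (left_mem_Icc.2 haa)) (mem_image_of_mem _ (right_mem_Icc.2 haa))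
    simp only [hM]
    rw [this]
  set Sm : Set ℝ := {y : ℝ | 0 < y ∧ iteratedDeriv 2 U y = 0 ∧ chiAbscissa U y < 0 ∧
    ∃ δ > (0:ℝ), (∀ z ∈ Ioo (y - δ) y, 0 < iteratedDeriv 2 U z) ∧
      (∀ z ∈ Ioo y (y + δ), iteratedDeriv 2 U z < 0)} with hSm
  set Sp : Set ℝ := {y : ℝ | 0 < y ∧ iteratedDeriv 2 U y = 0 ∧ chiAbscissa U y < 0 ∧
    ∃ δ > (0:ℝ), (∀ z ∈ Ioo (y - δ) y, iteratedDeriv 2 U z < 0) ∧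
      (∀ z ∈ Ioo y (y + δ), 0 < iteratedDeriv 2 U z)} with hSp
  set σ : ℝ → ℝ := fun y => (if y ∈ Sm then 1 else 0) - (if y ∈ Sp then 1 else 0) with hσ
  have h2 : ∀ y ∈ Y, M (U y + δ) - M (U y - δ) = σ y := by
    intro y hy
    obtain ⟨hy0, hy2⟩ := (memY y).1 hy
    obtain ⟨d1, d2, d3, d4⟩ := hδY y hy
    obtain ⟨y1, hy1, hUy1⟩ := hU.exists_pre (u := U y - δ) (by linarith) (by linarith)
    obtain ⟨y3, hy3, hUy3⟩ := hU.exists_pre (u := U y + δ) (by linarith) (by linarith)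
    have l1 : y1 < y := (hU.strictMono.lt_iff_lt (mem_Ici.2 hy1) (mem_Ici.2 hy0.le)).1 (by linarith)
    have l3 : y < y3 := (hU.strictMono.lt_iff_lt (mem_Ici.2 hy0.le) (mem_Ici.2 hy3)).1 (by linarith)
    have hy1pos : 0 < y1 := by
      refine lt_of_le_of_ne hy1 ?_
      rintro rfl
      rw [hU.zero_val] at hUy1
      linarith
    have nz : ∀ t, y1 ≤ t → t ≤ y3 → t ≠ y → iteratedDeriv 2 U t ≠ 0 := by
      intro t ht1 ht3 hne h0
      have htpos : 0 < t := hy1pos.trans_le ht1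
      have htY : t ∈ Y := (memY t).2 ⟨htpos, h0⟩
      have e1 := hU.strictMono.monotoneOn (mem_Ici.2 hy1) (mem_Ici.2 htpos.le) ht1
      have e3 := hU.strictMono.monotoneOn (mem_Ici.2 htpos.le) (mem_Ici.2 hy3) ht3
      have := d3 t htY (Ne.symm hne)
      rw [lt_abs] at this
      rcases this with h | h <;> linarith
    have gm : U y - δ ∈ good := by
      intro y' hy'
      by_cases hne : y = y'
      · subst hne; rw [le_abs]; right; linarith
      · have := d3 y' hy' hne
        rw [lt_abs] at this
        rw [le_abs]
        rcases this with h | h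
        · left; linarith
        · right; linarith
    have gp : U y + δ ∈ good := by
      intro y' hy'
      by_cases hne : y = y'
      · subst hne; rw [le_abs]; left; linarith
      · have := d3 y' hy' hne
        rw [lt_abs] at this
        rw [le_abs]
        rcases this with h | h
        · left; linarith
        · right; linarith
    have pδ : p ≤ δ := min_le_right _ _
    have qδ : 1 - δ ≤ q := le_max_right _ _
    have sm := hKη (U y - δ) ⟨⟨by linarith, by linarith⟩, gm⟩
    have sp := hKη (U y + δ) ⟨⟨by linarith, by linarith⟩, gp⟩
    rw [← hH] at sm sp
    have nm := nz y1 le_rfl (l1.trans l3).le l1.ne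
    have np := nz y3 (l1.trans l3).le le_rfl l3.ne'
    have hbox : ∀ t ∈ Icc (U y - δ) (U y + δ), 0 < (H (lineP η t)).re * chiAbscissa U y := by
      intro t ht
      refine d4 _ ?_ (by rwa [lineP_im]) (by rw [lineP_im]; exact hη3.le)
      rw [lineP_re, abs_le]
      exact ⟨by linarith [ht.1], by linarith [ht.2]⟩
    have hle : U y - δ ≤ U y + δ := by linarith
    have hsub : lineP η '' Icc (U y - δ) (U y + δ) ⊆ ℍ := by rintro _ ⟨t, -, rfl⟩; exact hline t
    rcases lt_or_gt_of_ne (hχ y hy) with hχn | hχp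
    · have hrn : ∀ z ∈ lineP η '' Icc (U y - δ) (U y + δ), (H z).re < 0 := by
        rintro _ ⟨t, ht, rfl⟩
        have := hbox t ht
        by_contra hh
        push Not at hh
        nlinarith
      have hbr := branch_const_neg (lineP_pre η _ _) (hhc.mono hsub) (hHc.mono hsub)
        (fun z hz => hexp z (hsub hz)) hrn
        (mem_image_of_mem _ (left_mem_Icc.2 hle)) (mem_image_of_mem _ (right_mem_Icc.2 hle))
      have hmSm : y ∈ Sm ↔ 0 < iteratedDeriv 2 U y1 ∧ iteratedDeriv 2 U y3 < 0 := by
        rw [sign_both hU.cont2 l1 l3 (fun t ht => nz t ht.1 (ht.2.trans l3).le ht.2.ne)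
          (fun t ht => nz t (l1.trans ht.1).le ht.2 ht.1.ne')]
        exact ⟨fun h => h.2.2.2, fun h => ⟨hy0, hy2, hχn, h⟩⟩
      have hmSp : y ∈ Sp ↔ iteratedDeriv 2 U y1 < 0 ∧ 0 < iteratedDeriv 2 U y3 := by
        have := sign_both (f := fun t => - iteratedDeriv 2 U t) hU.cont2.neg l1 l3
          (fun t ht => neg_ne_zero.2 (nz t ht.1 (ht.2.trans l3).le ht.2.ne))
          (fun t ht => neg_ne_zero.2 (nz t (l1.trans ht.1).le ht.2 ht.1.ne'))
        simp only [Left.neg_pos_iff, Left.neg_neg_iff] at this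
        rw [this]
        exact ⟨fun h => h.2.2.2, fun h => ⟨hy0, hy2, hχn, h⟩⟩
      have imp1 : 0 < iteratedDeriv 2 U y1 → 0 < (H (lineP η (U y - δ))).im := by
        intro hh
        rw [← hU.g_pos_iff hy1, hUy1] at hh
        exact pos_of_mul_pos_left sm hh.le
      have imn1 : iteratedDeriv 2 U y1 < 0 → (H (lineP η (U y - δ))).im < 0 := by
        intro hh
        rw [← hU.g_neg_iff hy1, hUy1] at hh
        by_contra h3
        push Not at h3
        nlinarith
      have imp3 : 0 < iteratedDeriv 2 U y3 → 0 < (H (lineP η (U y + δ))).im := by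
        intro hh
        rw [← hU.g_pos_iff hy3, hUy3] at hh
        exact pos_of_mul_pos_left sp hh.le
      have imn3 : iteratedDeriv 2 U y3 < 0 → (H (lineP η (U y + δ))).im < 0 := by
        intro hh
        rw [← hU.g_neg_iff hy3, hUy3] at hh
        by_contra h3
        push Not at h3
        nlinarith
      simp only [hM, hσ, hmSm, hmSp]
      rcases lt_or_gt_of_ne nm with s1 | s1 <;> rcases lt_or_gt_of_ne np with s3 | s3
      · rw [Complex.arg_neg_eq_arg_add_pi_of_im_neg (imn1 s1),
          Complex.arg_neg_eq_arg_add_pi_of_im_neg (imn3 s3)] at hbr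
        simp only [s1, s3, s1.not_gt, s3.not_gt, and_true, and_false, if_false]
        field_simp
        linarith
      · rw [Complex.arg_neg_eq_arg_add_pi_of_im_neg (imn1 s1),
          Complex.arg_neg_eq_arg_sub_pi_of_im_pos (imp3 s3)] at hbr
        simp only [s1, s3, s1.not_gt, s3.not_gt, and_true, and_false, if_false, if_true]
        field_simp
        linarith
      · rw [Complex.arg_neg_eq_arg_sub_pi_of_im_pos (imp1 s1),
          Complex.arg_neg_eq_arg_add_pi_of_im_neg (imn3 s3)] at hbr
        simp only [s1, s3, s1.not_gt, s3.not_gt, and_true, and_false, if_false, if_true]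
        field_simp
        linarith
      · rw [Complex.arg_neg_eq_arg_sub_pi_of_im_pos (imp1 s1),
          Complex.arg_neg_eq_arg_sub_pi_of_im_pos (imp3 s3)] at hbr
        simp only [s1, s3, s1.not_gt, s3.not_gt, and_true, and_false, if_false]
        field_simp
        linarith
    · have hrn : ∀ z ∈ lineP η '' Icc (U y - δ) (U y + δ), H z ∈ Complex.slitPlane := by
        rintro _ ⟨t, ht, rfl⟩
        left
        exact pos_of_mul_pos_left (hbox t ht) hχp.le
      have hbr := branch_const (lineP_pre η _ _) (hhc.mono hsub) (hHc.mono hsub)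
        (fun z hz => hexp z (hsub hz)) hrn
        (mem_image_of_mem _ (left_mem_Icc.2 hle)) (mem_image_of_mem _ (right_mem_Icc.2 hle))
      have n1 : y ∉ Sm := fun h => absurd h.2.2.1 (not_lt.2 hχp.le)
      have n2 : y ∉ Sp := fun h => absurd h.2.2.1 (not_lt.2 hχp.le)
      simp only [hM, hσ, n1, n2, if_false]
      rw [hbr]
      simp
  have hsum := sum_jumps Y U σ M hδ (fun y hy y' hy' hne => (hδY y hy).2.2.1 y' hy' hne) h1 h2 Y.card 0 1
    le_rfl zero_le_one le_rfl
    (fun y hy => by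
      have := (hδY y hy).1
      rw [le_abs]; right; linarith)
    (fun y hy => by
      have := (hδY y hy).2.1
      rw [le_abs]; left; linarith) (Finset.card_filter_le _ _)
  have hfil : Y.filter (fun y => U y ∈ Ioo 0 1) = Y :=
    Finset.filter_true_of_mem fun y hy => ⟨hU0 y hy, hU1 y hy⟩
  rw [hfil] at hsum
  -- outer path
  have outer : ∀ S : Set ℂ, Convex ℝ S → S ⊆ ℍ → (∀ μ ∈ S, 0 ≤ μ.re ^ 2 - μ.re + μ.im ^ 2) →
      ∀ x ∈ S, ∀ y ∈ S, (h x).im - (H x).arg = (h y).im - (H y).arg := by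
    intro S hS hsub hc x hx y hy
    exact branch_const hS.isPreconnected (hhc.mono hsub) (hHc.mono hsub) (fun z hz => hexp z (hsub hz))
      (fun z hz => Or.inr (hU.phi_im_neg (hsub hz) (hc z hz)).ne) hx hy
  have o1 := outer ({c | c.re ≤ 0} ∩ {c | 0 < c.im}) ((convex_halfSpace_re_le 0).inter (convex_halfSpace_im_gt 0))
    inter_subset_right (fun μ hμ => by have := hμ.1; have : μ.re ≤ 0 := this; nlinarith [sq_nonneg μ.re, sq_nonneg μ.im])
    (lineP η 0) ⟨by simp [lineP, hη], by simp [lineP, hη]⟩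
    (lineP 1 0) ⟨by simp [lineP, hη], by simp [lineP, hη]⟩
  have o2 := outer {c | 1 ≤ c.im} (convex_halfSpace_im_ge 1)
    (fun μ hμ => by have : 1 ≤ μ.im := hμ
                    show 0 < μ.im
                    linarith)
    (fun μ hμ => by have : 1 ≤ μ.im := hμ
                    nlinarith [sq_nonneg (μ.re - 1/2)])
    (lineP 1 0) (by simp [lineP, hη])
    (lineP 1 1) (by simp [lineP, hη])
  have o3 := outer ({c | 1 ≤ c.re} ∩ {c | 0 < c.im}) ((convex_halfSpace_re_ge 1).inter (convex_halfSpace_im_gt 0))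
    inter_subset_right (fun μ hμ => by have : 1 ≤ μ.re := hμ.1; nlinarith [sq_nonneg μ.im])
    (lineP 1 1) ⟨by simp [lineP, hη], by simp [lineP, hη]⟩
    (lineP η 1) ⟨by simp [lineP, hη], by simp [lineP, hη]⟩
  have hM01 : M 0 = M 1 := by
    simp only [hM]
    rw [o1, o2, o3]
  rw [hM01, sub_self] at hsum
  have hcardm : (xiMinus U 0 : ℝ) = ∑ y ∈ Y, (if y ∈ Sm then (1:ℝ) else 0) := by
    rw [Finset.sum_boole]
    have : xiMinus U 0 = Sm.ncard := rfl
    rw [this, ← Set.ncard_coe_finset]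
    congr 2
    ext y
    simp only [Finset.coe_filter, mem_ofPred_eq, memY]
    exact ⟨fun h => ⟨⟨h.1, h.2.1⟩, h⟩, fun h => h.2⟩
  have hcardp : (xiPlus U 0 : ℝ) = ∑ y ∈ Y, (if y ∈ Sp then (1:ℝ) else 0) := by
    rw [Finset.sum_boole]
    have : xiPlus U 0 = Sp.ncard := rfl
    rw [this, ← Set.ncard_coe_finset]
    congr 2
    ext y
    simp only [Finset.coe_filter, mem_ofPred_eq, memY]
    exact ⟨fun h => ⟨⟨h.1, h.2.1⟩, h⟩, fun h => h.2⟩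
  rw [hσ, Finset.sum_sub_distrib, ← hcardm, ← hcardp] at hsum
  have : (xiPlus U 0 : ℝ) < xiMinus U 0 := by exact_mod_cast hξpm
  linarith

end AdmissibleShearFlow
end

noncomputable section
open Topology

theorem hurwitz {f H : ℂ → ℂ} {z0 : ℂ} {r m : ℝ} (hr : 0 < r) (hm : 0 < m)
    (hf : ∀ z ∈ Metric.closedBall z0 r, DifferentiableAt ℂ f z)
    (hH : ∀ z ∈ Metric.sphere z0 r, m ≤ ‖H z‖) (hH0 : H z0 = 0)
    (hclose : ∀ z ∈ Metric.closedBall z0 r, ‖f z - H z‖ ≤ m / 8) {L : ℂ} (hL : ‖L‖ < m / 8) :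
    ∃ z ∈ Metric.closedBall z0 r, f z = L := by
  have h0mem : z0 ∈ Metric.closedBall z0 r := Metric.mem_closedBall_self hr.le
  have hf0 : ‖f z0‖ ≤ m / 8 := by simpa [hH0] using hclose z0 h0mem
  have hd : DiffContOnCl ℂ f (Metric.ball z0 r) := by
    apply DifferentiableOn.diffContOnCl
    rw [closure_ball z0 hr.ne']
    exact fun z hz => (hf z hz).differentiableWithinAt
  have hsph : ∀ z ∈ Metric.sphere z0 r, m / 2 ≤ ‖f z - f z0‖ := by
    intro z hz
    have h1 := hH z hz
    have h2 := hclose z (Metric.sphere_subset_closedBall hz)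
    have h3 : H z = (f z - f z0) - ((f z - H z) - f z0) := by ring
    have h4 : ‖H z‖ ≤ ‖f z - f z0‖ + (‖f z - H z‖ + ‖f z0‖) := by
      calc ‖H z‖ = ‖(f z - f z0) - ((f z - H z) - f z0)‖ := by rw [← h3]
        _ ≤ _ := (norm_sub_le _ _).trans (add_le_add_right (norm_sub_le _ _) _)
    linarith
  have hfreq : ∃ᶠ z in 𝓝 z0, f z ≠ f z0 := by
    intro hev
    simp only [not_not] at hev
    have han : AnalyticOnNhd ℂ f (Metric.ball z0 r) :=
      hd.differentiableOn.analyticOnNhd Metric.isOpen_ball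
    have heq : EqOn f (fun _ => f z0) (Metric.ball z0 r) :=
      han.eqOn_of_preconnected_of_eventuallyEq analyticOnNhd_const
        (convex_ball z0 r).isPreconnected (Metric.mem_ball_self hr) hev
    have heq2 : EqOn f (fun _ => f z0) (closure (Metric.ball z0 r)) :=
      heq.of_subset_closure hd.continuousOn continuousOn_const subset_closure subset_rfl
    rw [closure_ball z0 hr.ne'] at heq2
    have hz : z0 + r ∈ Metric.sphere z0 r := by simp [abs_of_pos hr]
    have h1 := hsph _ hz
    rw [heq2 (Metric.sphere_subset_closedBall hz)] at h1
    simp at h1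
    linarith
  have := hd.ball_subset_image_closedBall hr hsph hfreq
  have hmem : L ∈ Metric.ball (f z0) (m / 2 / 2) := by
    rw [Metric.mem_ball, dist_eq_norm]
    have := norm_sub_le L (f z0)
    linarith
  obtain ⟨z, hz, hz2⟩ := this hmem
  exact ⟨z, hz, hz2⟩

namespace AdmissibleShearFlow

theorem exists_disc {U : ℝ → ℝ} (hU : AdmissibleShearFlow U)
    (hξ : xiEq U 0 = 0) (hξpm : xiPlus U 0 < xiMinus U 0) :
    ∃ μ₀ : ℂ, ∃ r > 0, ∃ m > 0, PhiInv U μ₀ = 0 ∧ (∀ z ∈ Metric.sphere μ₀ r, m ≤ ‖PhiInv U z‖) ∧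
      ∃ η > 0, ∀ z ∈ Metric.closedBall μ₀ r, η ≤ z.im := by
  obtain ⟨μ₀, hμ₀, hz⟩ := hU.exists_zero hξ hξpm
  have hopen : IsOpen {μ : ℂ | 0 < μ.im} := isOpen_lt continuous_const Complex.continuous_im
  have han : AnalyticOnNhd ℂ (PhiInv U) {μ : ℂ | 0 < μ.im} := hU.phi_diff.analyticOnNhd hopen
  have hiso : ∀ᶠ z in 𝓝[≠] μ₀, PhiInv U z ≠ 0 := by
    rcases (han μ₀ hμ₀).eventually_eq_zero_or_eventually_ne_zero with h | h
    · exfalso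
      have := han.eqOn_zero_of_preconnected_of_eventuallyEq_zero
        (convex_halfSpace_im_gt 0).isPreconnected hμ₀ h
      have h1 : PhiInv U Complex.I = 0 := this (by simp)
      have h2 := hU.phi_im_neg (μ := Complex.I) (by simp) (by simp)
      rw [h1] at h2
      simp at h2
    · exact h
  rw [eventually_nhdsWithin_iff, Metric.eventually_nhds_iff] at hiso
  obtain ⟨ε, hε, hiso⟩ := hiso
  set r := min (ε / 2) (μ₀.im / 2) with hr
  have hrpos : 0 < r := by positivity
  have him : ∀ z ∈ Metric.closedBall μ₀ r, μ₀.im / 2 ≤ z.im := by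
    intro z hz
    rw [Metric.mem_closedBall, dist_eq_norm] at hz
    have h1 := (Complex.abs_im_le_norm (z - μ₀)).trans hz
    rw [Complex.sub_im, abs_le] at h1
    have := min_le_right (ε / 2) (μ₀.im / 2)
    linarith [h1.1]
  have hcont : ContinuousOn (fun z => ‖PhiInv U z‖) (Metric.sphere μ₀ r) := by
    refine (hU.phi_diff.continuousOn.mono ?_).norm
    intro z hz
    have := him z (Metric.sphere_subset_closedBall hz)
    show 0 < z.im
    linarith
  obtain ⟨w, hw, hmin⟩ := (isCompact_sphere μ₀ r).exists_isMinOn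
    (NormedSpace.sphere_nonempty.2 hrpos.le) hcont
  refine ⟨μ₀, r, hrpos, ‖PhiInv U w‖, ?_, hz, fun z hz => hmin hz, μ₀.im / 2, half_pos hμ₀, him⟩
  rw [gt_iff_lt, norm_pos_iff]
  rw [Metric.mem_sphere] at hw
  refine hiso ?_ ?_
  · rw [hw]
    have := min_le_left (ε / 2) (μ₀.im / 2)
    linarith
  · rintro rfl
    simp at hw
    linarith

end AdmissibleShearFlow
end

noncomputable section
open Topology

/-- Lebesgue measure on the half line. -/
abbrev mI : Measure ℝ := volume.restrict (Ioi (0:ℝ))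

/-- The space `L¹(0, ∞)`. -/
abbrev EI : Type := Lp ℂ 1 mI

theorem EI.int (v : EI) : Integrable v mI := L1.integrable_coeFn v

theorem exists_op (f : EI → ℝ → ℂ) (hi : ∀ v, Integrable (f v) mI)
    (hadd : ∀ u v, f (u + v) =ᵐ[mI] fun y => f u y + f v y)
    (hsmul : ∀ (c : ℂ) v, f (c • v) =ᵐ[mI] fun y => c * f v y) {C : ℝ} (hC : 0 ≤ C)
    (hb : ∀ v, ∫ y, ‖f v y‖ ∂mI ≤ C * ‖v‖) :
    ∃ T : EI →L[ℂ] EI, ‖T‖ ≤ C ∧ ∀ v, T v =ᵐ[mI] f v := by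
  let T0 : EI →ₗ[ℂ] EI :=
    { toFun := fun v => (hi v).toL1 _
      map_add' := by
        intro u v
        rw [← Integrable.toL1_add]
        exact (Integrable.toL1_eq_toL1_iff _ _ _ _).2 (hadd u v)
      map_smul' := by
        intro c v
        simp only [RingHom.id_apply]
        rw [← Integrable.toL1_smul]
        exact (Integrable.toL1_eq_toL1_iff _ _ _ _).2 (hsmul c v) }
  have hbound : ∀ v, ‖T0 v‖ ≤ C * ‖v‖ := by
    intro v
    change ‖(hi v).toL1 _‖ ≤ _
    rw [L1.norm_of_fun_eq_integral_norm]
    exact hb v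
  refine ⟨T0.mkContinuous C hbound, T0.mkContinuous_norm_le hC hbound, fun v => ?_⟩
  exact (hi v).coeFn_toL1

theorem EI.norm_eq (v : EI) : ‖v‖ = ∫ y, ‖v y‖ ∂mI := L1.norm_eq_integral_norm v

theorem exists_kerOp (k : ℝ → ℝ → ℂ) (hk : Measurable (Function.uncurry k)) {C : ℝ} (hC0 : 0 ≤ C)
    (hintg : ∀ x, 0 < x → Integrable (fun y => k y x) mI)
    (hC : ∀ x, 0 < x → ∫ y, ‖k y x‖ ∂mI ≤ C) :
    ∃ T : EI →L[ℂ] EI, ‖T‖ ≤ C ∧ ∀ v : EI, T v =ᵐ[mI] fun y => ∫ x, k y x * v x ∂mI := by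
  have hprod : ∀ v : EI, Integrable (fun p : ℝ × ℝ => k p.1 p.2 * v p.2) (mI.prod mI) := by
    intro v
    have hm : AEStronglyMeasurable (fun p : ℝ × ℝ => k p.1 p.2 * v p.2) (mI.prod mI) :=
      hk.aestronglyMeasurable.mul (v.int.aestronglyMeasurable.comp_snd)
    rw [integrable_prod_iff' hm]
    constructor
    · filter_upwards [ae_restrict_mem measurableSet_Ioi] with x hx
      exact (hintg x hx).mul_const _
    · have hg : Integrable (fun x => C * ‖v x‖) mI := v.int.norm.const_mul C
      refine hg.mono' (hm.norm.prod_swap.integral_prod_right') ?_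
      filter_upwards [ae_restrict_mem measurableSet_Ioi] with x hx
      rw [Real.norm_of_nonneg (integral_nonneg fun _ => norm_nonneg _)]
      simp only [norm_mul]
      rw [integral_mul_const]
      exact mul_le_mul_of_nonneg_right (hC x hx) (norm_nonneg _)
  refine exists_op (fun v y => ∫ x, k y x * v x ∂mI) ?_ ?_ ?_ hC0 ?_
  · intro v
    exact (hprod v).integral_prod_left
  · intro u v
    filter_upwards [(hprod u).prod_right_ae, (hprod v).prod_right_ae] with y hu hv
    rw [← integral_add hu hv]
    apply integral_congr_ae
    filter_upwards [Lp.coeFn_add u v] with x hx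
    rw [hx, Pi.add_apply, mul_add]
  · intro c v
    filter_upwards with y
    rw [← integral_const_mul]
    apply integral_congr_ae
    filter_upwards [Lp.coeFn_smul c v] with x hx
    rw [hx, Pi.smul_apply, smul_eq_mul]; ring
  · intro v
    calc ∫ y, ‖∫ x, k y x * v x ∂mI‖ ∂mI ≤ ∫ y, (∫ x, ‖k y x * v x‖ ∂mI) ∂mI := by
          apply integral_mono_ae (hprod v).integral_prod_left.norm (hprod v).norm.integral_prod_left
          filter_upwards with y
          exact norm_integral_le_integral_norm _
      _ = ∫ x, (∫ y, ‖k y x * v x‖ ∂mI) ∂mI := integral_integral_swap (hprod v).norm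
      _ ≤ ∫ x, C * ‖v x‖ ∂mI := by
          apply integral_mono_ae (hprod v).norm.integral_prod_right (v.int.norm.const_mul C)
          filter_upwards [ae_restrict_mem measurableSet_Ioi] with x hx
          simp only [norm_mul]
          rw [integral_mul_const]
          exact mul_le_mul_of_nonneg_right (hC x hx) (norm_nonneg _)
      _ = C * ‖v‖ := by rw [integral_const_mul, EI.norm_eq]

theorem exists_mulOp (c : ℝ → ℂ) (hc : Continuous c) {C : ℝ} (hC0 : 0 ≤ C)
    (hC : ∀ y, 0 < y → ‖c y‖ ≤ C) :
    ∃ T : EI →L[ℂ] EI, ‖T‖ ≤ C ∧ ∀ v : EI, T v =ᵐ[mI] fun y => c y * v y := by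
  have hb : ∀ᵐ y ∂mI, ‖c y‖ ≤ C := by
    filter_upwards [ae_restrict_mem measurableSet_Ioi] with y hy
    exact hC y hy
  have hi : ∀ v : EI, Integrable (fun y => c y * v y) mI := fun v =>
    v.int.bdd_mul (c := C) hc.aestronglyMeasurable hb
  refine exists_op (fun v y => c y * v y) hi ?_ ?_ hC0 ?_
  · intro u v
    filter_upwards [Lp.coeFn_add u v] with x hx
    rw [hx, Pi.add_apply, mul_add]
  · intro a v
    filter_upwards [Lp.coeFn_smul a v] with x hx
    rw [hx, Pi.smul_apply, smul_eq_mul]; ring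
  · intro v
    calc ∫ y, ‖c y * v y‖ ∂mI ≤ ∫ y, C * ‖v y‖ ∂mI := by
          apply integral_mono_ae (hi v).norm (v.int.norm.const_mul C)
          filter_upwards [hb] with y hy
          rw [norm_mul]
          exact mul_le_mul_of_nonneg_right hy (norm_nonneg _)
      _ = C * ‖v‖ := by rw [integral_const_mul, EI.norm_eq]

theorem int_le_eq (f : ℝ → ℂ) {y : ℝ} (hy : 0 ≤ y) :
    ∫ x, (if x ≤ y then f x else 0) ∂mI = ∫ x in (0:ℝ)..y, f x := by
  rw [intervalIntegral.integral_of_le hy]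
  have : (fun x => if x ≤ y then f x else 0) = (Iic y).indicator f := by
    ext x; simp [indicator]
  rw [this, setIntegral_indicator measurableSet_Iic, Ioi_inter_Iic]

theorem int_gt_eq (f : ℝ → ℂ) {y : ℝ} (hy : 0 ≤ y) :
    ∫ x, (if y < x then f x else 0) ∂mI = ∫ x in Ioi y, f x := by
  have : (fun x => if y < x then f x else 0) = (Ioi y).indicator f := by
    ext x; simp [indicator]
  rw [this, setIntegral_indicator measurableSet_Ioi, Ioi_inter_Ioi, max_eq_right hy]

theorem exists_volOp (p q : ℝ → ℂ) (hp : Continuous p) (hpi : Integrable p mI) (hq : Continuous q)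
    {Q : ℝ} (hQ0 : 0 ≤ Q) (hQ : ∀ y, 0 < y → ‖q y‖ ≤ Q) :
    ∃ T : EI →L[ℂ] EI, ‖T‖ ≤ (∫ y, ‖p y‖ ∂mI) * Q ∧
      ∀ v : EI, T v =ᵐ[mI] fun y => p y * ∫ x in (0:ℝ)..y, q x * v x := by
  have hi : ∀ x, 0 < x → Integrable (fun y => if x ≤ y then p y * q x else 0) mI := by
    intro x hx
    have : (fun y => if x ≤ y then p y * q x else 0) = (Ici x).indicator (fun y => p y * q x) := by
      ext y; simp [indicator]
    rw [this]
    exact (hpi.mul_const _).indicator measurableSet_Ici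
  have hCC : ∀ x, 0 < x → ∫ y, ‖(if x ≤ y then p y * q x else 0)‖ ∂mI ≤ (∫ y, ‖p y‖ ∂mI) * Q := by
    intro x hx
    rw [← integral_mul_const]
    apply integral_mono_ae (hi x hx).norm (hpi.norm.mul_const Q)
    filter_upwards with y
    split_ifs
    · rw [norm_mul]
      exact mul_le_mul_of_nonneg_left (hQ x hx) (norm_nonneg _)
    · simp only [norm_zero]
      positivity
  obtain ⟨T, hT, hT2⟩ := exists_kerOp (fun y x => if x ≤ y then p y * q x else 0)
    (C := (∫ y, ‖p y‖ ∂mI) * Q)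
    (Measurable.ite (measurableSet_le measurable_snd measurable_fst)
      ((hp.measurable.comp measurable_fst).mul (hq.measurable.comp measurable_snd)) measurable_const)
    (mul_nonneg (integral_nonneg fun _ => norm_nonneg _) hQ0) hi hCC
  · refine ⟨T, hT, fun v => ?_⟩
    filter_upwards [hT2 v, ae_restrict_mem measurableSet_Ioi] with y hy hy0
    rw [hy]
    have := int_le_eq (fun x => p y * (q x * v x)) (le_of_lt hy0)
    rw [intervalIntegral.integral_const_mul] at this
    rw [← this]
    congr 1; ext x
    split_ifs
    · ring
    · simp

theorem exp_int {s : ℝ} (hs : 0 < s) (x : ℝ) :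
    IntegrableOn (fun y => s * Real.exp (-s * (y - x))) (Ioi x) ∧
    ∫ y in Ioi x, s * Real.exp (-s * (y - x)) = 1 := by
  have hd : ∀ y ∈ Ici x, HasDerivAt (fun y => -Real.exp (-s * (y - x)))
      (s * Real.exp (-s * (y - x))) y := by
    intro y _
    have h1 : HasDerivAt (fun y : ℝ => -s * (y - x)) (-s * 1) y :=
      ((hasDerivAt_id y).sub_const x).const_mul (-s)
    refine h1.exp.neg.congr_deriv ?_
    ring
  have ht : Tendsto (fun y => -Real.exp (-s * (y - x))) atTop (𝓝 0) := by
    rw [← neg_zero]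
    refine (Real.tendsto_exp_atBot.comp ?_).neg
    exact (tendsto_atTop_add_const_right _ (-x) tendsto_id).const_mul_atTop_of_neg (by linarith)
  have h1 := integrableOn_Ioi_deriv_of_nonneg' hd (fun y _ => by positivity) ht
  refine ⟨h1, ?_⟩
  rw [integral_Ioi_of_hasDerivAt_of_tendsto' hd h1 ht]
  simp

theorem exists_Jp {s : ℝ} (hs : 0 < s) :
    ∃ T : EI →L[ℂ] EI, ‖T‖ ≤ 1 ∧
      ∀ v : EI, T v =ᵐ[mI] fun y => ∫ x in (0:ℝ)..y, ((s * Real.exp (-s * (y - x)) : ℝ) : ℂ) * v x := by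
  have hi0 : ∀ x, 0 < x → Integrable (fun y => if x < y then (s * Real.exp (-s * (y - x))) else 0) mI := by
    intro x hx
    have : (fun y => if x < y then (s * Real.exp (-s * (y - x))) else 0)
        = (Ioi x).indicator (fun y => s * Real.exp (-s * (y - x))) := by
      ext y; simp [indicator]
    rw [this, integrable_indicator_iff measurableSet_Ioi]
    unfold IntegrableOn
    rw [Measure.restrict_restrict measurableSet_Ioi, Ioi_inter_Ioi, max_eq_left hx.le]
    exact (exp_int hs x).1
  have he : ∀ x y : ℝ, (if x < y then ((s * Real.exp (-s * (y - x)) : ℝ) : ℂ) else 0)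
      = ((if x < y then (s * Real.exp (-s * (y - x))) else 0 : ℝ) : ℂ) := by
    intro x y; split_ifs <;> simp
  have hi : ∀ x, 0 < x → Integrable
      (fun y => if x < y then ((s * Real.exp (-s * (y - x)) : ℝ) : ℂ) else 0) mI := by
    intro x hx
    simp only [he]
    exact (hi0 x hx).ofReal
  have hCC : ∀ x, 0 < x → ∫ y, ‖(if x < y then ((s * Real.exp (-s * (y - x)) : ℝ) : ℂ) else 0)‖ ∂mI ≤ 1 := by
    intro x hx
    have h1 : ∀ y, ‖(if x < y then ((s * Real.exp (-s * (y - x)) : ℝ) : ℂ) else 0)‖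
        = (Ioi x).indicator (fun y => s * Real.exp (-s * (y - x))) y := by
      intro y
      simp only [indicator, mem_Ioi]
      split_ifs
      · rw [Complex.norm_real, Real.norm_of_nonneg (by positivity)]
      · simp
    simp only [h1]
    rw [setIntegral_indicator measurableSet_Ioi, Ioi_inter_Ioi, max_eq_right hx.le, (exp_int hs x).2]
  obtain ⟨T, hT, hT2⟩ := exists_kerOp
    (fun y x => if x < y then ((s * Real.exp (-s * (y - x)) : ℝ) : ℂ) else 0) (C := 1)
    (Measurable.ite (measurableSet_lt measurable_snd measurable_fst)
      (by fun_prop) measurable_const) zero_le_one hi hCC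
  · refine ⟨T, hT, fun v => ?_⟩
    filter_upwards [hT2 v, ae_restrict_mem measurableSet_Ioi] with y hy hy0
    rw [hy, ← int_le_eq _ (le_of_lt hy0)]
    apply integral_congr_ae
    have : ∀ᵐ x ∂mI, x ≠ y := ae_restrict_of_ae (by simp [ae_iff])
    filter_upwards [this] with x hx
    rcases lt_or_gt_of_ne hx with h | h
    · rw [if_pos h, if_pos h.le]
    · rw [if_neg (not_lt.2 h.le), if_neg (not_le.2 h), zero_mul]

theorem exists_Jm {s : ℝ} (hs : 0 < s) :
    ∃ T : EI →L[ℂ] EI, ‖T‖ ≤ 1 ∧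
      ∀ v : EI, T v =ᵐ[mI] fun y => ∫ x in Ioi y, ((s * Real.exp (-s * (x - y)) : ℝ) : ℂ) * v x := by
  have hc : ∀ x, Continuous (fun y : ℝ => s * Real.exp (-s * (x - y))) := by
    intro x; fun_prop
  have he : ∀ x y : ℝ, ‖(if y < x then ((s * Real.exp (-s * (x - y)) : ℝ) : ℂ) else 0)‖
      = (Iio x).indicator (fun y => s * Real.exp (-s * (x - y))) y := by
    intro x y
    simp only [indicator, mem_Iio]
    split_ifs
    · rw [Complex.norm_real, Real.norm_of_nonneg (by positivity)]
    · simp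
  have hmeas : Measurable (Function.uncurry fun y x : ℝ =>
      if y < x then ((s * Real.exp (-s * (x - y)) : ℝ) : ℂ) else 0) :=
    Measurable.ite (measurableSet_lt measurable_fst measurable_snd) (by fun_prop) measurable_const
  have hi : ∀ x, 0 < x → Integrable
      (fun y => if y < x then ((s * Real.exp (-s * (x - y)) : ℝ) : ℂ) else 0) mI := by
    intro x hx
    rw [← integrable_norm_iff]
    · simp only [he]
      rw [integrable_indicator_iff measurableSet_Iio]
      unfold IntegrableOn
      rw [Measure.restrict_restrict measurableSet_Iio, inter_comm, Ioi_inter_Iio]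
      exact ((hc x).integrableOn_Icc (a := 0) (b := x)).mono_set Ioo_subset_Icc_self
    · exact (hmeas.comp (measurable_id.prodMk measurable_const)).aestronglyMeasurable
  have hCC : ∀ x, 0 < x → ∫ y, ‖(if y < x then ((s * Real.exp (-s * (x - y)) : ℝ) : ℂ) else 0)‖ ∂mI ≤ 1 := by
    intro x hx
    simp only [he]
    rw [setIntegral_indicator measurableSet_Iio, Ioi_inter_Iio, ← integral_Ioc_eq_integral_Ioo,
      ← intervalIntegral.integral_of_le hx.le]
    have hd : ∀ y ∈ uIcc 0 x, HasDerivAt (fun y => Real.exp (-s * (x - y)))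
        (s * Real.exp (-s * (x - y))) y := by
      intro y _
      have h1 : HasDerivAt (fun y : ℝ => -s * (x - y)) (-s * (-1)) y :=
        ((hasDerivAt_id y).const_sub x).const_mul (-s)
      refine h1.exp.congr_deriv ?_
      ring
    rw [intervalIntegral.integral_eq_sub_of_hasDerivAt hd ((hc x).intervalIntegrable _ _)]
    simp
    positivity
  obtain ⟨T, hT, hT2⟩ := exists_kerOp
    (fun y x => if y < x then ((s * Real.exp (-s * (x - y)) : ℝ) : ℂ) else 0) (C := 1)
    hmeas zero_le_one hi hCC
  · refine ⟨T, hT, fun v => ?_⟩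
    filter_upwards [hT2 v, ae_restrict_mem measurableSet_Ioi] with y hy hy0
    rw [hy, ← int_gt_eq _ (le_of_lt hy0)]
    congr 1; ext x
    split_ifs <;> simp
end

noncomputable section
open Topology

theorem parts {a b : ℝ} (hab : a ≤ b) {φ φ' f : ℝ → ℂ} (hφ : ∀ x, HasDerivAt φ (φ' x) x)
    (hc : Continuous φ') (hf : IntegrableOn f (Ioc a b)) :
    ∫ x in a..b, φ' x * ∫ z in a..x, f z = φ b * (∫ x in a..b, f x) - ∫ x in a..b, φ x * f x := by
  have hφc : Continuous φ := continuous_iff_continuousAt.2 fun x => (hφ x).continuousAt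
  set ν : Measure ℝ := volume.restrict (Ioc a b) with hν
  have h1 : Integrable φ' ν := (hc.integrableOn_Icc).mono_set Ioc_subset_Icc_self
  have h2 : Integrable (fun p : ℝ × ℝ => φ' p.1 * f p.2) (ν.prod ν) := h1.mul_prod hf
  have h3 : Integrable (fun p : ℝ × ℝ => if p.2 ≤ p.1 then φ' p.1 * f p.2 else 0) (ν.prod ν) := by
    have : (fun p : ℝ × ℝ => if p.2 ≤ p.1 then φ' p.1 * f p.2 else 0)
        = {p : ℝ × ℝ | p.2 ≤ p.1}.indicator (fun p => φ' p.1 * f p.2) := by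
      ext p; simp [indicator]
    rw [this]
    exact h2.indicator (measurableSet_le measurable_snd measurable_fst)
  have hsw := integral_integral_swap (μ := ν) (ν := ν)
    (f := fun x z => if z ≤ x then φ' x * f z else 0) h3
  have e1 : ∫ x in a..b, φ' x * ∫ z in a..x, f z
      = ∫ x, (∫ z, (if z ≤ x then φ' x * f z else 0) ∂ν) ∂ν := by
    rw [intervalIntegral.integral_of_le hab]
    apply setIntegral_congr_fun measurableSet_Ioc
    intro x hx
    have : (fun z => if z ≤ x then φ' x * f z else 0) = (Iic x).indicator (fun z => φ' x * f z) := by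
      ext z; simp [indicator]
    simp only [this]
    rw [setIntegral_indicator measurableSet_Iic, integral_const_mul,
      intervalIntegral.integral_of_le hx.1.le, Ioc_inter_Iic, min_eq_right hx.2]
  have e2 : ∫ z, (∫ x, (if z ≤ x then φ' x * f z else 0) ∂ν) ∂ν
      = ∫ z in a..b, (φ b * f z - φ z * f z) := by
    rw [intervalIntegral.integral_of_le hab]
    apply setIntegral_congr_fun measurableSet_Ioc
    intro z hz
    have : (fun x => if z ≤ x then φ' x * f z else 0) = (Ici z).indicator (fun x => φ' x * f z) := by
      ext x; simp [indicator]
    simp only [this]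
    have h4 : Ioc a b ∩ Ici z = Icc z b := by
      ext t; simp only [mem_inter_iff, mem_Ioc, mem_Ici, mem_Icc]
      constructor
      · rintro ⟨⟨_, h⟩, h'⟩; exact ⟨h', h⟩
      · rintro ⟨h, h'⟩; exact ⟨⟨hz.1.trans_le h, h'⟩, h⟩
    rw [setIntegral_indicator measurableSet_Ici, integral_mul_const, h4, integral_Icc_eq_integral_Ioc,
      ← intervalIntegral.integral_of_le hz.2,
      intervalIntegral.integral_eq_sub_of_hasDerivAt (fun x _ => hφ x) (hc.intervalIntegrable _ _)]
    ring
  have hfi : IntervalIntegrable f volume a b := (intervalIntegrable_iff_integrableOn_Ioc_of_le hab).2 hf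
  rw [e1, hsw, e2, intervalIntegral.integral_sub (hfi.const_mul _)
    (hfi.continuousOn_mul hφc.continuousOn), intervalIntegral.integral_const_mul]

theorem Jp_id {s : ℝ} {g d : ℝ → ℂ} {g0 : ℂ} (hd : Integrable d mI)
    (hg : ∀ y, 0 ≤ y → g y = g0 + ∫ x in (0:ℝ)..y, d x) {y : ℝ} (hy : 0 ≤ y) :
    ∫ x in (0:ℝ)..y, ((s * Real.exp (-s * (y - x)) : ℝ) : ℂ) * g x
      = g y - g0 * (Real.exp (-s * y) : ℝ) - ∫ x in (0:ℝ)..y, ((Real.exp (-s * (y - x)) : ℝ) : ℂ) * d x := by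
  have hφ : ∀ x, HasDerivAt (fun x => ((Real.exp (-s * (y - x)) : ℝ) : ℂ))
      ((s * Real.exp (-s * (y - x)) : ℝ) : ℂ) x := by
    intro x
    have h1 : HasDerivAt (fun x : ℝ => -s * (y - x)) (-s * (-1)) x :=
      ((hasDerivAt_id x).const_sub y).const_mul (-s)
    refine (h1.exp.congr_deriv ?_).ofReal_comp
    ring
  have hc : Continuous (fun x => ((s * Real.exp (-s * (y - x)) : ℝ) : ℂ)) := by fun_prop
  have hdi : IntegrableOn d (Ioc 0 y) := IntegrableOn.mono_set hd Ioc_subset_Ioi_self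
  have hp := parts hy hφ hc hdi
  have hdI : IntervalIntegrable d volume 0 y := (intervalIntegrable_iff_integrableOn_Ioc_of_le hy).2 hdi
  have hcont : ContinuousOn (fun x => ∫ z in (0:ℝ)..x, d z) (uIcc 0 y) :=
    intervalIntegral.continuousOn_primitive_interval (by
      rw [uIcc_of_le hy]; exact (integrableOn_Icc_iff_integrableOn_Ioc).2 hdi)
  have e : ∫ x in (0:ℝ)..y, ((s * Real.exp (-s * (y - x)) : ℝ) : ℂ) * g x
      = ∫ x in (0:ℝ)..y, (((s * Real.exp (-s * (y - x)) : ℝ) : ℂ) * g0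
        + ((s * Real.exp (-s * (y - x)) : ℝ) : ℂ) * ∫ z in (0:ℝ)..x, d z) := by
    apply intervalIntegral.integral_congr
    intro x hx
    rw [uIcc_of_le hy] at hx
    simp only
    rw [hg x hx.1]; ring
  rw [e, intervalIntegral.integral_add, hp, intervalIntegral.integral_mul_const,
    intervalIntegral.integral_eq_sub_of_hasDerivAt (fun x _ => hφ x) (hc.intervalIntegrable _ _), hg y hy]
  · simp
    ring
  · exact (hc.intervalIntegrable _ _).mul_const _
  · exact (hc.continuousOn.mul hcont).intervalIntegrable

theorem Jm_id {s : ℝ} (hs : 0 < s) {g d : ℝ → ℂ} {g0 : ℂ} (hd : Integrable d mI) (hgi : Integrable g mI)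
    (hg : ∀ y, 0 ≤ y → g y = g0 + ∫ x in (0:ℝ)..y, d x) {y : ℝ} (hy : 0 ≤ y) :
    ∫ x in Ioi y, ((s * Real.exp (-s * (x - y)) : ℝ) : ℂ) * g x
      = g y + ∫ x in Ioi y, ((Real.exp (-s * (x - y)) : ℝ) : ℂ) * d x := by
  have hdy : IntegrableOn d (Ioi y) := IntegrableOn.mono_set hd (Ioi_subset_Ioi hy)
  have hgy : IntegrableOn g (Ioi y) := IntegrableOn.mono_set hgi (Ioi_subset_Ioi hy)
  have hφ : ∀ x, HasDerivAt (fun x => -((Real.exp (-s * (x - y)) : ℝ) : ℂ))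
      ((s * Real.exp (-s * (x - y)) : ℝ) : ℂ) x := by
    intro x
    have h1 : HasDerivAt (fun x : ℝ => -s * (x - y)) (-s * 1) x :=
      ((hasDerivAt_id x).sub_const y).const_mul (-s)
    refine (h1.exp).ofReal_comp.neg.congr_deriv ?_
    push_cast; ring
  have hc : Continuous (fun x => ((s * Real.exp (-s * (x - y)) : ℝ) : ℂ)) := by fun_prop
  have hce : Continuous (fun x => ((Real.exp (-s * (x - y)) : ℝ) : ℂ)) := by fun_prop
  have hbd : ∀ᵐ x ∂(volume.restrict (Ioi y)), ‖((Real.exp (-s * (x - y)) : ℝ) : ℂ)‖ ≤ 1 := by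
    filter_upwards [ae_restrict_mem measurableSet_Ioi] with x hx
    rw [Complex.norm_real, Real.norm_of_nonneg (Real.exp_pos _).le, Real.exp_le_one_iff]
    have : 0 < x - y := sub_pos.2 hx
    nlinarith
  have hid : IntegrableOn (fun x => ((Real.exp (-s * (x - y)) : ℝ) : ℂ) * d x) (Ioi y) :=
    Integrable.bdd_mul (c := 1) hdy hce.aestronglyMeasurable hbd
  have hig : IntegrableOn (fun x => ((s * Real.exp (-s * (x - y)) : ℝ) : ℂ) * g x) (Ioi y) := by
    have : IntegrableOn (fun x => (s : ℂ) * (((Real.exp (-s * (x - y)) : ℝ) : ℂ) * g x)) (Ioi y) :=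
      Integrable.const_mul (Integrable.bdd_mul (c := 1) hgy hce.aestronglyMeasurable hbd) _
    refine this.congr ?_
    filter_upwards with x
    push_cast; ring
  have key : ∀ N, y ≤ N → ∫ x in y..N, ((s * Real.exp (-s * (x - y)) : ℝ) : ℂ) * g x
      = g y * (1 - ((Real.exp (-s * (N - y)) : ℝ) : ℂ))
        - ((Real.exp (-s * (N - y)) : ℝ) : ℂ) * (∫ x in y..N, d x)
        + ∫ x in y..N, ((Real.exp (-s * (x - y)) : ℝ) : ℂ) * d x := by
    intro N hN
    have hdi : IntegrableOn d (Ioc y N) := hdy.mono_set Ioc_subset_Ioi_self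
    have hp := parts hN hφ hc hdi
    have hcont : ContinuousOn (fun x => ∫ z in y..x, d z) (uIcc y N) :=
      intervalIntegral.continuousOn_primitive_interval (by
        rw [uIcc_of_le hN]; exact (integrableOn_Icc_iff_integrableOn_Ioc).2 hdi)
    have e : ∫ x in y..N, ((s * Real.exp (-s * (x - y)) : ℝ) : ℂ) * g x
        = ∫ x in y..N, (((s * Real.exp (-s * (x - y)) : ℝ) : ℂ) * g y
          + ((s * Real.exp (-s * (x - y)) : ℝ) : ℂ) * ∫ z in y..x, d z) := by
      apply intervalIntegral.integral_congr
      intro x hx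
      rw [uIcc_of_le hN] at hx
      simp only
      have hx0 : 0 ≤ x := hy.trans hx.1
      have i1 : IntervalIntegrable d volume 0 y :=
        (intervalIntegrable_iff_integrableOn_Ioc_of_le hy).2 (IntegrableOn.mono_set hd Ioc_subset_Ioi_self)
      have i2 : IntervalIntegrable d volume y x :=
        (intervalIntegrable_iff_integrableOn_Ioc_of_le hx.1).2 (hdy.mono_set Ioc_subset_Ioi_self)
      rw [hg x hx0, hg y hy, ← intervalIntegral.integral_add_adjacent_intervals i1 i2]
      ring
    rw [e, intervalIntegral.integral_add, hp, intervalIntegral.integral_mul_const,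
      intervalIntegral.integral_eq_sub_of_hasDerivAt (fun x _ => hφ x) (hc.intervalIntegrable _ _)]
    · simp
      ring
    · exact (hc.intervalIntegrable _ _).mul_const _
    · exact (hc.continuousOn.mul hcont).intervalIntegrable
  have l1 := intervalIntegral_tendsto_integral_Ioi y hig tendsto_id
  have l2 := intervalIntegral_tendsto_integral_Ioi y hid tendsto_id
  have l3 := intervalIntegral_tendsto_integral_Ioi y hdy tendsto_id
  have l4 : Tendsto (fun N : ℝ => ((Real.exp (-s * (N - y)) : ℝ) : ℂ)) atTop (𝓝 0) := by
    have : Tendsto (fun N : ℝ => Real.exp (-s * (N - y))) atTop (𝓝 0) := by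
      refine Real.tendsto_exp_atBot.comp ?_
      exact (tendsto_atTop_add_const_right _ (-y) tendsto_id).const_mul_atTop_of_neg (by linarith)
    have h2 := (Complex.continuous_ofReal.tendsto 0).comp this
    rw [Complex.ofReal_zero] at h2
    exact h2
  have l5 := ((tendsto_const_nhds (x := g y)).mul ((tendsto_const_nhds (x := (1:ℂ))).sub l4)).sub
    (l4.mul l3) |>.add l2
  have l6 := l1.congr' (f₂ := _) (by
    filter_upwards [eventually_ge_atTop y] with N hN
    exact key N hN)
  have := tendsto_nhds_unique l6 l5
  rw [this]; ring

theorem EI.norm_toL1 {g : ℝ → ℂ} (hg : Integrable g mI) : ‖hg.toL1 g‖ = ∫ y, ‖g y‖ ∂mI := by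
  rw [L1.norm_of_fun_eq_integral_norm]

theorem exp_L1 {s : ℝ} (hs : 0 < s) : Integrable (fun y => ((Real.exp (-s * y) : ℝ) : ℂ)) mI ∧
    ∫ y, ‖((Real.exp (-s * y) : ℝ) : ℂ)‖ ∂mI = 1 / s := by
  have h := exp_int hs 0
  simp only [sub_zero] at h
  have h1 : Integrable (fun y => Real.exp (-s * y)) mI := by
    have := h.1.const_mul (1 / s)
    refine Integrable.congr this ?_
    filter_upwards with y
    field_simp
  refine ⟨h1.ofReal, ?_⟩
  have h2 := h.2
  rw [integral_const_mul] at h2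
  have : ∀ y, ‖((Real.exp (-s * y) : ℝ) : ℂ)‖ = Real.exp (-s * y) := fun y => by
    rw [Complex.norm_real, Real.norm_of_nonneg (Real.exp_pos _).le]
  simp only [this]
  rw [eq_div_iff hs.ne', mul_comm]
  exact h2

theorem JJ_est {s : ℝ} (hs : 0 < s) {Jp Jm : EI →L[ℂ] EI} (hp : ‖Jp‖ ≤ 1) (hm : ‖Jm‖ ≤ 1)
    (hJp : ∀ v : EI, Jp v =ᵐ[mI] fun y => ∫ x in (0:ℝ)..y, ((s * Real.exp (-s * (y - x)) : ℝ) : ℂ) * v x)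
    (hJm : ∀ v : EI, Jm v =ᵐ[mI] fun y => ∫ x in Ioi y, ((s * Real.exp (-s * (x - y)) : ℝ) : ℂ) * v x)
    {g d : ℝ → ℂ} {g0 : ℂ} (hd : Integrable d mI) (hgi : Integrable g mI)
    (hg : ∀ y, 0 ≤ y → g y = g0 + ∫ x in (0:ℝ)..y, d x) :
    ‖Jp (Jm (hgi.toL1 g)) - hgi.toL1 g‖ ≤ (2 * (∫ y, ‖d y‖ ∂mI) + ‖g0‖) / s := by
  set G := hgi.toL1 g
  set D := hd.toL1 d
  set X := (exp_L1 hs).1.toL1 _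
  have hG : G =ᵐ[mI] g := hgi.coeFn_toL1
  have hD : D =ᵐ[mI] d := hd.coeFn_toL1
  have hX : X =ᵐ[mI] _ := (exp_L1 hs).1.coeFn_toL1
  have sub0 : ∀ {u w : ℝ → ℂ} {y : ℝ}, 0 ≤ y → u =ᵐ[mI] w → u =ᵐ[volume.restrict (Ioc 0 y)] w :=
    fun hy h => ae_restrict_of_ae_restrict_of_subset Ioc_subset_Ioi_self h
  have sub1 : ∀ {u w : ℝ → ℂ} {y : ℝ}, 0 ≤ y → u =ᵐ[mI] w → u =ᵐ[volume.restrict (Ioi y)] w :=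
    fun hy h => ae_restrict_of_ae_restrict_of_subset (Ioi_subset_Ioi hy) h
  have e1 : Jm G = G + (1 / s : ℂ) • Jm D := by
    apply Lp.ext
    filter_upwards [hJm G, hJm D, hG, Lp.coeFn_add G ((1 / s : ℂ) • Jm D),
      Lp.coeFn_smul (1 / s : ℂ) (Jm D), ae_restrict_mem measurableSet_Ioi] with y h1 h2 h3 h4 h5 hy
    have hy' : 0 ≤ y := le_of_lt hy
    rw [h1, h4, Pi.add_apply, h5, Pi.smul_apply, h2, h3, smul_eq_mul]
    have a1 : ∫ x in Ioi y, ((s * Real.exp (-s * (x - y)) : ℝ) : ℂ) * G x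
        = ∫ x in Ioi y, ((s * Real.exp (-s * (x - y)) : ℝ) : ℂ) * g x := by
      apply integral_congr_ae
      filter_upwards [sub1 hy' hG] with x hx
      rw [hx]
    have a2 : ∫ x in Ioi y, ((s * Real.exp (-s * (x - y)) : ℝ) : ℂ) * D x
        = s * ∫ x in Ioi y, ((Real.exp (-s * (x - y)) : ℝ) : ℂ) * d x := by
      rw [← integral_const_mul]
      apply integral_congr_ae
      filter_upwards [sub1 hy' hD] with x hx
      rw [hx]; push_cast; ring
    rw [a1, a2, Jm_id hs hd hgi hg hy']
    have : (s : ℂ) ≠ 0 := by exact_mod_cast hs.ne'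
    field_simp
  have e2 : Jp G = G - (1 / s : ℂ) • Jp D - g0 • X := by
    apply Lp.ext
    filter_upwards [hJp G, hJp D, hG, hX, Lp.coeFn_sub G ((1 / s : ℂ) • Jp D),
      Lp.coeFn_smul (1 / s : ℂ) (Jp D), Lp.coeFn_smul g0 X,
      Lp.coeFn_sub (G - (1 / s : ℂ) • Jp D) (g0 • X),
      ae_restrict_mem measurableSet_Ioi] with y h1 h2 h3 h4 h5 h6 h7 h8 hy
    have hy' : 0 ≤ y := le_of_lt hy
    rw [h1, h8, Pi.sub_apply, h5, Pi.sub_apply, h6, h7, Pi.smul_apply, Pi.smul_apply, h2, h3, h4,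
      smul_eq_mul, smul_eq_mul]
    have a1 : ∫ x in (0:ℝ)..y, ((s * Real.exp (-s * (y - x)) : ℝ) : ℂ) * G x
        = ∫ x in (0:ℝ)..y, ((s * Real.exp (-s * (y - x)) : ℝ) : ℂ) * g x := by
      rw [intervalIntegral.integral_of_le hy', intervalIntegral.integral_of_le hy']
      apply integral_congr_ae
      filter_upwards [sub0 hy' hG] with x hx
      rw [hx]
    have a2 : ∫ x in (0:ℝ)..y, ((s * Real.exp (-s * (y - x)) : ℝ) : ℂ) * D x
        = s * ∫ x in (0:ℝ)..y, ((Real.exp (-s * (y - x)) : ℝ) : ℂ) * d x := by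
      rw [← intervalIntegral.integral_const_mul]
      rw [intervalIntegral.integral_of_le hy', intervalIntegral.integral_of_le hy']
      apply integral_congr_ae
      filter_upwards [sub0 hy' hD] with x hx
      rw [hx]; push_cast; ring
    rw [a1, a2, Jp_id hd hg hy']
    have : (s : ℂ) ≠ 0 := by exact_mod_cast hs.ne'
    field_simp
    ring
  have e3 : Jp (Jm G) - G = (1 / s : ℂ) • Jp (Jm D) - (1 / s : ℂ) • Jp D - g0 • X := by
    rw [e1, map_add, map_smul, e2]; abel
  have nD : ‖D‖ = ∫ y, ‖d y‖ ∂mI := EI.norm_toL1 hd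
  have nX : ‖X‖ = 1 / s := (EI.norm_toL1 _).trans (exp_L1 hs).2
  have n1 : ∀ w : EI, ‖Jp w‖ ≤ ‖w‖ := fun w => by simpa using Jp.le_of_opNorm_le hp w
  have n2 : ∀ w : EI, ‖Jm w‖ ≤ ‖w‖ := fun w => by simpa using Jm.le_of_opNorm_le hm w
  have ns : ‖(1 / s : ℂ)‖ = 1 / s := by
    rw [norm_div, Complex.norm_real, Real.norm_of_nonneg hs.le]; simp
  rw [e3]
  calc _ ≤ ‖(1 / s : ℂ) • Jp (Jm D)‖ + ‖(1 / s : ℂ) • Jp D‖ + ‖g0 • X‖ :=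
        (norm_sub_le _ _).trans (by gcongr; exact norm_sub_le _ _)
    _ ≤ 1 / s * ‖D‖ + 1 / s * ‖D‖ + ‖g0‖ * (1 / s) := by
        rw [norm_smul, norm_smul, norm_smul, ns, nX]
        gcongr
        · exact (n1 _).trans (n2 _)
        · exact n1 _
    _ = _ := by rw [nD]; ring
end

noncomputable section
open Topology

theorem unit_lemma {𝔸 : Type*} [NormedRing 𝔸] [NormedAlgebra ℂ 𝔸] [CompleteSpace 𝔸]
    (h1 : ‖(1:𝔸)‖ ≤ 1) {R M K S P : 𝔸} {A : ℂ} {ρ p ε : ℝ} (hAS : A • S = 1 + M * S)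
    (hP1 : (1 - S * K) * P = 1) (hP2 : P * (1 - S * K) = 1) (hρ : ‖R * M‖ ≤ ρ) (hρ1 : ρ < 1)
    (hp : ‖P‖ ≤ p) (hε : ‖(A • R - 1) * (S * K)‖ ≤ ε) (hsmall : p * (1 - ρ)⁻¹ * ε ≤ 1 / 2) :
    ∃ u : 𝔸ˣ, (u : 𝔸) = 1 - R * (M + K) ∧ ‖((u⁻¹ : 𝔸ˣ) : 𝔸)‖ ≤ 2 * p * (1 - ρ)⁻¹ := by
  have hinv : ∀ (t : 𝔸) (c : ℝ) (_ : ‖t‖ ≤ c) (_ : c < 1),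
      ∃ u : 𝔸ˣ, (u : 𝔸) = 1 - t ∧ ‖((u⁻¹ : 𝔸ˣ) : 𝔸)‖ ≤ (1 - c)⁻¹ := by
    intro t c htc hc
    have ht : ‖t‖ < 1 := htc.trans_lt hc
    refine ⟨Units.oneSub t ht, rfl, ?_⟩
    have h2 : ‖∑' n : ℕ, t ^ n‖ ≤ ‖(1:𝔸)‖ - 1 + (1 - ‖t‖)⁻¹ :=
      tsum_geometric_le_of_norm_lt_one t ht
    have h3 : (1 - ‖t‖)⁻¹ ≤ (1 - c)⁻¹ := inv_anti₀ (by linarith) (by linarith)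
    calc _ = ‖∑' n : ℕ, t ^ n‖ := rfl
      _ ≤ _ := by linarith
  obtain ⟨u1, hu1, hb1⟩ := hinv _ _ hρ hρ1
  have hpos : 0 ≤ (1 - ρ)⁻¹ := inv_nonneg.2 (by linarith)
  have hp0 : 0 ≤ p := (norm_nonneg _).trans hp
  set B := (A • R - 1) * (S * K) with hB
  set X : 𝔸 := ((u1⁻¹ : 𝔸ˣ) : 𝔸) with hX
  have hPXB : ‖P * X * B‖ ≤ 1 / 2 := by
    refine le_trans ?_ hsmall
    refine (norm_mul_le _ _).trans ?_
    refine mul_le_mul ((norm_mul_le _ _).trans ?_) hε (norm_nonneg _) (by positivity)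
    exact mul_le_mul hp hb1 (norm_nonneg _) hp0
  obtain ⟨u3, hu3, hb3⟩ := hinv _ _ hPXB (by norm_num)
  let uT : 𝔸ˣ := ⟨1 - S * K, P, hP1, hP2⟩
  refine ⟨u1 * uT * u3, ?_, ?_⟩
  · have hXX : (1 - R * M) * X = 1 := by rw [← hu1, hX]; exact u1.mul_inv
    have e0 : ((u1 * uT * u3 : 𝔸ˣ) : 𝔸) = (1 - R * M) * (1 - S * K) * (1 - P * X * B) := by
      rw [Units.val_mul, Units.val_mul, hu1, hu3]
    have e1 : (1 - R * M) * (1 - S * K) * (1 - P * X * B)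
        = (1 - R * M) * (1 - S * K) - ((1 - R * M) * (((1 - S * K) * P) * X)) * B := by
      noncomm_ring
    have e2 : R * (M * (S * K)) = A • (R * (S * K)) - R * K := by
      have : M * S = A • S - 1 := by rw [hAS]; abel
      rw [← mul_assoc M, this, sub_mul, one_mul, mul_sub, smul_mul_assoc, mul_smul_comm]
    rw [e0, e1, hP1, one_mul, hXX, one_mul, hB]
    have e3 : (1 - R * M) * (1 - S * K) = 1 - R * M - S * K + R * (M * (S * K)) := by noncomm_ring
    rw [e3, e2, sub_mul, smul_mul_assoc, one_mul, mul_add]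
    abel
  · rw [mul_inv_rev, mul_inv_rev, Units.val_mul, Units.val_mul]
    have hP : ((uT⁻¹ : 𝔸ˣ) : 𝔸) = P := rfl
    rw [hP]
    calc _ ≤ ‖((u3⁻¹ : 𝔸ˣ) : 𝔸)‖ * ‖P * X‖ := norm_mul_le _ _
      _ ≤ (1 - 1 / 2)⁻¹ * (p * (1 - ρ)⁻¹) := by
        refine mul_le_mul hb3 ((norm_mul_le _ _).trans ?_) (norm_nonneg _) (by norm_num)
        exact mul_le_mul hp hb1 (norm_nonneg _) hp0
      _ = _ := by norm_num; ring

theorem prim_cont {f : ℝ → ℂ} (hf : Integrable f mI) :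
    ContinuousOn (fun y => ∫ x in (0:ℝ)..y, f x) (Ici 0) := by
  have h1 : Integrable ((Ioi 0).indicator f) := (integrable_indicator_iff measurableSet_Ioi).2 hf
  have h2 : Continuous (fun y => ∫ x in (0:ℝ)..y, (Ioi 0).indicator f x) :=
    intervalIntegral.continuous_primitive (fun a b => h1.intervalIntegrable) 0
  refine h2.continuousOn.congr ?_
  intro y hy
  simp only
  rw [intervalIntegral.integral_of_le hy, intervalIntegral.integral_of_le hy]
  apply setIntegral_congr_fun measurableSet_Ioc
  intro x hx
  simp only [indicator, mem_Ioi, hx.1, if_true]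

theorem prim_meas {f : ℝ → ℂ} (hf : Integrable f mI) :
    AEStronglyMeasurable (fun y => ∫ x in (0:ℝ)..y, f x) mI :=
  ((prim_cont hf).mono Ioi_subset_Ici_self).aestronglyMeasurable measurableSet_Ioi

theorem prim_bd {f : ℝ → ℂ} (hf : Integrable f mI) {y : ℝ} (hy : 0 ≤ y) :
    ‖∫ x in (0:ℝ)..y, f x‖ ≤ ∫ x, ‖f x‖ ∂mI := by
  rw [intervalIntegral.integral_of_le hy]
  refine (norm_integral_le_integral_norm _).trans ?_
  exact setIntegral_mono_set hf.norm (Eventually.of_forall fun _ => norm_nonneg _)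
    (Ioc_subset_Ioi_self.eventuallyLE)

theorem prim_congr {f g : ℝ → ℂ} (h : f =ᵐ[mI] g) {y : ℝ} (hy : 0 ≤ y) :
    ∫ x in (0:ℝ)..y, f x = ∫ x in (0:ℝ)..y, g x := by
  rw [intervalIntegral.integral_of_le hy, intervalIntegral.integral_of_le hy]
  exact integral_congr_ae (ae_restrict_of_ae_restrict_of_subset Ioc_subset_Ioi_self h)

theorem prim_ii {f : ℝ → ℂ} (hf : Integrable f mI) {y : ℝ} (hy : 0 ≤ y) :
    IntervalIntegrable f volume 0 y :=
  (intervalIntegrable_iff_integrableOn_Ioc_of_le hy).2 (IntegrableOn.mono_set hf Ioc_subset_Ioi_self)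

namespace AdmissibleShearFlow

theorem bd1 {U : ℝ → ℝ} (hU : AdmissibleShearFlow U) : ∃ C : ℝ, 0 ≤ C ∧ ∀ y, 0 ≤ y → deriv U y ≤ C := by
  obtain ⟨C, hC⟩ := hU.derivs_bounded 1 le_rfl (by norm_num)
  refine ⟨C, (abs_nonneg _).trans (hC 0 le_rfl), fun y hy => ?_⟩
  have := hC y hy
  rw [iteratedDeriv_one] at this
  exact (le_abs_self _).trans this

theorem nrm1 {U : ℝ → ℝ} (hU : AdmissibleShearFlow U) {y : ℝ} (hy : 0 ≤ y) :
    ‖((deriv U y : ℝ) : ℂ)‖ = deriv U y := by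
  rw [Complex.norm_real, Real.norm_of_nonneg (hU.deriv_pos y hy).le]

theorem int_nrm1 {U : ℝ → ℝ} (hU : AdmissibleShearFlow U) : ∫ y, ‖((deriv U y : ℝ) : ℂ)‖ ∂mI = 1 := by
  have := hU.integral_U1_Ioi le_rfl
  rw [hU.zero_val, sub_zero] at this
  rw [← this]
  apply setIntegral_congr_fun measurableSet_Ioi
  intro y hy
  exact hU.nrm1 (le_of_lt hy)

theorem bI {U : ℝ → ℝ} (hU : AdmissibleShearFlow U) {μ : ℂ} (hμ : 0 < μ.im) {f : ℝ → ℂ}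
    (hf : Integrable f mI) : Integrable (fun y => (μ - (U y : ℂ))⁻¹ * f y) mI :=
  hf.bdd_mul (c := 1 / μ.im) (hU.cont_inv hμ).aestronglyMeasurable
    (Eventually.of_forall fun _ => inv_bd hμ _)

theorem uI {U : ℝ → ℝ} (hU : AdmissibleShearFlow U) {f : ℝ → ℂ}
    (hf : Integrable f mI) : Integrable (fun y => (U y : ℂ) * f y) mI := by
  have := hU.cont
  refine hf.bdd_mul (c := 1) (by fun_prop) ?_
  filter_upwards [ae_restrict_mem measurableSet_Ioi] with y hy
  rw [Complex.norm_real, Real.norm_of_nonneg (hU.nonneg (le_of_lt hy))]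
  exact (hU.lt_one (le_of_lt hy)).le

/-- `p` times a primitive of an integrable function is integrable when `p` is. -/
theorem _root_.mul_prim {p f : ℝ → ℂ} (hp : Integrable p mI) (hf : Integrable f mI) :
    Integrable (fun y => p y * ∫ x in (0:ℝ)..y, f x) mI := by
  refine hp.mul_bdd (c := ∫ x, ‖f x‖ ∂mI) (prim_meas hf) ?_
  filter_upwards [ae_restrict_mem measurableSet_Ioi] with y hy
  exact prim_bd hf (le_of_lt hy)

/-- First inversion identity. -/
theorem inv1 {U : ℝ → ℝ} (hU : AdmissibleShearFlow U) {μ : ℂ} (hμ : 0 < μ.im) {f : ℝ → ℂ}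
    (hf : Integrable f mI) {y : ℝ} (hy : 0 ≤ y) :
    ∫ x in (0:ℝ)..y, (f x - ((deriv U x : ℝ) : ℂ) * ∫ z in (0:ℝ)..x, (μ - (U z : ℂ))⁻¹ * f z)
      = (μ - (U y : ℂ)) * ∫ z in (0:ℝ)..y, (μ - (U z : ℂ))⁻¹ * f z := by
  have hb := hU.bI hμ hf
  have hp := parts hy hU.hasDerivC (by have := hU.cont1; fun_prop)
    (IntegrableOn.mono_set hb Ioc_subset_Ioi_self)
  have e2 : ∫ x in (0:ℝ)..y, f x = ∫ x in (0:ℝ)..y, (μ * ((μ - (U x : ℂ))⁻¹ * f x)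
      - (U x : ℂ) * ((μ - (U x : ℂ))⁻¹ * f x)) := by
    congr 1; ext x
    have := sub_ne hμ (U x)
    field_simp
  rw [intervalIntegral.integral_sub (prim_ii hf hy)
    (prim_ii (mul_prim (p := fun x => ((deriv U x : ℝ) : ℂ)) hU.int_U1.ofReal hb) hy), hp, e2,
    intervalIntegral.integral_sub ((prim_ii hb hy).const_mul μ) (prim_ii (hU.uI hb) hy),
    intervalIntegral.integral_const_mul]
  ring

/-- Second inversion identity. -/
theorem inv2 {U : ℝ → ℝ} (hU : AdmissibleShearFlow U) {μ : ℂ} (hμ : 0 < μ.im) {v : ℝ → ℂ}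
    (hv : Integrable v mI) {y : ℝ} (hy : 0 ≤ y) :
    ∫ x in (0:ℝ)..y, (μ - (U x : ℂ))⁻¹ * (v x +
        (μ - (U x : ℂ))⁻¹ * ((deriv U x : ℝ) : ℂ) * ∫ z in (0:ℝ)..x, v z)
      = (μ - (U y : ℂ))⁻¹ * ∫ z in (0:ℝ)..y, v z := by
  have hb := hU.bI hμ hv
  have hc := hU.cont_inv hμ
  have hc1 := hU.cont1
  have hp := parts hy (hU.hasDeriv_inv hμ) (by fun_prop)
    (IntegrableOn.mono_set hv Ioc_subset_Ioi_self)
  have hq : Integrable (fun y => ((deriv U y : ℝ) : ℂ) * (μ - (U y : ℂ))⁻¹ ^ 2) mI :=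
    intMul hU.int_U1 (by fun_prop) (C := (1 / μ.im) ^ 2) (fun y _ => by
      rw [norm_pow]; gcongr; exact inv_bd hμ _)
  have e : ∫ x in (0:ℝ)..y, (μ - (U x : ℂ))⁻¹ * (v x +
        (μ - (U x : ℂ))⁻¹ * ((deriv U x : ℝ) : ℂ) * ∫ z in (0:ℝ)..x, v z)
      = ∫ x in (0:ℝ)..y, ((μ - (U x : ℂ))⁻¹ * v x +
        (((deriv U x : ℝ) : ℂ) * (μ - (U x : ℂ))⁻¹ ^ 2) * ∫ z in (0:ℝ)..x, v z) := by
    congr 1; ext x; ring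
  rw [e, intervalIntegral.integral_add (prim_ii hb hy) (prim_ii (mul_prim hq hv) hy), hp]
  ring

end AdmissibleShearFlow
end

noncomputable section
open Topology

theorem EI.norm_one_le : ‖(1 : EI →L[ℂ] EI)‖ ≤ 1 := ContinuousLinearMap.norm_id_le

namespace AdmissibleShearFlow

theorem op_rel {U : ℝ → ℝ} (hU : AdmissibleShearFlow U) {μ : ℂ} (hμ : 0 < μ.im) {A : ℂ}
    {M K : EI →L[ℂ] EI}
    (hK : ∀ v : EI, K v =ᵐ[mI] fun y => (Complex.I * ((deriv U y : ℝ) : ℂ)) * ∫ x in (0:ℝ)..y, v x)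
    (hM : ∀ v : EI, M v =ᵐ[mI] fun y => (A + Complex.I * (μ - (U y : ℂ))) * v y) :
    ∃ S P : EI →L[ℂ] EI, A • S = 1 + M * S ∧ (1 - S * K) * P = 1 ∧ P * (1 - S * K) = 1 ∧
      ‖P‖ ≤ 1 + 1 / μ.im ∧
      ∀ v : EI, (S * K) v =ᵐ[mI] fun y => -((μ - (U y : ℂ))⁻¹ * ((deriv U y : ℝ) : ℂ)
        * ∫ x in (0:ℝ)..y, v x) := by
  have hc := hU.cont_inv hμ
  have hc1 := hU.cont1
  obtain ⟨S, -, hS⟩ := exists_mulOp (fun y => Complex.I * (μ - (U y : ℂ))⁻¹) (by fun_prop)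
    (C := 1 / μ.im) (by positivity) (fun y _ => by
      rw [norm_mul, Complex.norm_I, one_mul]; exact inv_bd hμ _)
  obtain ⟨P', hP'n, hP'⟩ := exists_volOp (fun y => ((deriv U y : ℝ) : ℂ)) (fun y => (μ - (U y : ℂ))⁻¹)
    (by fun_prop) hU.int_U1.ofReal hc (Q := 1 / μ.im) (by positivity) (fun y _ => inv_bd hμ _)
  have hSK : ∀ v : EI, (S * K) v =ᵐ[mI] fun y => -((μ - (U y : ℂ))⁻¹ * ((deriv U y : ℝ) : ℂ)
        * ∫ x in (0:ℝ)..y, v x) := by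
    intro v
    filter_upwards [hS (K v), hK v] with y h1 h2
    rw [mul_apply_eq_comp, h1, h2]
    linear_combination ((μ - (U y : ℂ))⁻¹ * ((deriv U y : ℝ) : ℂ) * ∫ x in (0:ℝ)..y, v x) * Complex.I_mul_I
  have hP : ∀ v : EI, (1 - P') v =ᵐ[mI] fun y => v y - ((deriv U y : ℝ) : ℂ) *
      ∫ x in (0:ℝ)..y, (μ - (U x : ℂ))⁻¹ * v x := by
    intro v
    filter_upwards [Lp.coeFn_sub v (P' v), hP' v] with y h1 h2
    rw [_root_.sub_apply, one_apply_eq_self, h1, Pi.sub_apply, h2]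
  have hT : ∀ v : EI, (1 - S * K) v =ᵐ[mI] fun y => v y + (μ - (U y : ℂ))⁻¹ * ((deriv U y : ℝ) : ℂ)
        * ∫ x in (0:ℝ)..y, v x := by
    intro v
    filter_upwards [Lp.coeFn_sub v ((S * K) v), hSK v] with y h1 h2
    rw [_root_.sub_apply, one_apply_eq_self, h1, Pi.sub_apply, h2]
    ring
  refine ⟨S, 1 - P', ?_, ?_, ?_, ?_, hSK⟩
  · ext1 v
    apply Lp.ext
    filter_upwards [Lp.coeFn_smul A (S v), hS v, hM (S v), Lp.coeFn_add v (M (S v))] with y h1 h2 h3 h4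
    rw [_root_.smul_apply, h1, Pi.smul_apply, h2, _root_.add_apply,
      one_apply_eq_self, mul_apply_eq_comp, h4, Pi.add_apply, h3, h2, smul_eq_mul]
    have := sub_ne hμ (U y)
    field_simp
    linear_combination -(μ - (U y : ℂ)) * v y * Complex.I_sq
  · ext1 f
    apply Lp.ext
    filter_upwards [hT ((1 - P') f), hP f, ae_restrict_mem measurableSet_Ioi] with y h1 h2 hy
    rw [mul_apply_eq_comp, h1, h2, prim_congr (hP f) (le_of_lt hy),
      hU.inv1 hμ f.int (le_of_lt hy), one_apply_eq_self]
    have := sub_ne hμ (U y)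
    field_simp
    ring
  · ext1 v
    apply Lp.ext
    have hcg : (fun x => (μ - (U x : ℂ))⁻¹ * (1 - S * K) v x) =ᵐ[mI] fun x => (μ - (U x : ℂ))⁻¹ * (v x +
        (μ - (U x : ℂ))⁻¹ * ((deriv U x : ℝ) : ℂ) * ∫ z in (0:ℝ)..x, v z) := by
      filter_upwards [hT v] with x hx
      rw [hx]
    filter_upwards [hP ((1 - S * K) v), hT v, ae_restrict_mem measurableSet_Ioi] with y h1 h2 hy
    rw [mul_apply_eq_comp, h1, h2, prim_congr hcg (le_of_lt hy),
      hU.inv2 hμ v.int (le_of_lt hy), one_apply_eq_self]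
    ring
  · rw [hU.int_nrm1, one_mul] at hP'n
    exact (norm_sub_le _ _).trans (add_le_add EI.norm_one_le hP'n)

theorem est_B {U : ℝ → ℝ} (hU : AdmissibleShearFlow U) {η : ℝ} (hη : 0 < η) :
    ∃ C : ℝ, 0 ≤ C ∧ ∀ μ : ℂ, η ≤ μ.im → ∀ s : ℝ, 0 < s → ∀ Jp Jm W : EI →L[ℂ] EI,
    ‖Jp‖ ≤ 1 → ‖Jm‖ ≤ 1 →
    (∀ v : EI, Jp v =ᵐ[mI] fun y => ∫ x in (0:ℝ)..y, ((s * Real.exp (-s * (y - x)) : ℝ) : ℂ) * v x) →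
    (∀ v : EI, Jm v =ᵐ[mI] fun y => ∫ x in Ioi y, ((s * Real.exp (-s * (x - y)) : ℝ) : ℂ) * v x) →
    (∀ v : EI, W v =ᵐ[mI] fun y => -((μ - (U y : ℂ))⁻¹ * ((deriv U y : ℝ) : ℂ)
        * ∫ x in (0:ℝ)..y, v x)) →
    ‖(Jp * Jm - 1) * W‖ ≤ C / s := by
  obtain ⟨C1, hC1, hC1b⟩ := hU.bd1
  set I2 := ∫ y, |iteratedDeriv 2 U y| ∂mI
  have hI2 : 0 ≤ I2 := integral_nonneg fun _ => abs_nonneg _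
  have hint1 : ∫ y, deriv U y ∂mI = 1 := by
    have := hU.integral_U1_Ioi le_rfl
    rw [hU.zero_val, sub_zero] at this
    exact this
  refine ⟨2 * (C1 / η ^ 2 + 1 / η * I2 + C1 / η), by positivity, ?_⟩
  intro μ hημ s hs Jp Jm W hp hm hJp hJm hW
  have hμ : 0 < μ.im := hη.trans_le hημ
  have hbb : ∀ y, ‖(μ - (U y : ℂ))⁻¹‖ ≤ 1 / η := fun y =>
    (inv_bd hμ _).trans (one_div_le_one_div_of_le hη hημ)
  have hc := hU.cont_inv hμ
  have hc1 := hU.cont1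
  have hc2 := hU.cont2
  refine ContinuousLinearMap.opNorm_le_bound _ (by positivity) fun v => ?_
  set b : ℝ → ℂ := fun y => (μ - (U y : ℂ))⁻¹ with hb
  set φ : ℝ → ℂ := fun y => b y * ((deriv U y : ℝ) : ℂ) with hφ
  set φ' : ℝ → ℂ := fun y => (((deriv U y : ℝ) : ℂ) * b y ^ 2) * ((deriv U y : ℝ) : ℂ)
    + b y * ((iteratedDeriv 2 U y : ℝ) : ℂ) with hφ'
  have hdφ : ∀ y, HasDerivAt φ (φ' y) y := fun y => (hU.hasDeriv_inv hμ y).mul (hU.hasDerivC2 y)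
  have hφ'c : Continuous φ' := by simp only [hφ']; fun_prop
  have hφc : Continuous φ := by simp only [hφ]; fun_prop
  have hφb : ∀ y, 0 ≤ y → ‖φ y‖ ≤ C1 / η := by
    intro y hy
    rw [hφ]; simp only [norm_mul]
    rw [hU.nrm1 hy]
    calc _ ≤ 1 / η * C1 := mul_le_mul (hbb y) (hC1b y hy) (hU.deriv_pos y hy).le (by positivity)
      _ = _ := by ring
  have hφ'b : ∀ y, 0 ≤ y → ‖φ' y‖ ≤ C1 / η ^ 2 * deriv U y + 1 / η * |iteratedDeriv 2 U y| := by
    intro y hy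
    refine (norm_add_le _ _).trans ?_
    simp only [norm_mul, norm_pow]
    rw [hU.nrm1 hy, Complex.norm_real, Real.norm_eq_abs]
    have h0 := (hU.deriv_pos y hy).le
    have h3 : ‖b y‖ ≤ 1 / η := hbb y
    have h4 := hC1b y hy
    have : deriv U y * ‖b y‖ ^ 2 * deriv U y ≤ C1 * (1 / η) ^ 2 * deriv U y := by gcongr
    have h5 : ‖b y‖ * |iteratedDeriv 2 U y| ≤ 1 / η * |iteratedDeriv 2 U y| := by gcongr
    have h6 : C1 * (1 / η) ^ 2 * deriv U y = C1 / η ^ 2 * deriv U y := by field_simp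
    linarith
  have hU2i : Integrable (fun y => |iteratedDeriv 2 U y|) mI := Integrable.abs hU.int_U2
  have hgi' : Integrable (fun y => C1 / η ^ 2 * deriv U y + 1 / η * |iteratedDeriv 2 U y|) mI :=
    (Integrable.const_mul hU.int_U1 _).add (hU2i.const_mul _)
  have hφ'i : Integrable φ' mI := by
    refine hgi'.mono' hφ'c.aestronglyMeasurable ?_
    filter_upwards [ae_restrict_mem measurableSet_Ioi] with y hy
    exact hφ'b y (le_of_lt hy)
  set V : ℝ → ℂ := fun y => ∫ x in (0:ℝ)..y, v x with hV
  set d : ℝ → ℂ := fun y => -(φ' y * V y + φ y * v y) with hd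
  have hφv : Integrable (fun y => φ y * v y) mI := by
    refine v.int.bdd_mul (c := C1 / η) hφc.aestronglyMeasurable ?_
    filter_upwards [ae_restrict_mem measurableSet_Ioi] with y hy
    exact hφb y (le_of_lt hy)
  have hdi : Integrable d mI := ((mul_prim hφ'i v.int).add hφv).neg
  have hgi : Integrable (fun y => -(φ y * V y)) mI := by
    refine (mul_prim ?_ v.int).neg
    have := intMul hU.int_U1 hc (fun y _ => hbb y)
    refine this.congr ?_
    filter_upwards with y
    simp only [hφ, hb]; ring
  have hgd : ∀ y, 0 ≤ y → -(φ y * V y) = 0 + ∫ x in (0:ℝ)..y, d x := by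
    intro y hy
    have hp := parts hy hdφ hφ'c (IntegrableOn.mono_set v.int Ioc_subset_Ioi_self)
    simp only [hd]
    rw [intervalIntegral.integral_neg, intervalIntegral.integral_add (prim_ii (mul_prim hφ'i v.int) hy)
      (prim_ii hφv hy), hp]
    simp only [hV]; ring
  have hWv : W v = hgi.toL1 _ := by
    apply Lp.ext
    filter_upwards [hW v, hgi.coeFn_toL1] with y h1 h2
    rw [h1, h2]
  have hJ := JJ_est hs hp hm hJp hJm hdi hgi hgd
  rw [← hWv] at hJ
  have hnd : ∫ y, ‖d y‖ ∂mI ≤ (C1 / η ^ 2 + 1 / η * I2 + C1 / η) * ‖v‖ := by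
    calc ∫ y, ‖d y‖ ∂mI ≤ ∫ y, ((C1 / η ^ 2 * deriv U y + 1 / η * |iteratedDeriv 2 U y|) * ‖v‖
          + C1 / η * ‖v y‖) ∂mI := by
          apply integral_mono_ae hdi.norm ((hgi'.mul_const _).add (v.int.norm.const_mul _))
          filter_upwards [ae_restrict_mem measurableSet_Ioi] with y hy
          have hy' : 0 ≤ y := le_of_lt hy
          simp only [hd, norm_neg]
          refine (norm_add_le _ _).trans ?_
          rw [norm_mul, norm_mul]
          have hVb : ‖V y‖ ≤ ‖v‖ := by rw [EI.norm_eq]; exact prim_bd v.int hy'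
          refine add_le_add ?_ ?_
          · exact mul_le_mul (hφ'b y hy') hVb (norm_nonneg _) ((norm_nonneg _).trans (hφ'b y hy'))
          · exact mul_le_mul_of_nonneg_right (hφb y hy') (norm_nonneg _)
      _ = _ := by
          rw [integral_add (hgi'.mul_const _) (v.int.norm.const_mul _), integral_mul_const,
            integral_add (Integrable.const_mul hU.int_U1 _) (hU2i.const_mul _), integral_const_mul,
            integral_const_mul, integral_const_mul, hint1, ← EI.norm_eq]
          ring
  have e : ((Jp * Jm - 1) * W) v = Jp (Jm (W v)) - W v := rfl
  rw [e]
  refine hJ.trans ?_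
  rw [norm_zero, add_zero, div_mul_eq_mul_div]
  exact div_le_div_of_nonneg_right (by linarith) hs.le

end AdmissibleShearFlow
end

noncomputable section
open Topology

namespace AdmissibleShearFlow

/-- The source as an element of `L¹`. -/
def srcL {U : ℝ → ℝ} (hU : AdmissibleShearFlow U) : EI :=
  Integrable.toL1 (fun y => (srcF U y : ℂ)) (Integrable.ofReal hU.int_F)

theorem srcL_ae {U : ℝ → ℝ} (hU : AdmissibleShearFlow U) :
    hU.srcL =ᵐ[mI] fun y => (srcF U y : ℂ) := Integrable.coeFn_toL1 _

theorem est_v0 {U : ℝ → ℝ} (hU : AdmissibleShearFlow U) {η : ℝ} (hη : 0 < η) :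
    ∃ C : ℝ, 0 ≤ C ∧ ∀ μ : ℂ, η ≤ μ.im → ∃ V0 : EI, ∫ y, V0 y ∂mI = PhiInv U μ ∧
    (∀ A : ℂ, ∀ M K : EI →L[ℂ] EI,
      (∀ v : EI, K v =ᵐ[mI] fun y => (Complex.I * ((deriv U y : ℝ) : ℂ)) * ∫ x in (0:ℝ)..y, v x) →
      (∀ v : EI, M v =ᵐ[mI] fun y => (A + Complex.I * (μ - (U y : ℂ))) * v y) →
      (M + K) V0 = A • V0 + Complex.I • hU.srcL) ∧
    ∀ s : ℝ, 0 < s → ∀ Jp Jm : EI →L[ℂ] EI,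
    ‖Jp‖ ≤ 1 → ‖Jm‖ ≤ 1 →
    (∀ v : EI, Jp v =ᵐ[mI] fun y => ∫ x in (0:ℝ)..y, ((s * Real.exp (-s * (y - x)) : ℝ) : ℂ) * v x) →
    (∀ v : EI, Jm v =ᵐ[mI] fun y => ∫ x in Ioi y, ((s * Real.exp (-s * (x - y)) : ℝ) : ℂ) * v x) →
    ‖Jp (Jm V0) - V0‖ ≤ C / s := by
  set I2 := ∫ y, |iteratedDeriv 2 U y| ∂mI
  set I3 := ∫ y, |y * iteratedDeriv 2 U y| ∂mI
  set IF := ∫ y, |srcF U y| ∂mI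
  have hI2 : 0 ≤ I2 := integral_nonneg fun _ => abs_nonneg _
  have hI3 : 0 ≤ I3 := integral_nonneg fun _ => abs_nonneg _
  have hIF : 0 ≤ IF := integral_nonneg fun _ => abs_nonneg _
  refine ⟨2 * (1 / η * I3 + I2 * ((1 / η) ^ 2 * IF)) + 1 / η, by positivity, ?_⟩
  intro μ hημ
  have hμ : 0 < μ.im := hη.trans_le hημ
  have hbb : ∀ y, ‖(μ - (U y : ℂ))⁻¹‖ ≤ 1 / η := fun y =>
    (inv_bd hμ _).trans (one_div_le_one_div_of_le hη hημ)
  have hc := hU.cont_inv hμ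
  have hc1 := hU.cont1
  have hc2 := hU.cont2
  have hcF := hU.contF
  have hFi : Integrable (fun y => (srcF U y : ℂ)) mI := Integrable.ofReal hU.int_F
  set b : ℝ → ℂ := fun y => (μ - (U y : ℂ))⁻¹ with hb
  have hbF : Integrable (fun y => b y * (srcF U y : ℂ)) mI := hU.bI hμ hFi
  have hbbF : Integrable (fun y => b y * (b y * (srcF U y : ℂ))) mI := hU.bI hμ hbF
  set W0 : ℝ → ℂ := fun y => ∫ x in (0:ℝ)..y, b x * (b x * (srcF U x : ℂ)) with hW0
  have hW0d : ∀ y, HasDerivAt W0 (b y * (b y * (srcF U y : ℂ))) y := by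
    intro y
    have hcc : Continuous (fun x => b x * (b x * (srcF U x : ℂ))) := by fun_prop
    exact hcc.integral_hasStrictDerivAt 0 y |>.hasDerivAt
  have hW0c : Continuous W0 := continuous_iff_continuousAt.2 fun y => (hW0d y).continuousAt
  set v0 : ℝ → ℂ := fun y => b y * (srcF U y : ℂ) - ((deriv U y : ℝ) : ℂ) * W0 y with hv0
  set d : ℝ → ℂ := fun y => b y * ((y * iteratedDeriv 2 U y : ℝ) : ℂ)
    - ((iteratedDeriv 2 U y : ℝ) : ℂ) * W0 y with hd
  have hv0d : ∀ y, HasDerivAt v0 (d y) y := by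
    intro y
    have h1 := ((hU.hasDeriv_inv hμ y).mul (hU.hasDerivF y).ofReal_comp).sub
      ((hU.hasDerivC2 y).mul (hW0d y))
    refine h1.congr_deriv ?_
    simp only [hd, hb]; ring
  have hdc : Continuous d := by simp only [hd]; fun_prop
  have hU1i : Integrable (fun y => ((deriv U y : ℝ) : ℂ)) mI := Integrable.ofReal hU.int_U1
  have hU2i : Integrable (fun y => ((iteratedDeriv 2 U y : ℝ) : ℂ)) mI := Integrable.ofReal hU.int_U2
  have hU3i : Integrable (fun y => ((y * iteratedDeriv 2 U y : ℝ) : ℂ)) mI := Integrable.ofReal hU.int_yU2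
  have hv0i : Integrable v0 mI := hbF.sub (mul_prim hU1i hbbF)
  have hdi : Integrable d mI := (hU.bI hμ hU3i).sub (mul_prim hU2i hbbF)
  have hprim : ∀ y, 0 ≤ y → ∫ x in (0:ℝ)..y, v0 x = (μ - (U y : ℂ)) * W0 y := by
    intro y hy
    exact hU.inv1 hμ hbF hy
  have hg : ∀ y, 0 ≤ y → v0 y = μ⁻¹ + ∫ x in (0:ℝ)..y, d x := by
    intro y _
    rw [intervalIntegral.integral_eq_sub_of_hasDerivAt (fun x _ => hv0d x) (hdc.intervalIntegrable _ _)]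
    have : v0 0 = μ⁻¹ := by
      simp [hv0, hb, hW0, srcF, hU.zero_val]
    rw [this]; ring
  have hV0 : hv0i.toL1 v0 =ᵐ[mI] v0 := hv0i.coeFn_toL1
  have hW0b : ∀ y, 0 ≤ y → ‖W0 y‖ ≤ (1 / η) ^ 2 * IF := by
    intro y hy
    refine (prim_bd hbbF hy).trans ?_
    rw [← integral_const_mul]
    apply integral_mono hbbF.norm (Integrable.const_mul (Integrable.abs hU.int_F) _)
    intro x
    simp only [norm_mul, Complex.norm_real, Real.norm_eq_abs]
    have := hbb x
    calc ‖b x‖ * (‖b x‖ * |srcF U x|) ≤ 1 / η * (1 / η * |srcF U x|) := by gcongr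
      _ = _ := by ring
  refine ⟨hv0i.toL1 v0, ?_, ?_, ?_⟩
  · rw [integral_congr_ae hV0]
    have l1 := intervalIntegral_tendsto_integral_Ioi 0 hv0i tendsto_id
    have l2 := intervalIntegral_tendsto_integral_Ioi 0 hbbF tendsto_id
    have l3 : Tendsto (fun y => (μ - (U y : ℂ)) * W0 y) atTop
        (𝓝 ((μ - 1) * ∫ x in Ioi (0:ℝ), b x * (b x * (srcF U x : ℂ)))) := by
      refine Tendsto.mul ?_ l2
      exact tendsto_const_nhds.sub ((Complex.continuous_ofReal.tendsto 1).comp hU.tendsto_one)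
    have l4 := l1.congr' (f₂ := fun y => (μ - (U y : ℂ)) * W0 y) (by
      filter_upwards [eventually_ge_atTop 0] with y hy
      exact hprim y hy)
    rw [tendsto_nhds_unique l4 l3, phi_eq]
    congr 2
    ext x
    simp only [hb]; ring
  · intro A M K hK hM
    apply Lp.ext
    set V0 := hv0i.toL1 v0
    filter_upwards [Lp.coeFn_add (M V0) (K V0), Lp.coeFn_add (A • V0) (Complex.I • hU.srcL),
      Lp.coeFn_smul A V0, Lp.coeFn_smul Complex.I hU.srcL, hU.srcL_ae, hK V0, hM V0, hV0,
      ae_restrict_mem measurableSet_Ioi] with y h1 h2 h3 h4 h5 h6 h7 h8 hy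
    have hy' : 0 ≤ y := le_of_lt hy
    rw [_root_.add_apply, h1, Pi.add_apply, h2, Pi.add_apply, h3, h4, Pi.smul_apply, Pi.smul_apply, h5,
      h6, h7, h8, prim_congr hV0 hy', hprim y hy', smul_eq_mul, smul_eq_mul]
    have hbm : (μ - (U y : ℂ)) * b y = 1 := mul_inv_cancel₀ (sub_ne hμ _)
    simp only [hv0]
    linear_combination (Complex.I * (srcF U y : ℂ)) * hbm
  · intro s hs Jp Jm hp hm hJp hJm
    have hJ := JJ_est hs hp hm hJp hJm hdi hv0i hg
    refine hJ.trans (div_le_div_of_nonneg_right ?_ hs.le)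
    have hn : ‖μ⁻¹‖ ≤ 1 / η := by
      have := hbb 0
      rw [hU.zero_val] at this
      simpa using this
    have hdn : ∫ y, ‖d y‖ ∂mI ≤ 1 / η * I3 + I2 * ((1 / η) ^ 2 * IF) := by
      rw [← integral_const_mul, ← integral_mul_const, ← integral_add
        (Integrable.const_mul (Integrable.abs hU.int_yU2) _)
        (Integrable.mul_const (Integrable.abs hU.int_U2) _)]
      apply integral_mono_ae hdi.norm ((Integrable.const_mul (Integrable.abs hU.int_yU2) _).add
        (Integrable.mul_const (Integrable.abs hU.int_U2) _))
      filter_upwards [ae_restrict_mem measurableSet_Ioi] with y hy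
      refine (norm_sub_le _ _).trans ?_
      rw [norm_mul, norm_mul, Complex.norm_real, Complex.norm_real, Real.norm_eq_abs, Real.norm_eq_abs]
      refine add_le_add ?_ ?_
      · exact mul_le_mul_of_nonneg_right (hbb y) (abs_nonneg _)
      · exact mul_le_mul_of_nonneg_left (hW0b y (le_of_lt hy)) (abs_nonneg _)
    linarith

end AdmissibleShearFlow
end

noncomputable section
open Topology

theorem exists_intCLM : ∃ l : EI →L[ℂ] ℂ, (∀ v : EI, l v = ∫ y, v y ∂mI) ∧ ∀ v, ‖l v‖ ≤ ‖v‖ := by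
  let l0 : EI →ₗ[ℂ] ℂ :=
    { toFun := fun v => ∫ y, v y ∂mI
      map_add' := by
        intro u v
        rw [← integral_add u.int v.int]
        exact integral_congr_ae (Lp.coeFn_add u v)
      map_smul' := by
        intro c v
        simp only [RingHom.id_apply, smul_eq_mul]
        rw [← integral_const_mul]
        exact integral_congr_ae (Lp.coeFn_smul c v) }
  have hb : ∀ v, ‖l0 v‖ ≤ 1 * ‖v‖ := by
    intro v
    rw [one_mul, EI.norm_eq]
    exact norm_integral_le_integral_norm _
  exact ⟨l0.mkContinuous 1 hb, fun v => rfl, fun v => by simpa using hb v⟩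

theorem norm_symbol {μ : ℂ} {A η B u : ℝ} (hη : 0 < η) (hμ : η ≤ μ.im) (hB : ‖μ‖ + 1 ≤ B)
    (hu : |u| ≤ 1) (hA : A * η = B ^ 2) :
    ‖(A : ℂ) + Complex.I * (μ - (u : ℂ))‖ ≤ Real.sqrt (A ^ 2 - B ^ 2) := by
  apply Real.le_sqrt_of_sq_le
  rw [Complex.sq_norm, Complex.normSq_apply]
  have h1 : ‖μ - (u : ℂ)‖ ≤ B := by
    refine (norm_sub_le _ _).trans ?_
    rw [Complex.norm_real, Real.norm_eq_abs]
    linarith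
  have h2 : ‖μ - (u : ℂ)‖ ^ 2 ≤ B ^ 2 := pow_le_pow_left₀ (norm_nonneg _) h1 2
  rw [Complex.sq_norm, Complex.normSq_apply] at h2
  simp at h2 ⊢
  have hA0 : 0 ≤ A := by
    by_contra hcon
    push Not at hcon
    nlinarith [sq_nonneg B]
  nlinarith [mul_le_mul_of_nonneg_left hμ hA0]

namespace AdmissibleShearFlow

theorem visc {U : ℝ → ℝ} (hU : AdmissibleShearFlow U) {η B : ℝ} (hη : 0 < η) (hB : 0 < B) :
    ∃ A : ℝ, 0 < A ∧ ∃ C : ℝ, 0 ≤ C ∧ ∃ s0 : ℝ, ∀ s : ℝ, 0 < s → s0 ≤ s →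
    ∃ V : ℂ → EI, ∀ μ : ℂ, η ≤ μ.im → ‖μ‖ + 1 ≤ B →
      DifferentiableAt ℂ (fun μ => ∫ y, V μ y ∂mI) μ ∧
      ‖(∫ y, V μ y ∂mI) - PhiInv U μ‖ ≤ C / s ∧
      ∃ H : EI, (H =ᵐ[mI] fun y => (A : ℂ)⁻¹ * (((A : ℂ) + Complex.I * (μ - (U y : ℂ))) * V μ y
          + Complex.I * ((deriv U y : ℝ) : ℂ) * (∫ x in (0:ℝ)..y, V μ x) - Complex.I * (srcF U y : ℂ))) ∧
        V μ =ᵐ[mI] fun y => ((Real.exp (-s * y) : ℝ) : ℂ) +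
          ∫ x in (0:ℝ)..y, ((s * Real.exp (-s * (y - x)) : ℝ) : ℂ) *
            ∫ z in Ioi x, ((s * Real.exp (-s * (z - x)) : ℝ) : ℂ) * H z := by
  obtain ⟨CB, hCB, hestB⟩ := hU.est_B hη
  obtain ⟨C0, hC0, hest0⟩ := hU.est_v0 hη
  obtain ⟨l, hl, hln⟩ := exists_intCLM
  have hcU := hU.cont
  have hc1 := hU.cont1
  set A : ℝ := B ^ 2 / η with hAdef
  have hA : 0 < A := by positivity
  have hAη : A * η = B ^ 2 := by rw [hAdef]; field_simp
  have hAc : (A : ℂ) ≠ 0 := by exact_mod_cast hA.ne'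
  set c : ℝ := Real.sqrt (A ^ 2 - B ^ 2) with hc
  have hcA : c < A := by
    rw [hc, Real.sqrt_lt' hA]
    have : 0 < B ^ 2 := by positivity
    linarith
  set ρ : ℝ := c / A with hρ
  have hρ1 : ρ < 1 := (div_lt_one hA).2 hcA
  set p : ℝ := 1 + 1 / η with hp
  have hp0 : 0 ≤ p := by positivity
  have hρi : 0 ≤ (1 - ρ)⁻¹ := _root_.inv_nonneg.2 (by linarith)
  refine ⟨A, hA, 2 * p * (1 - ρ)⁻¹ * (1 + C0), by positivity, 2 * p * (1 - ρ)⁻¹ * CB, ?_⟩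
  intro s hs hs0
  obtain ⟨Jp, hp1, hJp⟩ := exists_Jp hs
  obtain ⟨Jm, hm1, hJm⟩ := exists_Jm hs
  obtain ⟨K, -, hK0⟩ := exists_volOp (fun y => Complex.I * ((deriv U y : ℝ) : ℂ)) (fun _ => 1)
    (by fun_prop) ((Integrable.ofReal hU.int_U1).const_mul _) continuous_const (Q := 1) zero_le_one (by simp)
  have hK : ∀ v : EI, K v =ᵐ[mI] fun y => (Complex.I * ((deriv U y : ℝ) : ℂ)) * ∫ x in (0:ℝ)..y, v x := by
    simpa using hK0
  obtain ⟨M0, -, hM0⟩ := exists_mulOp (fun y => (A : ℂ) - Complex.I * (U y : ℂ)) (by fun_prop)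
    (C := A + 1) (by positivity) (fun y hy => by
      refine (norm_sub_le _ _).trans ?_
      rw [norm_mul, Complex.norm_I, one_mul, Complex.norm_real, Complex.norm_real,
        Real.norm_of_nonneg hA.le, Real.norm_of_nonneg (hU.nonneg hy.le)]
      linarith [hU.lt_one hy.le])
  set R : EI →L[ℂ] EI := (A : ℂ)⁻¹ • (Jp * Jm) with hR
  have hAR : (A : ℂ) • R = Jp * Jm := by rw [hR, smul_smul, mul_inv_cancel₀ hAc, one_smul]
  have hRn : ‖R‖ ≤ A⁻¹ := by
    rw [hR, norm_smul, norm_inv, Complex.norm_real, Real.norm_of_nonneg hA.le]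
    have : ‖Jp * Jm‖ ≤ 1 := (norm_mul_le _ _).trans (by nlinarith [norm_nonneg Jp, norm_nonneg Jm])
    calc _ ≤ A⁻¹ * 1 := by gcongr
      _ = _ := mul_one _
  set X : EI := (exp_L1 hs).1.toL1 _ with hX
  have hXae : X =ᵐ[mI] fun y => ((Real.exp (-s * y) : ℝ) : ℂ) := (exp_L1 hs).1.coeFn_toL1
  have hXn : ‖X‖ = 1 / s := (EI.norm_toL1 _).trans (exp_L1 hs).2
  set T : ℂ → (EI →L[ℂ] EI) := fun μ => 1 - R * (M0 + (Complex.I * μ) • 1 + K) with hT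
  set f : EI := X - Complex.I • R hU.srcL with hf
  refine ⟨fun μ => Ring.inverse (T μ) f, ?_⟩
  intro μ hημ hμB
  have hμ : 0 < μ.im := hη.trans_le hημ
  obtain ⟨M, hMn, hM⟩ := exists_mulOp (fun y => (A : ℂ) + Complex.I * (μ - (U y : ℂ))) (by fun_prop)
    (C := c) (Real.sqrt_nonneg _) (fun y hy => norm_symbol hη hημ hμB (by
      rw [abs_of_nonneg (hU.nonneg hy.le)]; exact (hU.lt_one hy.le).le) hAη)
  have hMM : M = M0 + (Complex.I * μ) • 1 := by
    ext1 v
    apply Lp.ext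
    filter_upwards [hM v, hM0 v, Lp.coeFn_add (M0 v) ((Complex.I * μ) • v),
      Lp.coeFn_smul (Complex.I * μ) v] with y h1 h2 h3 h4
    rw [h1, _root_.add_apply, _root_.smul_apply, one_apply_eq_self, h3, Pi.add_apply, h2, h4, Pi.smul_apply,
      smul_eq_mul]
    ring
  obtain ⟨S, P, hAS, hP1, hP2, hPn, hSK⟩ := hU.op_rel hμ hK hM
  have hPn' : ‖P‖ ≤ p := hPn.trans (by
    rw [hp]; gcongr)
  have hRM : ‖R * M‖ ≤ ρ := by
    refine (norm_mul_le _ _).trans ?_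
    calc _ ≤ A⁻¹ * c := mul_le_mul hRn hMn (norm_nonneg _) (by positivity)
      _ = _ := by rw [hρ]; ring
  have hE := hestB μ hημ s hs Jp Jm (S * K) hp1 hm1 hJp hJm hSK
  rw [← hAR] at hE
  obtain ⟨u, hu, hun⟩ := unit_lemma EI.norm_one_le hAS hP1 hP2 hRM hρ1 hPn' hE (by
    rw [mul_div_assoc', div_le_iff₀ hs]; linarith)
  have huT : (u : EI →L[ℂ] EI) = T μ := by rw [hu, hT, hMM]
  have hinv : Ring.inverse (T μ) = ((u⁻¹ : (EI →L[ℂ] EI)ˣ) : EI →L[ℂ] EI) := by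
    rw [← huT, Ring.inverse_unit]
  set v : EI := Ring.inverse (T μ) f with hv
  have hTv : T μ v = f := by
    rw [hv, hinv, ← huT, ← mul_apply_eq_comp, u.mul_inv, one_apply_eq_self]
  obtain ⟨V0, hV0i, hV0e, hV0J⟩ := hest0 μ hημ
  refine ⟨?_, ?_, ?_⟩
  · have h1 : DifferentiableAt ℂ (fun μ => Ring.inverse (T μ)) μ := by
      have hTd : DifferentiableAt ℂ T μ := by
        rw [hT]
        have : DifferentiableAt ℂ (fun μ : ℂ => M0 + (Complex.I * μ) • (1 : EI →L[ℂ] EI) + K) μ := by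
          fun_prop
        exact (differentiableAt_const _).sub ((differentiableAt_const R).mul this)
      have hi : DifferentiableAt ℂ (Ring.inverse : (EI →L[ℂ] EI) → _) (T μ) := by
        rw [← huT]; exact differentiableAt_inverse u.isUnit
      exact hi.comp μ hTd
    have h2 : (fun μ => ∫ y, (Ring.inverse (T μ) f) y ∂mI) = fun μ => l (Ring.inverse (T μ) f) := by
      ext z; exact (hl _).symm
    rw [h2]
    exact l.differentiableAt.comp μ (h1.clm_apply (differentiableAt_const f))
  · have e1 : (∫ y, v y ∂mI) - PhiInv U μ = l (v - V0) := by
      rw [map_sub, hl, hl, hV0i]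
    rw [e1]
    refine (hln _).trans ?_
    have e2 : T μ (v - V0) = X + (Jp (Jm V0) - V0) := by
      have h3 : T μ V0 = V0 - R ((M + K) V0) := by rw [hT, hMM]; rfl
      rw [map_sub, hTv, h3, hV0e A M K hK hM, map_add, map_smul, map_smul, hf]
      have h4 : (A : ℂ) • R V0 = Jp (Jm V0) := by
        rw [← _root_.smul_apply, hAR]; rfl
      rw [h4]; abel
    have e3 : v - V0 = ((u⁻¹ : (EI →L[ℂ] EI)ˣ) : EI →L[ℂ] EI) (X + (Jp (Jm V0) - V0)) := by
      rw [← e2, ← huT, ← mul_apply_eq_comp, u.inv_mul, one_apply_eq_self]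
    rw [e3]
    refine (ContinuousLinearMap.le_of_opNorm_le _ hun _).trans ?_
    rw [mul_div_assoc]
    refine mul_le_mul_of_nonneg_left ?_ (by positivity)
    refine (norm_add_le _ _).trans ?_
    rw [hXn, add_div]
    exact add_le_add le_rfl (hV0J s hs Jp Jm hp1 hm1 hJp hJm)
  · set H : EI := (A : ℂ)⁻¹ • ((M v + K v) - Complex.I • hU.srcL) with hH
    refine ⟨H, ?_, ?_⟩
    · filter_upwards [Lp.coeFn_smul (A : ℂ)⁻¹ ((M v + K v) - Complex.I • hU.srcL),
        Lp.coeFn_sub (M v + K v) (Complex.I • hU.srcL), Lp.coeFn_add (M v) (K v),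
        Lp.coeFn_smul Complex.I hU.srcL, hU.srcL_ae, hM v, hK v] with y h1 h2 h3 h4 h5 h6 h7
      rw [hH, h1, Pi.smul_apply, h2, Pi.sub_apply, h3, Pi.add_apply, h4, Pi.smul_apply, h5, h6, h7,
        smul_eq_mul, smul_eq_mul]
    · have e1 : v = X + Jp (Jm H) := by
        have h3 : T μ v = v - R ((M + K) v) := by rw [hT, hMM]; rfl
        have h4 : v = f + R (M v + K v) := by
          rw [← hTv, h3]; simp
        have h5 : Jp (Jm H) = R (M v + K v) - Complex.I • R hU.srcL := by
          have h6 : ∀ w, R w = (A : ℂ)⁻¹ • Jp (Jm w) := fun w => rfl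
          rw [hH, map_smul, map_smul, map_sub, map_sub, map_smul, map_smul, h6, h6, smul_sub, smul_comm]
        rw [h5]
        nth_rw 1 [h4]
        rw [hf]; abel
      have hcg : (fun x => ((s : ℝ) : ℂ) * Jm H x) =ᵐ[mI] fun x => ((s : ℝ) : ℂ) *
          ∫ z in Ioi x, ((s * Real.exp (-s * (z - x)) : ℝ) : ℂ) * H z := by
        filter_upwards [hJm H] with x hx
        rw [hx]
      have hae : v =ᵐ[mI] fun y => X y + Jp (Jm H) y := by
        have := Lp.coeFn_add X (Jp (Jm H))
        rw [← e1] at this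
        exact this
      filter_upwards [hae, hXae, hJp (Jm H), ae_restrict_mem measurableSet_Ioi] with y h1 h2 h3 hy
      rw [h1, h2, h3]
      congr 1
      apply prim_congr _ (le_of_lt hy)
      filter_upwards [hJm H] with x hx
      rw [hx]

end AdmissibleShearFlow
end

noncomputable section
open Topology

theorem ode_ext {E : Type*} [NormedAddCommGroup E] [NormedSpace ℝ E] [CompleteSpace E]
    {f : E → E} (hf : ContDiff ℝ (⊤ : ℕ∞) f) {X : ℝ → E}
    (hX : ∀ t, 0 ≤ t → HasDerivWithinAt X (f (X t)) (Ici t) t)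
    (hX' : ∀ t, 0 < t → HasDerivAt X (f (X t)) t) :
    ∃ Z : ℝ → E, ContDiff ℝ (⊤ : ℕ∞) Z ∧ (∀ t, 0 ≤ t → Z t = X t) ∧
      ∃ δ : ℝ, 0 < δ ∧ ∀ t, -δ < t → HasDerivAt Z (f (Z t)) t := by
  have hf1 : ContDiffAt ℝ 1 f (X 0) := (hf.of_le (by exact_mod_cast le_top)).contDiffAt
  obtain ⟨α, hα0, r, hr, hα⟩ :=
    hf1.exists_forall_mem_closedBall_exists_eq_forall_mem_Ioo_hasDerivAt₀ 0
  rw [zero_sub, zero_add] at hα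
  classical
  let Y : ℝ → E := fun t => if t < 0 then α t else X t
  have Yneg : ∀ t, t < 0 → Y t = α t := fun t ht => if_pos ht
  have Ypos : ∀ t, 0 ≤ t → Y t = X t := fun t ht => if_neg (not_lt.2 ht)
  have hY : ∀ t, -r < t → HasDerivAt Y (f (Y t)) t := by
    intro t ht
    rcases lt_trichotomy t 0 with h | h | h
    · rw [Yneg t h]
      refine (hα t ⟨ht, h.trans hr⟩).congr_of_eventuallyEq ?_
      filter_upwards [Iio_mem_nhds h] with x hx using Yneg x hx
    · subst h
      rw [Ypos 0 le_rfl]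
      have h1 : HasDerivWithinAt Y (f (X 0)) (Ici 0) 0 :=
        (hX 0 le_rfl).congr (fun x hx => Ypos x hx) (Ypos 0 le_rfl)
      have h2 : HasDerivWithinAt Y (f (X 0)) (Iic 0) 0 := by
        have := (hα 0 ⟨by linarith, hr⟩).hasDerivWithinAt (s := Iic 0)
        rw [hα0] at this
        refine this.congr (fun x hx => ?_) (by rw [Ypos 0 le_rfl, hα0])
        rcases lt_or_eq_of_le (show x ≤ 0 from hx) with h | h
        · exact Yneg x h
        · rw [h, Ypos 0 le_rfl, hα0]
      have := h2.union h1
      rw [Iic_union_Ici] at this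
      exact this.hasDerivAt univ_mem
    · rw [Ypos t h.le]
      refine (hX' t h).congr_of_eventuallyEq ?_
      filter_upwards [Ioi_mem_nhds h] with x hx using Ypos x (le_of_lt hx)
  have hYs : ContDiffOn ℝ (⊤ : ℕ∞) Y (Ioi (-r)) := by
    refine contDiffOn_infty.2 ?_
    intro n
    induction n with
    | zero =>
      exact_mod_cast contDiffOn_zero.2 fun t ht => (hY t ht).continuousAt.continuousWithinAt
    | succ n ih =>
      have := (contDiffOn_succ_iff_deriv_of_isOpen (𝕜 := ℝ) (n := (n : WithTop ℕ∞)) (f := Y) (isOpen_Ioi (a := -r))).2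
        ⟨fun t ht => (hY t ht).differentiableAt.differentiableWithinAt, by simp, ?_⟩
      · exact_mod_cast this
      · have hh : ContDiffOn ℝ (n : WithTop ℕ∞) (fun t => f (Y t)) (Ioi (-r)) :=
          (hf.of_le (by exact_mod_cast le_top)).comp_contDiffOn ih
        exact hh.congr fun t ht => (hY t ht).deriv
  let c : ℝ → ℝ := fun t => Real.smoothTransition ((3 * t + 2 * r) / r)
  have hc : ContDiff ℝ (⊤ : ℕ∞) c := by
    refine Real.smoothTransition.contDiff.comp ?_
    fun_prop
  have c1 : ∀ t, -(r / 3) ≤ t → c t = 1 := fun t ht =>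
    Real.smoothTransition.one_of_one_le ((le_div_iff₀ hr).2 (by linarith))
  have c0 : ∀ t, t ≤ -(2 * r / 3) → c t = 0 := fun t ht =>
    Real.smoothTransition.zero_of_nonpos (div_nonpos_of_nonpos_of_nonneg (by linarith) hr.le)
  refine ⟨fun t => c t • Y t, ?_, ?_, r / 3, by positivity, ?_⟩
  · refine contDiff_iff_contDiffAt.2 fun t => ?_
    by_cases ht : -r < t
    · exact hc.contDiffAt.smul (hYs.contDiffAt (Ioi_mem_nhds ht))
    · refine (contDiffAt_const (c := (0 : E))).congr_of_eventuallyEq ?_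
      have : t < -(2 * r / 3) := by linarith
      filter_upwards [Iio_mem_nhds this] with x hx
      rw [c0 x (le_of_lt hx), zero_smul]
  · intro t ht
    simp only []
    rw [c1 t (by linarith), one_smul, Ypos t ht]
  · intro t ht
    have : (fun t => c t • Y t) =ᶠ[𝓝 t] Y := by
      filter_upwards [Ioi_mem_nhds ht] with x hx
      rw [c1 x (le_of_lt hx), one_smul]
    have h2 := (hY t (by linarith)).congr_of_eventuallyEq this
    exact h2.congr_deriv (congrArg f this.eq_of_nhds.symm)

end

noncomputable section
open Topology

theorem hasDerivAt_expC (s y : ℝ) :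
    HasDerivAt (fun y : ℝ => ((Real.exp (s * y) : ℝ) : ℂ)) ((s : ℂ) * ((Real.exp (s * y) : ℝ) : ℂ)) y := by
  have h : HasDerivAt (fun y : ℝ => Real.exp (s * y)) (Real.exp (s * y) * s) y := by
    simpa using ((hasDerivAt_id y).const_mul s).exp
  refine h.ofReal_comp.congr_deriv ?_
  push_cast; ring

theorem exp_cancel (s y : ℝ) : ((Real.exp (-s * y) : ℝ) : ℂ) * ((Real.exp (s * y) : ℝ) : ℂ) = 1 := by
  rw [← Complex.ofReal_mul, ← Real.exp_add, show -s * y + s * y = 0 by ring, Real.exp_zero, Complex.ofReal_one]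

theorem exp_split (s x y : ℝ) : ((s * Real.exp (-s * (y - x)) : ℝ) : ℂ) =
    (s : ℂ) * ((Real.exp (-s * y) : ℝ) : ℂ) * ((Real.exp (s * x) : ℝ) : ℂ) := by
  rw [show -s * (y - x) = -s * y + s * x by ring, Real.exp_add]
  push_cast; ring

theorem Jm_formula {s : ℝ} (hs : 0 < s) {H : ℝ → ℂ} (hH : Integrable H mI) {y : ℝ} (hy : 0 ≤ y) :
    Integrable (fun z => ((Real.exp (-s * z) : ℝ) : ℂ) * H z) mI ∧
    ∫ z in Ioi y, ((s * Real.exp (-s * (z - y)) : ℝ) : ℂ) * H z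
      = (s : ℂ) * ((Real.exp (s * y) : ℝ) : ℂ) * ((∫ z in Ioi (0:ℝ), ((Real.exp (-s * z) : ℝ) : ℂ) * H z)
        - ∫ z in (0:ℝ)..y, ((Real.exp (-s * z) : ℝ) : ℂ) * H z) := by
  have hi : Integrable (fun z => ((Real.exp (-s * z) : ℝ) : ℂ) * H z) mI := by
    refine hH.bdd_mul (c := 1) (by fun_prop) ?_
    filter_upwards [ae_restrict_mem measurableSet_Ioi] with z hz
    rw [Complex.norm_real, Real.norm_eq_abs, Real.abs_exp]
    refine Real.exp_le_one_iff.2 ?_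
    have : 0 < s * z := mul_pos hs hz
    linarith
  refine ⟨hi, ?_⟩
  have h1 := intervalIntegral.integral_interval_add_Ioi (a := 0) (b := y) (μ := volume)
    (f := fun z => ((Real.exp (-s * z) : ℝ) : ℂ) * H z) hi (IntegrableOn.mono_set hi (Ioi_subset_Ioi hy))
  rw [← h1, add_sub_cancel_left, ← integral_const_mul]
  refine integral_congr_ae (Eventually.of_forall fun z => ?_)
  simp only [exp_split]
  ring

theorem reg1 {s : ℝ} (hs : 0 < s) {v H : EI} {a b f : ℝ → ℂ} (ha : Continuous a) (hb : Continuous b)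
    (hf : Continuous f)
    (hH : H =ᵐ[mI] fun y => a y * v y + b y * (∫ x in (0:ℝ)..y, v x) + f y)
    (hv : v =ᵐ[mI] fun y => ((Real.exp (-s * y) : ℝ) : ℂ) +
          ∫ x in (0:ℝ)..y, ((s * Real.exp (-s * (y - x)) : ℝ) : ℂ) *
            ∫ z in Ioi x, ((s * Real.exp (-s * (z - x)) : ℝ) : ℂ) * H z) :
    ∃ φ V W : ℝ → ℂ, φ 0 = 0 ∧ V 0 = 1 ∧
      (∀ t, 0 ≤ t → HasDerivAt φ (V t) t ∧ HasDerivAt V ((s : ℂ) * (W t - V t)) t ∧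
        HasDerivAt W ((s : ℂ) * (W t - (a t * V t + b t * φ t + f t))) t) ∧
      Tendsto V atTop (𝓝 0) ∧ Tendsto φ atTop (𝓝 (∫ y, v y ∂mI)) := by
  have hce : Continuous (fun y : ℝ => ((Real.exp (s * y) : ℝ) : ℂ)) := by fun_prop
  have hcm : Continuous (fun y : ℝ => ((Real.exp (-s * y) : ℝ) : ℂ)) := by fun_prop
  obtain ⟨c, hc⟩ : ∃ c : ℂ, c = ∫ z in Ioi (0:ℝ), ((Real.exp (-s * z) : ℝ) : ℂ) * H z := ⟨_, rfl⟩
  have hprim : ∀ {g : ℝ → ℂ}, Continuous g → ∀ y, HasDerivAt (fun y => ∫ x in (0:ℝ)..y, g x) (g y) y :=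
    fun hg y => (hg.integral_hasStrictDerivAt 0 y).hasDerivAt
  have hprimc : ∀ {g : ℝ → ℂ}, Continuous g → Continuous (fun y => ∫ x in (0:ℝ)..y, g x) :=
    fun hg => continuous_iff_continuousAt.2 fun y => (hprim hg y).continuousAt
  -- continuous version of the inner integral
  obtain ⟨W0, hW0c, hW0⟩ : ∃ W0 : ℝ → ℂ, Continuous W0 ∧ ∀ y, 0 ≤ y →
      ∫ z in Ioi y, ((s * Real.exp (-s * (z - y)) : ℝ) : ℂ) * H z = W0 y := by
    have hi := (Jm_formula hs H.int le_rfl).1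
    have h1 : Integrable ((Ioi 0).indicator fun z => ((Real.exp (-s * z) : ℝ) : ℂ) * H z) :=
      (integrable_indicator_iff measurableSet_Ioi).2 hi
    refine ⟨fun y => (s : ℂ) * ((Real.exp (s * y) : ℝ) : ℂ) * (c -
      ∫ z in (0:ℝ)..y, (Ioi 0).indicator (fun z => ((Real.exp (-s * z) : ℝ) : ℂ) * H z) z), ?_, ?_⟩
    · exact (continuous_const.mul hce).mul (continuous_const.sub
        (intervalIntegral.continuous_primitive (fun a b => h1.intervalIntegrable) 0))
    · intro y hy
      rw [(Jm_formula hs H.int hy).2, hc]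
      congr 2
      refine prim_congr ?_ hy
      filter_upwards [ae_restrict_mem measurableSet_Ioi] with z hz
      rw [indicator_of_mem hz]
  -- the outer integral
  let K : (ℝ → ℂ) → ℝ → ℂ := fun w y => ((Real.exp (-s * y) : ℝ) : ℂ) * (1 +
    ∫ x in (0:ℝ)..y, (s : ℂ) * ((Real.exp (s * x) : ℝ) : ℂ) * w x)
  have hK : ∀ {w : ℝ → ℂ}, Continuous w → ∀ y, HasDerivAt (K w) ((s : ℂ) * (w y - K w y)) y := by
    intro w hw y
    have h1 := hprim (g := fun x => (s : ℂ) * ((Real.exp (s * x) : ℝ) : ℂ) * w x) (by fun_prop) y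
    have h2 := (hasDerivAt_expC (-s) y).mul (h1.const_add 1)
    refine h2.congr_deriv ?_
    simp only [K]
    have := exp_cancel s y
    push_cast at this ⊢
    linear_combination (s : ℂ) * w y * this
  have hKc : ∀ {w : ℝ → ℂ}, Continuous w → Continuous (K w) :=
    fun hw => continuous_iff_continuousAt.2 fun y => (hK hw y).continuousAt
  have hKcongr : ∀ {w w' : ℝ → ℂ}, (∀ y, 0 ≤ y → w y = w' y) → ∀ y, 0 ≤ y → K w y = K w' y := by
    intro w w' h y hy
    simp only [K]
    congr 2
    refine intervalIntegral.integral_congr fun x hx => ?_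
    rw [uIcc_of_le hy] at hx
    simp only [h x hx.1]
  have hv0 : v =ᵐ[mI] K W0 := by
    filter_upwards [hv, ae_restrict_mem measurableSet_Ioi] with y h hy
    rw [h]
    simp only [K]
    rw [mul_add, mul_one, ← intervalIntegral.integral_const_mul]
    congr 1
    refine intervalIntegral.integral_congr fun x hx => ?_
    rw [uIcc_of_le (le_of_lt hy)] at hx
    simp only [hW0 x hx.1]
    rw [exp_split]
    ring
  have hV0c := hKc hW0c
  let h0 : ℝ → ℂ := fun y => a y * K W0 y + b y * (∫ x in (0:ℝ)..y, K W0 x) + f y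
  have hh0c : Continuous h0 := ((ha.mul hV0c).add (hb.mul (hprimc hV0c))).add hf
  have hH0 : H =ᵐ[mI] h0 := by
    filter_upwards [hH, hv0, ae_restrict_mem measurableSet_Ioi] with y h1 h2 hy
    rw [h1, h2, prim_congr hv0 (le_of_lt hy)]
  let W : ℝ → ℂ := fun y => (s : ℂ) * ((Real.exp (s * y) : ℝ) : ℂ) * (c -
      ∫ z in (0:ℝ)..y, ((Real.exp (-s * z) : ℝ) : ℂ) * h0 z)
  have hWd : ∀ y, HasDerivAt W ((s : ℂ) * (W y - h0 y)) y := by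
    intro y
    have h1 := hprim (g := fun z => ((Real.exp (-s * z) : ℝ) : ℂ) * h0 z) (by fun_prop) y
    have h2 := ((hasDerivAt_expC s y).const_mul (s : ℂ)).mul (h1.const_sub c)
    refine h2.congr_deriv ?_
    simp only [W]
    have := exp_cancel s y
    push_cast at this ⊢
    linear_combination -(s : ℂ) * h0 y * this
  have hWc : Continuous W := continuous_iff_continuousAt.2 fun y => (hWd y).continuousAt
  have hWW0 : ∀ y, 0 ≤ y → W y = W0 y := by
    intro y hy
    rw [← hW0 y hy, (Jm_formula hs H.int hy).2, ← hc]
    simp only [W]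
    congr 2
    refine prim_congr ?_ hy
    filter_upwards [hH0] with z hz
    rw [hz]
  have hVV0 : ∀ y, 0 ≤ y → K W y = K W0 y := hKcongr hWW0
  have hvV : v =ᵐ[mI] K W := by
    filter_upwards [hv0, ae_restrict_mem measurableSet_Ioi] with y h hy
    rw [h, hVV0 y (le_of_lt hy)]
  have hVint : Integrable (K W) mI := v.int.congr hvV
  have hWint : Integrable W mI := by
    obtain ⟨T, -, hT⟩ := exists_Jm hs
    refine (T H).int.congr ?_
    filter_upwards [hT H, ae_restrict_mem measurableSet_Ioi] with y h hy
    rw [h, hW0 y (le_of_lt hy), hWW0 y (le_of_lt hy)]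
  have hφ0 : ∀ y, 0 ≤ y → ∫ x in (0:ℝ)..y, K W x = ∫ x in (0:ℝ)..y, K W0 x := by
    intro y hy
    refine intervalIntegral.integral_congr fun x hx => ?_
    rw [uIcc_of_le hy] at hx
    exact hVV0 x hx.1
  refine ⟨fun y => ∫ x in (0:ℝ)..y, K W x, K W, W, by simp, by simp [K], ?_, ?_, ?_⟩
  · intro t ht
    refine ⟨hprim (hKc hWc) t, hK hWc t, (hWd t).congr_deriv ?_⟩
    simp only [h0]
    rw [hφ0 t ht, hVV0 t ht]
  · exact tendsto_zero_of_hasDerivAt_of_integrableOn_Ioi (a := 0) (fun x _ => hK hWc x)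
      ((hWint.sub hVint).const_mul (s : ℂ)) hVint
  · rw [integral_congr_ae hvV]
    exact intervalIntegral_tendsto_integral_Ioi 0 hVint tendsto_id

end

noncomputable section
open Topology

theorem AdmissibleShearFlow.reg {U : ℝ → ℝ} (hU : AdmissibleShearFlow U) {A s k : ℝ} (hA : 0 < A)
    (hs : 0 < s) (hk : 0 < k) (hsk : s ^ 2 = A * k) {μ : ℂ} {v H : EI}
    (hH : H =ᵐ[mI] fun y => (A : ℂ)⁻¹ * (((A : ℂ) + Complex.I * (μ - (U y : ℂ))) * v y
          + Complex.I * ((deriv U y : ℝ) : ℂ) * (∫ x in (0:ℝ)..y, v x) - Complex.I * (srcF U y : ℂ)))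
    (hv : v =ᵐ[mI] fun y => ((Real.exp (-s * y) : ℝ) : ℂ) +
          ∫ x in (0:ℝ)..y, ((s * Real.exp (-s * (y - x)) : ℝ) : ℂ) *
            ∫ z in Ioi x, ((s * Real.exp (-s * (z - x)) : ℝ) : ℂ) * H z) :
    ∃ φ : ℝ → ℂ, IsEigSolution U μ k (∫ y, v y ∂mI) φ := by
  have hsm := hU.smooth
  have hsm1 := hU.smooth1
  have hof : ContDiff ℝ (⊤ : ℕ∞) (fun x : ℝ => (x : ℂ)) := Complex.ofRealCLM.contDiff
  have hUs : ContDiff ℝ (⊤ : ℕ∞) (fun y => (U y : ℂ)) := hof.comp hsm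
  have hU1s : ContDiff ℝ (⊤ : ℕ∞) (fun y => ((deriv U y : ℝ) : ℂ)) := hof.comp hsm1
  have hFs : ContDiff ℝ (⊤ : ℕ∞) (fun y => (srcF U y : ℂ)) := by
    refine hof.comp ?_
    unfold srcF
    fun_prop
  let a : ℝ → ℂ := fun y => (A : ℂ)⁻¹ * ((A : ℂ) + Complex.I * (μ - (U y : ℂ)))
  let b : ℝ → ℂ := fun y => (A : ℂ)⁻¹ * (Complex.I * ((deriv U y : ℝ) : ℂ))
  let f : ℝ → ℂ := fun y => -((A : ℂ)⁻¹ * (Complex.I * (srcF U y : ℂ)))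
  have ha : ContDiff ℝ (⊤ : ℕ∞) a := by fun_prop
  have hb : ContDiff ℝ (⊤ : ℕ∞) b := by fun_prop
  have hf : ContDiff ℝ (⊤ : ℕ∞) f := by fun_prop
  have hH' : H =ᵐ[mI] fun y => a y * v y + b y * (∫ x in (0:ℝ)..y, v x) + f y := by
    refine hH.trans (Eventually.of_forall fun y => ?_)
    simp only [a, b, f]
    ring
  obtain ⟨φ, V, W, hφ0, hV0, hd, hVt, hφt⟩ := reg1 hs ha.continuous hb.continuous hf.continuous hH' hv
  let G : ℝ × ℂ × ℂ × ℂ → ℝ × ℂ × ℂ × ℂ := fun p => (1, p.2.2.1, (s : ℂ) * (p.2.2.2 - p.2.2.1),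
    (s : ℂ) * (p.2.2.2 - (a p.1 * p.2.2.1 + b p.1 * p.2.1 + f p.1)))
  have hG : ContDiff ℝ (⊤ : ℕ∞) G := by
    have h1 : ContDiff ℝ (⊤ : ℕ∞) (fun p : ℝ × ℂ × ℂ × ℂ => a p.1) := ha.comp contDiff_fst
    have h2 : ContDiff ℝ (⊤ : ℕ∞) (fun p : ℝ × ℂ × ℂ × ℂ => b p.1) := hb.comp contDiff_fst
    have h3 : ContDiff ℝ (⊤ : ℕ∞) (fun p : ℝ × ℂ × ℂ × ℂ => f p.1) := hf.comp contDiff_fst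
    fun_prop
  let X : ℝ → ℝ × ℂ × ℂ × ℂ := fun t => (t, φ t, V t, W t)
  have hX : ∀ t, 0 ≤ t → HasDerivAt X (G (X t)) t := by
    intro t ht
    obtain ⟨h1, h2, h3⟩ := hd t ht
    exact (hasDerivAt_id t).prodMk (h1.prodMk (h2.prodMk h3))
  obtain ⟨Z, hZs, hZX, δ, hδ, hZ⟩ := ode_ext hG (fun t ht => (hX t ht).hasDerivWithinAt)
    (fun t ht => hX t (le_of_lt ht))
  have d1 : ∀ t, -δ < t → HasDerivAt (fun t => (Z t).2.1) (Z t).2.2.1 t := fun t ht =>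
    (hZ t ht).snd.fst
  have d2 : ∀ t, -δ < t → HasDerivAt (fun t => (Z t).2.2.1) ((s : ℂ) * ((Z t).2.2.2 - (Z t).2.2.1)) t :=
    fun t ht => (hZ t ht).snd.snd.fst
  have d3 : ∀ t, -δ < t → HasDerivAt (fun t => (Z t).2.2.2) (G (Z t)).2.2.2 t :=
    fun t ht => (hZ t ht).snd.snd.snd
  have e1 : ∀ t, 0 ≤ t → deriv (fun t => (Z t).2.1) t = V t := by
    intro t ht
    rw [(d1 t (by linarith)).deriv, hZX t ht]
  refine ⟨fun t => (Z t).2.1, hZs.snd.fst, ?_, ?_, ?_, ?_, ?_⟩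
  · intro y hy
    have hy' : -δ < y := by linarith
    have q1 : deriv (fun t => (Z t).2.1) =ᶠ[𝓝 y] fun t => (Z t).2.2.1 := by
      filter_upwards [Ioi_mem_nhds hy'] with t ht using (d1 t ht).deriv
    have q2 : deriv (deriv (fun t => (Z t).2.1)) =ᶠ[𝓝 y]
        fun t => (s : ℂ) * ((Z t).2.2.2 - (Z t).2.2.1) := by
      refine q1.deriv.trans ?_
      filter_upwards [Ioi_mem_nhds hy'] with t ht using (d2 t ht).deriv
    have q3 : iteratedDeriv 3 (fun t => (Z t).2.1) y =
        (s : ℂ) * ((G (Z y)).2.2.2 - (s : ℂ) * ((Z y).2.2.2 - (Z y).2.2.1)) := by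
      rw [iteratedDeriv_succ, iteratedDeriv_succ, iteratedDeriv_one, q2.deriv_eq]
      exact (((d3 y hy').sub (d2 y hy')).const_mul (s : ℂ)).deriv
    rw [q3, e1 y hy, hZX y hy]
    simp only [G, X, a, b, f]
    have hAc : (A : ℂ) ≠ 0 := by exact_mod_cast hA.ne'
    have hkc : (k : ℂ) ≠ 0 := by exact_mod_cast hk.ne'
    have hs2 : (s : ℂ) ^ 2 = A * k := by exact_mod_cast hsk
    have key : (s : ℂ) * ((s : ℂ) * (W y - ((A : ℂ)⁻¹ * ((A : ℂ) + Complex.I * (μ - (U y : ℂ))) * V y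
        + (A : ℂ)⁻¹ * (Complex.I * ((deriv U y : ℝ) : ℂ)) * φ y
        + -((A : ℂ)⁻¹ * (Complex.I * (srcF U y : ℂ))))) - (s : ℂ) * (W y - V y))
        = -(Complex.I * k) * ((μ - (U y : ℂ)) * V y + ((deriv U y : ℝ) : ℂ) * φ y - (srcF U y : ℂ)) := by
      rw [show ∀ x z : ℂ, (s : ℂ) * ((s : ℂ) * x - (s : ℂ) * z) = (s : ℂ) ^ 2 * (x - z) by intros; ring, hs2]
      field_simp
      ring
    rw [key]
    field_simp
    have e0 : (Z y).2.1 = φ y := by rw [hZX y hy]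
    linear_combination ((deriv U y : ℝ) : ℂ) * e0 + ((μ - (U y : ℂ)) * V y + ((deriv U y : ℝ) : ℂ) * φ y - (srcF U y : ℂ)) * Complex.I_sq
  · simp only [hZX 0 le_rfl, X, hφ0]
  · rw [e1 0 le_rfl, hV0]
  · refine hVt.congr' ?_
    filter_upwards [eventually_ge_atTop 0] with t ht using (e1 t ht).symm
  · refine hφt.congr' ?_
    filter_upwards [eventually_ge_atTop 0] with t ht
    rw [hZX t ht]

theorem main_crit (U : ℝ → ℝ) (hU : AdmissibleShearFlow U)
    (hξ : xiEq U 0 = 0) (hξpm : xiPlus U 0 < xiMinus U 0) :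
    ∃ K : ℝ, 0 < K ∧ ∃ η : ℝ, 0 < η ∧ ∃ γp : ℝ, 0 < γp ∧
      ∀ k : ℕ, K ≤ (k : ℝ) → ∀ ν : ℝ, 0 < ν → (Real.sqrt ν * (k : ℝ))⁻¹ ≤ γp →
        ∃ μ : ℂ, η ≤ μ.im ∧ ∃ φ : ℝ → ℂ,
          IsEigSolution U μ (k : ℝ) ((((Real.sqrt ν * (k : ℝ))⁻¹ : ℝ)) : ℂ) φ := by
  obtain ⟨μ₀, r, hr, m, hm, hz, hsph, η, hη, hdisc⟩ := hU.exists_disc hξ hξpm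
  have hB : 0 < ‖μ₀‖ + r + 1 := by positivity
  obtain ⟨A, hA, C, hC, s0, hvisc⟩ := hU.visc hη hB
  let S : ℝ := max s0 (8 * C / m)
  refine ⟨S ^ 2 / A + 1, by positivity, η, hη, m / 16, by positivity, ?_⟩
  intro k hk ν hν hγ
  have hk0 : (0 : ℝ) < k := lt_of_lt_of_le (by positivity) hk
  have hs : 0 < Real.sqrt (A * k) := Real.sqrt_pos.2 (by positivity)
  have hS : S ≤ Real.sqrt (A * k) := by
    apply Real.le_sqrt_of_sq_le
    have : S ^ 2 / A ≤ k := by linarith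
    rw [div_le_iff₀ hA] at this
    linarith
  obtain ⟨V, hV⟩ := hvisc _ hs ((le_max_left _ _).trans hS)
  have hin : ∀ z ∈ Metric.closedBall μ₀ r, ‖z‖ + 1 ≤ ‖μ₀‖ + r + 1 := by
    intro z hz
    have h1 : ‖z - μ₀‖ ≤ r := by simpa [dist_eq_norm] using hz
    have h2 : ‖z‖ ≤ ‖μ₀‖ + ‖z - μ₀‖ := by
      simpa using norm_add_le μ₀ (z - μ₀)
    linarith
  have hCs : C / Real.sqrt (A * k) ≤ m / 8 := by
    rw [div_le_iff₀ hs]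
    have h1 : 8 * C / m ≤ Real.sqrt (A * k) := (le_max_right _ _).trans hS
    rw [div_le_iff₀ hm] at h1
    linarith
  have hL : ‖((((Real.sqrt ν * (k : ℝ))⁻¹ : ℝ)) : ℂ)‖ < m / 8 := by
    rw [Complex.norm_real, Real.norm_eq_abs, abs_of_nonneg (by positivity)]
    linarith
  obtain ⟨μ, hμ, hμL⟩ := hurwitz (f := fun μ => ∫ y, V μ y ∂mI) (H := PhiInv U) hr hm
    (fun z hz => (hV z (hdisc z hz) (hin z hz)).1) hsph hz
    (fun z hz => ((hV z (hdisc z hz) (hin z hz)).2.1).trans hCs) hL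
  refine ⟨μ, hdisc μ hμ, ?_⟩
  obtain ⟨-, -, H, hH, hv⟩ := hV μ (hdisc μ hμ) (hin μ hμ)
  have := hU.reg hA hs hk0 (Real.sq_sqrt (by positivity)) hH hv
  rwa [show (∫ y, V μ y ∂mI) = _ from hμL] at this

end

/-- Theorem (IBL instability under Criterion 2, regime `(√ν k)⁻¹ ≤ γ₊`). -/
theorem ibl_instability_criterion2 (U : ℝ → ℝ) (hU : AdmissibleShearFlow U)
    (hξ : xiEq U 0 = 0) (hξpm : xiPlus U 0 < xiMinus U 0) :
    ∃ K : ℝ, 0 < K ∧ ∃ η : ℝ, 0 < η ∧ ∃ γp : ℝ, 0 < γp ∧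
      ∀ k : ℕ, K ≤ (k : ℝ) → ∀ ν : ℝ, 0 < ν → (Real.sqrt ν * (k : ℝ))⁻¹ ≤ γp →
        ∃ μ : ℂ, η ≤ μ.im ∧ ∃ φ : ℝ → ℂ,
          IsEigSolution U μ (k : ℝ) ((((Real.sqrt ν * (k : ℝ))⁻¹ : ℝ)) : ℂ) φ := by
  exact main_crit U hU hξ hξpm

end
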